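/- arXiv:0906.4374 — 6 statements merged into one kernel-verified Lean document; each statement's English description precedes it below -/
import Mathlib

section
/- Let ζ be a primitive 27th root of unity and let F = ℚ(ζ + ζ⁻¹) be the maximal real subfield of ℚ(ζ₂₇). Then F is a Galois extension of ℚ of degree 9 with cyclic Galois group of order 9, the discriminant of F is 3^22, F is totally real, F has class number 1, and moreover F has strict (narrow) class number 1: for every choice of signs ε(v) ∈ {±1}, one for each of the 9 real embeddings v of F, there exists a unit u of the ring of integers of F with sign(v(u)) = ε(v) for all v. -/
open NumberField IntermediateField

namespace RealCyclotomic27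

open Polynomial

/-- The minimal polynomial of `ψ = 1 + 2 cos (2π / 27)`; it is Eisenstein at `3`. -/
noncomputable def minpolyShift : ℤ[X] :=
  X ^ 9 - 9 * X ^ 8 + 27 * X ^ 7 - 21 * X ^ 6 - 36 * X ^ 5 + 54 * X ^ 4 + 9 * X ^ 3 - 27 * X ^ 2 + 3

theorem minpolyShift_eq : minpolyShift = X ^ 9 + C (-9) * X ^ 8 + C 27 * X ^ 7 + C (-21) * X ^ 6 +
    C (-36) * X ^ 5 + C 54 * X ^ 4 + C 9 * X ^ 3 + C (-27) * X ^ 2 + C 3 := by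
  simp only [minpolyShift, map_neg, map_ofNat]
  ring

theorem natDegree_minpolyShift : minpolyShift.natDegree = 9 := by
  rw [minpolyShift_eq]
  compute_degree!

theorem monic_minpolyShift : minpolyShift.Monic := by
  rw [minpolyShift_eq]
  monicity!

theorem isEisensteinAt_minpolyShift :
    minpolyShift.IsEisensteinAt (Submodule.span ℤ {(3 : ℤ)}) where
  leading := by
    rw [monic_minpolyShift.leadingCoeff]
    exact fun h ↦ absurd (Ideal.mem_span_singleton.1 h) (by norm_num)
  mem {n} hn := by
    rw [natDegree_minpolyShift] at hn
    refine Ideal.mem_span_singleton.2 ?_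
    rw [minpolyShift_eq]
    simp only [coeff_add, coeff_C_mul, coeff_X_pow, coeff_C]
    interval_cases n <;> norm_num
  notMem h := by
    rw [Ideal.submodule_span_eq, Ideal.span_singleton_pow, Ideal.mem_span_singleton,
      minpolyShift_eq] at h
    simp only [coeff_add, coeff_C_mul, coeff_X_pow, coeff_C] at h
    norm_num at h

theorem irreducible_minpolyShift : Irreducible minpolyShift := by
  refine isEisensteinAt_minpolyShift.irreducible ?_ monic_minpolyShift.isPrimitive
    (by simp [natDegree_minpolyShift])
  exact (Ideal.span_singleton_prime (by norm_num)).2 (by norm_num)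

theorem isIntegral_of_root {R : Type*} [Ring R] {ψ : R} (hψ : aeval ψ minpolyShift = 0) :
    IsIntegral ℤ ψ :=
  ⟨_, monic_minpolyShift, by rwa [← aeval_def]⟩

variable {K : Type} [Field K] [NumberField K] {ψ : K}

theorem minpoly_int (hψ : aeval ψ minpolyShift = 0) : minpoly ℤ ψ = minpolyShift := by
  have hint := isIntegral_of_root hψ
  exact eq_of_monic_of_associated (minpoly.monic hint) monic_minpolyShift
    ((minpoly.prime_of_isIntegrallyClosed hint).irreducible.associated_of_dvd
      irreducible_minpolyShift (minpoly.isIntegrallyClosed_dvd hint hψ))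

theorem minpoly_rat (hψ : aeval ψ minpolyShift = 0) :
    minpoly ℚ ψ = minpolyShift.map (algebraMap ℤ ℚ) := by
  rw [minpoly.isIntegrallyClosed_eq_field_fractions' ℚ (isIntegral_of_root hψ), minpoly_int hψ]

theorem norm_sub_gen {F L : Type*} [Field F] [Field L] [Algebra F L] (B : PowerBasis F L) (t : F) :
    Algebra.norm F (algebraMap F L t - B.gen) = (minpoly F B.gen).eval t := by
  rw [← charpoly_leftMulMatrix, Matrix.eval_charpoly, Algebra.norm_eq_matrix_det B.basis, map_sub]
  rw [AlgHom.commutes]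
  rfl

theorem discr_sq (B : PowerBasis ℚ K) (hB : B.gen = ψ) (hψ : aeval ψ minpolyShift = 0) :
    Algebra.discr ℚ B.basis ^ 2 = (3 ^ 22) ^ 2 := by
  have hdeg : Module.finrank ℚ K = 9 := by
    rw [B.finrank, ← B.natDegree_minpoly, hB, minpoly_rat hψ,
      monic_minpolyShift.natDegree_map, natDegree_minpolyShift]
  have hroot : ψ ^ 9 - 9 * ψ ^ 8 + 27 * ψ ^ 7 - 21 * ψ ^ 6 - 36 * ψ ^ 5 + 54 * ψ ^ 4 + 9 * ψ ^ 3
      - 27 * ψ ^ 2 + 3 = 0 := by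
    simpa [minpolyShift, map_ofNat (aeval ψ : ℤ[X] →ₐ[ℤ] K)] using hψ
  have h3 := norm_sub_gen B 3
  have h1 := norm_sub_gen B (-1)
  rw [hB, minpoly_rat hψ] at h1 h3
  simp only [minpolyShift, Polynomial.map_add, Polynomial.map_sub, Polynomial.map_mul,
    Polynomial.map_pow, Polynomial.map_X, Polynomial.map_ofNat, eval_add, eval_sub, eval_mul,
    eval_pow, eval_X, eval_ofNat] at h1 h3
  rw [Algebra.discr_powerBasis_eq_norm, hdeg, hB, minpoly_rat hψ]
  have hder : aeval ψ (derivative (minpolyShift.map (algebraMap ℤ ℚ))) ^ 2 *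
      ((algebraMap ℚ K 3 - ψ) * (algebraMap ℚ K (-1) - ψ)) = algebraMap ℚ K (-3 ^ 5) := by
    have hd : aeval ψ (derivative (minpolyShift.map (algebraMap ℤ ℚ))) =
        9 * ψ ^ 8 - 72 * ψ ^ 7 + 189 * ψ ^ 6 - 126 * ψ ^ 5 - 180 * ψ ^ 4 + 216 * ψ ^ 3 +
          27 * ψ ^ 2 - 54 * ψ := by
      simp [minpolyShift, map_ofNat (aeval ψ : ℚ[X] →ₐ[ℚ] K)]
      ring
    rw [hd]
    simp only [map_neg, map_pow, map_ofNat, map_one]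
    linear_combination (81 * ψ ^ 9 - 729 * ψ ^ 8 + 2187 * ψ ^ 7 - 1701 * ψ ^ 6 - 2916 * ψ ^ 5 +
      4374 * ψ ^ 4 + 729 * ψ ^ 3 - 2187 * ψ ^ 2 + 81) * hroot
  have hN := congrArg (Algebra.norm ℚ) hder
  rw [map_mul, map_mul, map_pow, h1, h3, Algebra.norm_algebraMap, hdeg] at hN
  norm_num at hN ⊢
  linarith

theorem mem_adjoin_int (B : PowerBasis ℚ K) (hB : B.gen = ψ) (hψ : aeval ψ minpolyShift = 0)
    (x : 𝓞 K) : (x : K) ∈ Algebra.adjoin ℤ {ψ} := by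
  have hint : IsIntegral ℤ B.gen := hB ▸ isIntegral_of_root hψ
  have H := Algebra.discr_mul_isIntegral_mem_adjoin ℚ hint (RingOfIntegers.isIntegral_coe x)
  have hd : Algebra.discr ℚ B.basis = 3 ^ 22 ∨ Algebra.discr ℚ B.basis = - 3 ^ 22 :=
    sq_eq_sq_iff_eq_or_eq_neg.1 (discr_sq B hB hψ)
  have H' : (3 : ℤ) ^ 22 • (x : K) ∈ Algebra.adjoin ℤ {B.gen} := by
    rcases hd with hd | hd <;> rw [hd] at H
    · convert! H using 1
      norm_num [Algebra.smul_def]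
    · convert! neg_mem H using 1
      norm_num [Algebra.smul_def]
  rw [← hB]
  refine mem_adjoin_of_smul_prime_pow_smul_of_minpoly_isEisensteinAt (K := ℚ) (p := (3 : ℤ))
    (by norm_num) hint (RingOfIntegers.isIntegral_coe x) H' ?_
  rw [hB, minpoly_int hψ]
  exact isEisensteinAt_minpolyShift

theorem exists_integral_powerBasis (B : PowerBasis ℚ K) (hB : B.gen = ψ)
    (hψ : aeval ψ minpolyShift = 0) :
    ∃ P : PowerBasis ℤ (𝓞 K), (P.gen : K) = ψ := by
  have hint := isIntegral_of_root hψ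
  let y : 𝓞 K := ⟨ψ, hint⟩
  have htop : Algebra.adjoin ℤ {y} = ⊤ := by
    refine eq_top_iff.2 fun x _ ↦ ?_
    have hx := mem_adjoin_int B hB hψ x
    rw [Algebra.adjoin_singleton_eq_range_aeval] at hx ⊢
    obtain ⟨q, hq⟩ := hx
    refine ⟨q, RingOfIntegers.coe_injective ?_⟩
    refine Eq.trans ?_ hq
    exact (aeval_algebraMap_apply K y q).symm
  exact ⟨PowerBasis.ofAdjoinEqTop' (RingOfIntegers.isIntegral y) htop, by
    rw [PowerBasis.ofAdjoinEqTop'_gen]; rfl⟩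

theorem discr_eq (B : PowerBasis ℚ K) (hB : B.gen = ψ) (hψ : aeval ψ minpolyShift = 0) :
    (NumberField.discr K : ℚ) = Algebra.discr ℚ B.basis := by
  obtain ⟨P, hP⟩ := exists_integral_powerBasis B hB hψ
  have key := Algebra.discr_localizationLocalization ℤ (nonZeroDivisors ℤ) K P.basis (Rₘ := ℚ)
  rw [NumberField.discr_eq_discr, eq_intCast] at key
  rw [← key]
  have hdim : P.dim = B.dim := by
    rw [← P.finrank, ← B.finrank, RingOfIntegers.rank]
  rw [← Algebra.discr_reindex ℚ _ (finCongr hdim)]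
  congr 1
  ext i
  simp [hP, hB]

/-- The minimal polynomial of `2 cos (2π / 27)`, as a function. -/
def minpolyFun {R : Type*} [CommRing R] (x : R) : R :=
  x ^ 9 - 9 * x ^ 7 + 27 * x ^ 5 - 30 * x ^ 3 + 9 * x + 1

theorem map_minpolyFun {R S : Type*} [CommRing R] [CommRing S] (φ : R →+* S) (x : R) :
    φ (minpolyFun x) = minpolyFun (φ x) := by
  simp [minpolyFun, map_ofNat φ]

theorem aeval_minpolyShift {R : Type*} [CommRing R] [Algebra ℤ R] (x : R) :
    Polynomial.aeval (x + 1) minpolyShift = minpolyFun x := by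
  simp only [minpolyShift, minpolyFun, map_add, map_sub, map_mul, map_pow, Polynomial.aeval_X,
    map_ofNat]
  ring

/-- The conjugates `2 cos (2π 2ⁿ / 27)` of `2 cos (2π / 27)`. -/
noncomputable def conj (n : ℕ) : ℝ := 2 * Real.cos (2 * Real.pi * 2 ^ n / 27)

theorem conj_succ (n : ℕ) : conj (n + 1) = conj n ^ 2 - 2 := by
  rw [conj, conj, show 2 * Real.pi * 2 ^ (n + 1) / 27 = 2 * (2 * Real.pi * 2 ^ n / 27) by ring,
    Real.cos_two_mul]
  ring

theorem conj_add_nine (n : ℕ) : conj (n + 9) = conj n := by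
  rw [conj, conj, show 2 * Real.pi * 2 ^ (n + 9) / 27 =
    ((2 ^ n * 19 : ℕ) : ℝ) * (2 * Real.pi) - 2 * Real.pi * 2 ^ n / 27 by push_cast; ring,
    Real.cos_nat_mul_two_pi_sub]

theorem conj_mod (n : ℕ) : conj (n % 9) = conj n := by
  conv_rhs => rw [← Nat.mod_add_div n 9]
  induction n / 9 with
  | zero => simp
  | succ k ih => rw [Nat.mul_succ, ← add_assoc, conj_add_nine, ih]

theorem cos_two_pi_mul_two_pow_div_three (n : ℕ) : Real.cos (2 * Real.pi * 2 ^ n / 3) = -1 / 2 := by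
  induction n with
  | zero =>
    rw [show 2 * Real.pi * 2 ^ 0 / 3 = 2 * (Real.pi / 3) by ring, Real.cos_two_mul,
      Real.cos_pi_div_three]
    norm_num
  | succ n ih =>
    rw [show 2 * Real.pi * 2 ^ (n + 1) / 3 = 2 * (2 * Real.pi * 2 ^ n / 3) by ring,
      Real.cos_two_mul, ih]
    norm_num

theorem minpolyFun_conj (n : ℕ) : minpolyFun (conj n) = 0 := by
  have h := cos_two_pi_mul_two_pow_div_three n
  rw [show 2 * Real.pi * 2 ^ n / 3 = 3 * (3 * (2 * Real.pi * 2 ^ n / 27)) by ring,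
    Real.cos_three_mul, Real.cos_three_mul] at h
  rw [minpolyFun, conj]
  linear_combination 2 * h

/-- The sign of `conj n`. -/
def conjSign (n : ℕ) : ℤ := if n % 9 ∈ [3, 4, 6, 7, 8] then -1 else 1

theorem sign_conj (n : ℕ) : Real.sign (conj n) = conjSign n := by
  have hpi := Real.pi_pos
  have pos (x : ℝ) (k : ℕ) (h₁ : -(1 / 4) < x) (h₂ : x < 1 / 4) :
      0 < Real.cos (x * (2 * Real.pi) + k * (2 * Real.pi)) := by
    rw [Real.cos_add_nat_mul_two_pi]
    exact Real.cos_pos_of_mem_Ioo ⟨by nlinarith, by nlinarith⟩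
  have neg (x : ℝ) (k : ℕ) (h₁ : 1 / 4 < x) (h₂ : x < 3 / 4) :
      Real.cos (x * (2 * Real.pi) + k * (2 * Real.pi)) < 0 := by
    rw [Real.cos_add_nat_mul_two_pi]
    exact Real.cos_neg_of_pi_div_two_lt_of_lt (by nlinarith) (by nlinarith)
  have split (i k : ℕ) : conj i = 2 * Real.cos ((2 ^ i / 27 - k) * (2 * Real.pi) +
      k * (2 * Real.pi)) := by
    rw [conj]
    congr 2
    ring
  have hsign : conjSign n = conjSign (n % 9) := by simp [conjSign]
  rw [← conj_mod, hsign]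
  have hlt := Nat.mod_lt n (show 9 > 0 by norm_num)
  generalize n % 9 = i at hlt
  by_cases hi : i ∈ [3, 4, 6, 7, 8]
  · have : conj i < 0 := by
      fin_cases hi
      · rw [split _ 0]; linarith [neg (2 ^ 3 / 27 - (0 : ℕ)) 0 (by norm_num) (by norm_num)]
      · rw [split _ 0]; linarith [neg (2 ^ 4 / 27 - (0 : ℕ)) 0 (by norm_num) (by norm_num)]
      · rw [split _ 2]; linarith [neg (2 ^ 6 / 27 - (2 : ℕ)) 2 (by norm_num) (by norm_num)]
      · rw [split _ 4]; linarith [neg (2 ^ 7 / 27 - (4 : ℕ)) 4 (by norm_num) (by norm_num)]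
      · rw [split _ 9]; linarith [neg (2 ^ 8 / 27 - (9 : ℕ)) 9 (by norm_num) (by norm_num)]
    rw [Real.sign_of_neg this, conjSign, if_pos (by rwa [Nat.mod_eq_of_lt hlt])]
    norm_num
  · have : 0 < conj i := by
      have hi' : i ∈ [0, 1, 2, 5] := by
        interval_cases i <;> simp_all
      fin_cases hi'
      · rw [split _ 0]; linarith [pos (2 ^ 0 / 27 - (0 : ℕ)) 0 (by norm_num) (by norm_num)]
      · rw [split _ 0]; linarith [pos (2 ^ 1 / 27 - (0 : ℕ)) 0 (by norm_num) (by norm_num)]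
      · rw [split _ 0]; linarith [pos (2 ^ 2 / 27 - (0 : ℕ)) 0 (by norm_num) (by norm_num)]
      · rw [split _ 1]; linarith [pos (2 ^ 5 / 27 - (1 : ℕ)) 1 (by norm_num) (by norm_num)]
    rw [Real.sign_of_pos this, conjSign, if_neg (by rwa [Nat.mod_eq_of_lt hlt])]
    norm_num

theorem eq_of_conj_add_eq {i j : Fin 9} (h : ∀ n : ℕ, conj (n + i) = conj (n + j)) : i = j := by
  have h' : ∀ n : Fin 9, conjSign (n + i) = conjSign (n + j) := fun n ↦ by
    have := congrArg Real.sign (h n)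
    rw [sign_conj, sign_conj] at this
    exact_mod_cast this
  clear h
  revert i j
  decide

theorem real_sign_mul (x y : ℝ) : Real.sign (x * y) = Real.sign x * Real.sign y := by
  rcases lt_trichotomy x 0 with hx | rfl | hx
  · rcases lt_trichotomy y 0 with hy | rfl | hy
    · simp [Real.sign_of_neg, Real.sign_of_pos, hx, hy, mul_pos_of_neg_of_neg]
    · simp
    · simp [Real.sign_of_neg, Real.sign_of_pos, hx, hy, mul_neg_of_neg_of_pos]
  · simp
  · rcases lt_trichotomy y 0 with hy | rfl | hy
    · simp [Real.sign_of_neg, Real.sign_of_pos, hx, hy, mul_neg_of_pos_of_neg]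
    · simp
    · simp [Real.sign_of_pos, hx, hy]

theorem real_sign_prod {ι : Type*} (s : Finset ι) (g : ι → ℝ) :
    Real.sign (∏ i ∈ s, g i) = ∏ i ∈ s, Real.sign (g i) :=
  map_prod (⟨⟨Real.sign, Real.sign_one⟩, real_sign_mul⟩ : ℝ →* ℝ) g s

/-- The iterates of `θ` under `x ↦ x ^ 2 - 2`, which are the conjugates of `θ`. -/
def iter {R : Type*} [CommRing R] (θ : R) : ℕ → R
  | 0 => θ
  | n + 1 => iter θ n ^ 2 - 2

theorem map_iter {R S : Type*} [CommRing R] [CommRing S] (φ : R →+* S) (θ : R) (n : ℕ) :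
    φ (iter θ n) = iter (φ θ) n := by
  induction n with
  | zero => rfl
  | succ n ih => simp [iter, ih, map_ofNat φ]

theorem iter_conj (n j : ℕ) : iter (conj j) n = conj (n + j) := by
  induction n with
  | zero => simp [iter]
  | succ n ih => rw [iter, ih, Nat.succ_add, conj_succ]

theorem iter_iter {R : Type*} [CommRing R] (θ : R) (m n : ℕ) :
    iter (iter θ m) n = iter θ (n + m) := by
  induction n with
  | zero => simp [iter]
  | succ n ih => rw [iter, ih, Nat.succ_add, iter]

theorem exists_unit_of_minpolyFun_eq_zero {K : Type*} [Field K] {x : K}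
    (hx : minpolyFun x = 0) :
    ∃ u : (𝓞 K)ˣ, ((u : 𝓞 K) : K) = x := by
  have hint : IsIntegral ℤ x := by
    have := isIntegral_of_root ((aeval_minpolyShift x).trans hx)
    convert! this.sub isIntegral_one using 1
    ring
  let y : 𝓞 K := ⟨x, hint⟩
  have hy : minpolyFun y = 0 := by
    apply RingOfIntegers.coe_injective
    rw [map_minpolyFun, map_zero]
    exact hx
  refine ⟨Units.mkOfMulEqOne y (-(y ^ 8 - 9 * y ^ 6 + 27 * y ^ 4 - 30 * y ^ 2 + 9)) ?_, rfl⟩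
  rw [minpolyFun] at hy
  linear_combination -hy

/-- `θ` generates `K` over `ℚ` and is a root of the minimal polynomial of `2 cos (2π / 27)`. -/
structure IsGenerator (θ : K) : Prop where
  root : minpolyFun θ = 0
  adjoin : Algebra.adjoin ℚ {θ} = ⊤

variable {θ : K}

theorem IsGenerator.aeval_eq_zero (h : IsGenerator θ) :
    Polynomial.aeval (θ + 1) minpolyShift = 0 := by
  rw [aeval_minpolyShift, h.root]

theorem IsGenerator.exists_powerBasis (h : IsGenerator θ) :
    ∃ B : PowerBasis ℚ K, B.gen = θ + 1 := by
  have htop : Algebra.adjoin ℚ {θ + 1} = ⊤ := by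
    rw [eq_top_iff, ← h.adjoin, Algebra.adjoin_le_iff, Set.singleton_subset_iff]
    convert! sub_mem (Algebra.self_mem_adjoin_singleton ℚ (θ + 1)) (one_mem _) using 1
    ring
  exact ⟨PowerBasis.ofAdjoinEqTop (Algebra.IsIntegral.isIntegral _) htop, by simp⟩

theorem IsGenerator.exists_algHom (h : IsGenerator θ) {A : Type*} [CommRing A] [Algebra ℚ A] {t : A}
    (ht : minpolyFun t = 0) : ∃ φ : K →ₐ[ℚ] A, φ θ = t := by
  obtain ⟨B, hB⟩ := h.exists_powerBasis
  have hroot : Polynomial.aeval (t + 1) (minpoly ℚ B.gen) = 0 := by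
    rw [hB, minpoly_rat h.aeval_eq_zero, Polynomial.aeval_map_algebraMap, aeval_minpolyShift, ht]
  refine ⟨B.lift _ hroot, ?_⟩
  have := B.lift_gen _ hroot
  rw [hB, map_add, map_one] at this
  exact add_right_cancel this

theorem IsGenerator.algHom_ext (h : IsGenerator θ) {A : Type*} [CommRing A] [Algebra ℚ A]
    {φ φ' : K →ₐ[ℚ] A} (heq : φ θ = φ' θ) : φ = φ' :=
  AlgHom.ext_of_adjoin_eq_top h.adjoin (by simpa using heq)

theorem IsGenerator.finrank (h : IsGenerator θ) : Module.finrank ℚ K = 9 := by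
  obtain ⟨B, hB⟩ := h.exists_powerBasis
  rw [B.finrank, ← B.natDegree_minpoly, hB, minpoly_rat h.aeval_eq_zero,
    monic_minpolyShift.natDegree_map, natDegree_minpolyShift]

/-- The nine real embeddings of `K`. -/
noncomputable def IsGenerator.realEmb (h : IsGenerator θ) (j : Fin 9) : K →+* ℝ :=
  (h.exists_algHom (minpolyFun_conj j)).choose

theorem IsGenerator.realEmb_iter (h : IsGenerator θ) (j : Fin 9) (n : ℕ) :
    h.realEmb j (iter θ n) = conj (n + j) := by
  rw [map_iter, ← iter_conj]
  exact congrArg (iter · n) (h.exists_algHom (minpolyFun_conj j)).choose_spec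

theorem IsGenerator.bijective_complexEmb (h : IsGenerator θ) :
    Function.Bijective fun j ↦ Complex.ofRealHom.comp (h.realEmb j) := by
  refine (Fintype.bijective_iff_injective_and_card _).2 ⟨fun i j hij ↦ ?_, ?_⟩
  · refine eq_of_conj_add_eq fun n ↦ ?_
    have := RingHom.congr_fun hij (iter θ n)
    simpa [h.realEmb_iter] using this
  · rw [NumberField.Embeddings.card, h.finrank, Fintype.card_fin]

theorem IsGenerator.bijective_realEmb (h : IsGenerator θ) : Function.Bijective h.realEmb := by
  refine ⟨fun i j hij ↦ h.bijective_complexEmb.1 (by simp only [hij]), fun v ↦ ?_⟩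
  obtain ⟨j, hj⟩ := h.bijective_complexEmb.2 (Complex.ofRealHom.comp v)
  refine ⟨j, RingHom.ext fun x ↦ ?_⟩
  simpa using RingHom.congr_fun hj x

theorem IsGenerator.card_realEmb (h : IsGenerator θ) : Nat.card (K →+* ℝ) = 9 := by
  rw [← Nat.card_eq_of_bijective _ h.bijective_realEmb, Nat.card_eq_fintype_card, Fintype.card_fin]

theorem IsGenerator.isReal (h : IsGenerator θ) (v : InfinitePlace K) : v.IsReal := by
  obtain ⟨j, hj⟩ := h.bijective_complexEmb.2 v.embedding
  rw [InfinitePlace.isReal_iff, ← hj, ComplexEmbedding.isReal_iff]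
  ext x
  simp [ComplexEmbedding.conjugate_coe_eq]

theorem IsGenerator.iter_add_nine (h : IsGenerator θ) (n : ℕ) : iter θ (n + 9) = iter θ n := by
  apply (h.realEmb 0).injective
  rw [h.realEmb_iter, h.realEmb_iter, add_right_comm, conj_add_nine]

theorem IsGenerator.minpolyFun_iter (h : IsGenerator θ) (n : ℕ) : minpolyFun (iter θ n) = 0 := by
  apply (h.realEmb 0).injective
  rw [map_minpolyFun, h.realEmb_iter, minpolyFun_conj, map_zero]

theorem IsGenerator.exists_orderOf_eq_nine (h : IsGenerator θ) :
    ∃ σ : K ≃ₐ[ℚ] K, orderOf σ = 9 := by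
  obtain ⟨φ, hφ⟩ := h.exists_algHom (h.minpolyFun_iter 1)
  let σ := (Algebra.IsAlgebraic.algEquivEquivAlgHom ℚ K).symm φ
  have hσ : ∀ x, σ x = φ x := fun x ↦ rfl
  have hpow (n : ℕ) : (σ ^ n) θ = iter θ n := by
    induction n with
    | zero => rfl
    | succ n ih =>
      rw [pow_succ', AlgEquiv.mul_apply, ih, hσ]
      have := map_iter (φ : K →+* K) θ n
      simp only [RingHom.coe_coe] at this
      rw [this, hφ, iter_iter]
  refine ⟨σ, ?_⟩
  have hp : Fact (Nat.Prime 3) := ⟨Nat.prime_three⟩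
  refine orderOf_eq_prime_pow (p := 3) (n := 1) (fun h3 ↦ ?_) ?_
  · have := hpow (3 ^ 1)
    rw [h3, AlgEquiv.one_apply] at this
    have := congrArg (fun x ↦ Real.sign (h.realEmb 0 x)) this
    have h0 := h.realEmb_iter 0 0
    rw [iter] at h0
    simp only [h0, h.realEmb_iter, sign_conj] at this
    norm_num [conjSign] at this
  · apply AlgEquiv.coe_toAlgHom_injective
    refine h.algHom_ext ?_
    simpa [hpow, iter] using h.iter_add_nine 0

theorem IsGenerator.card_aut (h : IsGenerator θ) : Nat.card (K ≃ₐ[ℚ] K) = 9 := by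
  obtain ⟨σ, hσ⟩ := h.exists_orderOf_eq_nine
  refine le_antisymm ?_ (hσ ▸ Nat.le_of_dvd Nat.card_pos (orderOf_dvd_natCard σ))
  rw [← h.finrank, Nat.card_eq_fintype_card]
  exact AlgEquiv.card_le

theorem IsGenerator.isCyclic (h : IsGenerator θ) : IsCyclic (K ≃ₐ[ℚ] K) := by
  obtain ⟨σ, hσ⟩ := h.exists_orderOf_eq_nine
  exact isCyclic_of_orderOf_eq_card σ (hσ.trans h.card_aut.symm)

theorem IsGenerator.isGalois (h : IsGenerator θ) : IsGalois ℚ K :=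
  IsGalois.of_card_aut_eq_finrank _ _ (h.card_aut.trans h.finrank.symm)

theorem IsGenerator.exists_unit_sign (h : IsGenerator θ) (a : Fin 9) :
    ∃ u : (𝓞 K)ˣ, ∀ j, Real.sign (h.realEmb j ((u : 𝓞 K) : K)) = if j = a then -1 else 1 := by
  choose u hu using fun n ↦ exists_unit_of_minpolyFun_eq_zero (h.minpolyFun_iter n)
  refine ⟨u (10 - a) * u (14 - a) * u (16 - a), fun j ↦ ?_⟩
  have key : ∀ j a : Fin 9, conjSign (10 - a + j) * conjSign (14 - a + j) *
      conjSign (16 - a + j) = if j = a then -1 else 1 := by decide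
  simp only [Units.val_mul, map_mul, hu, h.realEmb_iter, real_sign_mul, sign_conj]
  exact_mod_cast congrArg (Int.cast : ℤ → ℝ) (key j a)

theorem IsGenerator.exists_unit_signs (h : IsGenerator θ) (ε : (K →+* ℝ) → ℝ)
    (hε : ∀ v, ε v = 1 ∨ ε v = -1) :
    ∃ u : (𝓞 K)ˣ, ∀ v : K →+* ℝ, Real.sign (v ((u : 𝓞 K) : K)) = ε v := by
  classical
  choose w hw using h.exists_unit_sign
  refine ⟨∏ a, if ε (h.realEmb a) = -1 then w a else 1, fun v ↦ ?_⟩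
  obtain ⟨j, rfl⟩ := h.bijective_realEmb.2 v
  have hterm (a : Fin 9) : Real.sign (h.realEmb j
      (((if ε (h.realEmb a) = -1 then w a else 1 : (𝓞 K)ˣ) : 𝓞 K) : K)) =
      if j = a then ε (h.realEmb j) else 1 := by
    split_ifs with h₁ h₂ h₂
    · rw [hw, if_pos h₂, h₂, h₁]
    · rw [hw, if_neg h₂]
    · rw [h₂, (hε _).resolve_right h₁]
      simp
    · simp
  have hprod := map_prod ((h.realEmb j).comp (algebraMap (𝓞 K) K))
    (fun a ↦ ((if ε (h.realEmb a) = -1 then w a else 1 : (𝓞 K)ˣ) : 𝓞 K)) Finset.univ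
  simp only [RingHom.comp_apply] at hprod
  rw [Units.coe_prod, hprod, real_sign_prod, Finset.prod_congr rfl fun a _ ↦ hterm a]
  simp

theorem IsGenerator.discr (h : IsGenerator θ) : NumberField.discr K = 3 ^ 22 := by
  obtain ⟨B, hB⟩ := h.exists_powerBasis
  have hsq := discr_sq B hB h.aeval_eq_zero
  rw [← discr_eq B hB h.aeval_eq_zero] at hsq
  have hreal : IsTotallyReal K := ⟨h.isReal⟩
  have hsign := NumberField.sign_discr K
  rw [IsTotallyReal.nrComplexPlaces_eq_zero, pow_zero, Int.sign_eq_one_iff_pos] at hsign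
  exact (pow_left_inj₀ hsign.le (by positivity) two_ne_zero).1 (by exact_mod_cast hsq)

theorem minpolyFun_ne_zero_of_card_eq_eight {F : Type*} [Field F] [Fintype F]
    (hF : Fintype.card F = 8) (h2 : (2 : F) = 0) (t : F) : minpolyFun t ≠ 0 := by
  intro h
  have h8 := FiniteField.pow_card t
  rw [hF] at h8
  rw [minpolyFun] at h
  refine one_ne_zero (α := F) ?_
  linear_combination (t ^ 6 + t ^ 5 + t ^ 4 + t ^ 2 + 1) * h +
    (t ^ 7 + t ^ 6 + t ^ 4 + t ^ 3 + t ^ 2 + t + 1) * h8 -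
    (t ^ 15 + t ^ 14 - 4 * t ^ 13 - 4 * t ^ 12 + 10 * t ^ 11 + 14 * t ^ 10 - 5 * t ^ 9 -
      15 * t ^ 8 - 2 * t ^ 7 + 5 * t ^ 6 + 3 * t ^ 5 - 11 * t ^ 3 + 4 * t) * h2

theorem minpolyFun_ne_zero_of_card_eq_125 {F : Type*} [Field F] [Fintype F]
    (hF : Fintype.card F = 125) (h5 : (5 : F) = 0) (t : F) : minpolyFun t ≠ 0 := by
  intro h
  have h125 := FiniteField.pow_card t
  rw [hF] at h125
  rw [minpolyFun] at h
  have h25 : t ^ 25 = t ^ 2 + 3 := by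
    linear_combination (t ^ 16 + 4 * t ^ 14 + 4 * t ^ 12 + 3 * t ^ 10 + 4 * t ^ 7 + 3 * t ^ 6 +
      2 * t ^ 5 + t ^ 4 + t ^ 3 + t ^ 2 + 2 * t + 2) * h +
      (t ^ 23 + t ^ 21 - 9 * t ^ 19 + 6 * t ^ 17 - t ^ 16 + 6 * t ^ 14 + 16 * t ^ 13 -
        19 * t ^ 12 - 20 * t ^ 11 + 14 * t ^ 10 + 14 * t ^ 9 + 3 * t ^ 8 - 2 * t ^ 7 -
        9 * t ^ 6 - 7 * t ^ 5 + 10 * t ^ 4 + 10 * t ^ 3 - 4 * t ^ 2 - 4 * t - 1) * h5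
  rw [show 125 = 25 * 5 from rfl, pow_mul, h25] at h125
  have h10 : t ^ 10 - t + 3 = 0 := by
    linear_combination h125 - (3 * t ^ 8 + 18 * t ^ 6 + 54 * t ^ 4 + 81 * t ^ 2 + 48) * h5
  refine one_ne_zero (α := F) ?_
  linear_combination -(3 * t ^ 9 + 3 * t ^ 8 + 3 * t ^ 6 + 2 * t ^ 5 + 3 * t ^ 4 + t ^ 3 +
    3 * t ^ 2 + t + 3) * h - (2 * t ^ 8 + 2 * t ^ 7 + 2 * t ^ 6 + 4 * t ^ 5 + 2 * t ^ 4 +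
    3 * t ^ 3 + 2 * t ^ 2 + 3 * t + 2) * h10 +
    (t ^ 18 + t ^ 17 - 5 * t ^ 16 - 4 * t ^ 15 + 17 * t ^ 14 + 12 * t ^ 13 - 21 * t ^ 12 -
      6 * t ^ 11 + 15 * t ^ 10 - t ^ 9 - 7 * t ^ 8 - t ^ 7 + 4 * t ^ 6 + 6 * t ^ 5 - 3 * t ^ 4 -
      11 * t ^ 3 + 3 * t ^ 2 + 7 * t + 2) * h5

theorem minpolyFun_zmod_ne_zero {p : ℕ} (hp : p.Prime) (hle : p ≤ 165)
    (hne : p ∉ [3, 53, 107, 109, 163]) (a : ZMod p) : minpolyFun a ≠ 0 := by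
  have key : ∀ p < 166, (2 ≤ p ∧ (∀ m < p, 2 ≤ m → p % m ≠ 0) ∧ p ∉ [3, 53, 107, 109, 163]) →
      ∀ a < p, (a ^ 9 + 27 * a ^ 5 + 9 * a + 1) % p ≠ (9 * a ^ 7 + 30 * a ^ 3) % p := by
    decide +kernel
  have : NeZero p := ⟨hp.ne_zero⟩
  intro h
  refine key p (by lia) ⟨hp.two_le, fun m hm hm2 h0 ↦ ?_, hne⟩ a.val a.val_lt ?_
  · exact (hp.eq_one_or_self_of_dvd m (Nat.dvd_of_mod_eq_zero h0)).elim (by lia) (by lia)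
  · refine (ZMod.natCast_eq_natCast_iff' _ _ p).1 ?_
    push_cast
    rw [ZMod.natCast_zmod_val]
    rw [minpolyFun] at h
    linear_combination h

theorem IsGenerator.minkowski_bound (h : IsGenerator θ) :
    ⌊(4 / Real.pi) ^ InfinitePlace.nrComplexPlaces K * ((Module.finrank ℚ K).factorial /
      (Module.finrank ℚ K : ℝ) ^ Module.finrank ℚ K * √|(NumberField.discr K : ℝ)|)⌋₊ = 165 := by
  have hreal : IsTotallyReal K := ⟨h.isReal⟩
  have hsqrt : √|(NumberField.discr K : ℝ)| = 3 ^ 11 := by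
    rw [h.discr, show |(((3 ^ 22 : ℤ)) : ℝ)| = (3 ^ 11) ^ 2 by norm_num]
    exact Real.sqrt_sq (by positivity)
  rw [hsqrt, IsTotallyReal.nrComplexPlaces_eq_zero, h.finrank, Nat.floor_eq_iff (by positivity)]
  norm_num [Nat.factorial]

theorem IsGenerator.inertiaDeg_dvd_nine (h : IsGenerator θ) {p : ℕ} (hp : p.Prime)
    (P : Ideal (𝓞 K)) [P.IsPrime] [P.LiesOver (Ideal.span {(p : ℤ)})] : P.inertiaDeg ℤ ∣ 9 := by
  have := h.isGalois
  have : (Ideal.span {(p : ℤ)}).IsPrime :=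
    (Ideal.span_singleton_prime (by exact_mod_cast hp.ne_zero)).2 (Nat.prime_iff_prime_int.1 hp)
  rw [← h.card_aut, ← Ideal.ncard_primesOver_mul_card_inertia_mul_finrank
    (G := K ≃ₐ[ℚ] K) (Ideal.span {(p : ℤ)}) P]
  exact dvd_mul_left _ _

theorem IsGenerator.exists_integer (h : IsGenerator θ) :
    ∃ (t : 𝓞 K) (B : PowerBasis ℤ (𝓞 K)), minpolyFun t = 0 ∧ B.gen = t + 1 := by
  obtain ⟨B, hB⟩ := h.exists_powerBasis
  obtain ⟨P, hP⟩ := exists_integral_powerBasis B hB h.aeval_eq_zero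
  refine ⟨P.gen - 1, P, RingOfIntegers.coe_injective ?_, by ring⟩
  rw [map_minpolyFun, map_sub, map_one, map_zero, ← h.root, ← add_sub_cancel_right θ 1, ← hP]

theorem IsGenerator.lt_pow_inertiaDeg (h : IsGenerator θ) {p : ℕ} (hp : p.Prime) (hle : p ≤ 165)
    (hne : p ∉ [3, 53, 107, 109, 163]) (P : Ideal (𝓞 K)) [P.IsPrime]
    [P.LiesOver (Ideal.span {(p : ℤ)})] : 165 < p ^ P.inertiaDeg ℤ := by
  obtain ⟨t, -, ht, -⟩ := h.exists_integer
  have hcard := Ideal.pow_inertiaDeg p P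
  rw [Ideal.absNorm_apply, Submodule.cardQuot_apply] at hcard
  have hfin : Finite (𝓞 K ⧸ P) := Nat.finite_of_card_ne_zero
    (hcard ▸ pow_ne_zero _ hp.ne_zero)
  have := Fintype.ofFinite (𝓞 K ⧸ P)
  rw [Nat.card_eq_fintype_card] at hcard
  let : Field (𝓞 K ⧸ P) := (Finite.isField_of_domain (𝓞 K ⧸ P)).toField
  have hroot : minpolyFun (Ideal.Quotient.mk P t) = 0 := by
    rw [← map_minpolyFun, ht, map_zero]
  have hp0 : (p : 𝓞 K ⧸ P) = 0 := by
    have hmem : algebraMap ℤ (𝓞 K) p ∈ P := by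
      rw [← Ideal.mem_comap, ← Ideal.under_def, ← Ideal.LiesOver.over (P := P)
        (p := Ideal.span {(p : ℤ)})]
      exact Ideal.mem_span_singleton_self _
    simpa using Ideal.Quotient.eq_zero_iff_mem.2 hmem
  have hdeg : P.inertiaDeg ℤ ∈ Nat.divisors 9 := by simpa using h.inertiaDeg_dvd_nine hp P
  rw [show Nat.divisors 9 = {1, 3, 9} by decide] at hdeg
  simp only [Finset.mem_insert, Finset.mem_singleton] at hdeg
  rcases hdeg with hd | hd | hd <;> rw [hd] at hcard ⊢
  · let e := ZMod.ringEquivOfPrime (𝓞 K ⧸ P) hp (by rw [← hcard, pow_one])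
    refine absurd ?_ (minpolyFun_zmod_ne_zero hp hle hne (e.symm (Ideal.Quotient.mk P t)))
    rw [← RingEquiv.coe_toRingHom, ← map_minpolyFun, hroot, map_zero]
  · by_cases h2 : p = 2
    · subst h2
      exact absurd hroot (minpolyFun_ne_zero_of_card_eq_eight hcard.symm (by simpa using hp0) _)
    by_cases h5 : p = 5
    · subst h5
      exact absurd hroot (minpolyFun_ne_zero_of_card_eq_125 hcard.symm (by simpa using hp0) _)
    have h6 : 6 ≤ p := by
      by_contra! hlt
      have := hp.two_le
      interval_cases p
      · exact h2 rfl
      · simp at hne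
      · norm_num at hp
      · exact h5 rfl
    calc 165 < 6 ^ 3 := by norm_num
      _ ≤ p ^ 3 := Nat.pow_le_pow_left h6 3
  · calc 165 < 2 ^ 9 := by norm_num
      _ ≤ p ^ 9 := Nat.pow_le_pow_left hp.two_le 9

/-- A criterion for the degree one prime of `𝓞 K` above `p` containing `t - a` to be generated
by `α`. -/
theorem exists_isPrincipal_primesOver {t : 𝓞 K} (ht : minpolyFun t = 0) {B : PowerBasis ℤ (𝓞 K)}
    (hB : B.gen = t + 1) {p : ℕ} (hp : p.Prime) (a : ℤ) (ha : (p : ℤ) ∣ minpolyFun a)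
    (α β γ δ κ : 𝓞 K) (hα : α = (t - a) * δ + p * κ) (hβ : α * β = p) (hγ : α * γ = t - a) :
    ∃ P ∈ Ideal.primesOver (Ideal.span {(p : ℤ)}) (𝓞 K), Submodule.IsPrincipal P := by
  have : Fact p.Prime := ⟨hp⟩
  have ha' : minpolyFun (a : ZMod p) = 0 := by
    rw [← eq_intCast (Int.castRingHom (ZMod p)), ← map_minpolyFun, eq_intCast]
    exact (ZMod.intCast_zmod_eq_zero_iff_dvd _ _).2 ha
  have hmin : minpoly ℤ B.gen = minpolyShift := by
    rw [← minpoly_int (K := K) (ψ := algebraMap (𝓞 K) K B.gen)]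
    · exact (minpoly.algebraMap_eq RingOfIntegers.coe_injective _).symm
    · rw [hB, map_add, map_one, aeval_minpolyShift, ← map_minpolyFun, ht, map_zero]
  have hroot : Polynomial.aeval ((a : ZMod p) + 1) (minpoly ℤ B.gen) = 0 := by
    rw [hmin, aeval_minpolyShift, ha']
  let φ : 𝓞 K →+* ZMod p := B.lift _ hroot
  have hφt : φ t = a := by
    have := B.lift_gen _ hroot
    rw [hB, map_add, map_one] at this
    exact add_right_cancel this
  have hker : RingHom.ker φ = Ideal.span {α} := by
    refine le_antisymm (fun x hx ↦ ?_) ?_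
    · rw [Ideal.mem_span_singleton]
      obtain ⟨q, hq⟩ := B.exists_eq_aeval' x
      have hdvd : t - a ∣ x - (q.eval (a + 1) : ℤ) := by
        have := Polynomial.sub_dvd_eval_sub (t + 1) ((a : 𝓞 K) + 1)
          (q.map (algebraMap ℤ (𝓞 K)))
        convert! this using 1
        · ring
        · rw [hq, hB, Polynomial.eval_map_algebraMap]
          congr 1
          rw [← eq_intCast (algebraMap ℤ (𝓞 K)), ← Polynomial.eval_map_apply]
          simp
      have hx' : (p : 𝓞 K) ∣ (q.eval (a + 1) : ℤ) := by
        have h0 : ((q.eval (a + 1) : ℤ) : ZMod p) = 0 := by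
          obtain ⟨y, hy⟩ := hdvd
          have := congrArg φ hy
          rw [map_mul, map_sub, map_sub, hφt, map_intCast, map_intCast, sub_self, zero_mul,
            RingHom.mem_ker.1 hx, zero_sub, neg_eq_zero] at this
          exact this
        obtain ⟨y, hy⟩ := (ZMod.intCast_zmod_eq_zero_iff_dvd _ _).1 h0
        exact ⟨y, by rw [hy]; push_cast; ring⟩
      rw [← sub_add_cancel x (q.eval (a + 1) : ℤ)]
      exact dvd_add (((Dvd.intro _ hγ)).trans hdvd) ((Dvd.intro _ hβ).trans hx')
    · rw [Ideal.span_singleton_le_iff_mem, RingHom.mem_ker, hα]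
      simp [hφt]
  refine ⟨RingHom.ker φ, ⟨RingHom.ker_isPrime φ, ⟨?_⟩⟩, ⟨α, hker⟩⟩
  rw [Ideal.under_def, RingHom.comap_ker, ← ZMod.ker_intCastRingHom]
  congr 1
  exact RingHom.ext_int _ _

theorem IsGenerator.exists_isPrincipal_primesOver (h : IsGenerator θ) {p : ℕ}
    (hp : p ∈ [3, 53, 107, 109, 163]) :
    ∃ P ∈ Ideal.primesOver (Ideal.span {(p : ℤ)}) (𝓞 K), Submodule.IsPrincipal P := by
  obtain ⟨t, B, ht, hB⟩ := h.exists_integer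
  have hf := ht
  rw [minpolyFun] at hf
  fin_cases hp
  · refine RealCyclotomic27.exists_isPrincipal_primesOver ht hB (by norm_num) 2
      (by norm_num [minpolyFun]) (t - 2)
      (-t ^ 8 - 2 * t ^ 7 + 5 * t ^ 6 + 10 * t ^ 5 - 7 * t ^ 4 - 14 * t ^ 3 + 2 * t ^ 2 + 4 * t - 1)
      1 1 0 ?_ ?_ ?_
    · push_cast; ring
    · push_cast; linear_combination -hf
    · push_cast; ring
  · refine RealCyclotomic27.exists_isPrincipal_primesOver ht hB (by norm_num) 5
      (by norm_num [minpolyFun]) (t ^ 3 - 4 * t + 1)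
      (14 * t ^ 8 + 17 * t ^ 7 - 94 * t ^ 6 - 99 * t ^ 5 + 201 * t ^ 4 + 157 * t ^ 3 -
        165 * t ^ 2 - 83 * t + 29)
      (-t ^ 8 - t ^ 7 + 7 * t ^ 6 + 6 * t ^ 5 - 16 * t ^ 4 - 10 * t ^ 3 + 14 * t ^ 2 + 6 * t - 3)
      (t ^ 2 + 5 * t + 21) 2 ?_ ?_ ?_
    · push_cast; ring
    · push_cast; linear_combination (14 * t ^ 2 + 17 * t - 24) * hf
    · push_cast; linear_combination (-t ^ 2 - t + 2) * hf
  · refine RealCyclotomic27.exists_isPrincipal_primesOver ht hB (by norm_num) 97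
      (by norm_num [minpolyFun]) (-t ^ 2 + t + 3)
      (-37 * t ^ 8 + 49 * t ^ 7 + 271 * t ^ 6 - 356 * t ^ 5 - 542 * t ^ 4 + 712 * t ^ 3 +
        196 * t ^ 2 - 248 * t + 7)
      (34 * t ^ 8 - 45 * t ^ 7 - 249 * t ^ 6 + 327 * t ^ 5 + 498 * t ^ 4 - 654 * t ^ 3 -
        180 * t ^ 2 + 228 * t - 6)
      (-t - 96) (-87) ?_ ?_ ?_
    · push_cast; ring
    · push_cast; linear_combination (37 * t - 86) * hf
    · push_cast; linear_combination (-34 * t + 79) * hf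
  · refine RealCyclotomic27.exists_isPrincipal_primesOver ht hB (by norm_num) 27
      (by norm_num [minpolyFun]) (-2 * t ^ 3 + t ^ 2 + 6 * t - 2)
      (-101 * t ^ 8 + 107 * t ^ 7 + 637 * t ^ 6 - 677 * t ^ 5 - 1059 * t ^ 4 + 1055 * t ^ 3 +
        450 * t ^ 2 - 276 * t - 77)
      (26 * t ^ 8 - 29 * t ^ 7 - 164 * t ^ 6 + 183 * t ^ 5 + 272 * t ^ 4 - 285 * t ^ 3 -
        114 * t ^ 2 + 76 * t + 20)
      (-2 * t ^ 2 - 53 * t - 1425) (-353) ?_ ?_ ?_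
    · push_cast; ring
    · push_cast; linear_combination (202 * t ^ 2 - 315 * t + 45) * hf
    · push_cast; linear_combination (-52 * t ^ 2 + 84 * t - 13) * hf
  · refine RealCyclotomic27.exists_isPrincipal_primesOver ht hB (by norm_num) 12
      (by norm_num [minpolyFun]) (-t ^ 4 - t ^ 3 + 4 * t ^ 2 + 4 * t - 2)
      (-16 * t ^ 8 - 29 * t ^ 7 + 122 * t ^ 6 + 160 * t ^ 5 - 305 * t ^ 4 - 237 * t ^ 3 +
        244 * t ^ 2 + 157 * t - 53)
      (t ^ 8 + 2 * t ^ 7 - 8 * t ^ 6 - 11 * t ^ 5 + 21 * t ^ 4 + 16 * t ^ 3 - 17 * t ^ 2 -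
        11 * t + 4)
      (-t ^ 3 - 13 * t ^ 2 - 152 * t - 1820) (-134) ?_ ?_ ?_
    · push_cast; ring
    · push_cast; linear_combination (16 * t ^ 3 + 45 * t ^ 2 - 13 * t - 57) * hf
    · push_cast; linear_combination (-t ^ 3 - 3 * t ^ 2 + t + 4) * hf

theorem IsGenerator.classNumber (h : IsGenerator θ) : NumberField.classNumber K = 1 := by
  have := h.isGalois
  rw [classNumber_eq_one_iff]
  open RingOfIntegers in
  refine isPrincipalIdealRing_of_isPrincipal_of_lt_or_isPrincipal_of_mem_primesOver_of_mem_Icc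
    fun p hp hprime ↦ ?_
  rw [h.minkowski_bound] at hp ⊢
  by_cases hmem : p ∈ [3, 53, 107, 109, 163]
  · obtain ⟨P, hP, hprin⟩ := h.exists_isPrincipal_primesOver hmem
    exact ⟨P, hP, Or.inr hprin⟩
  · have : (Ideal.span {(p : ℤ)}).IsPrime := (Ideal.span_singleton_prime
      (by exact_mod_cast hprime.ne_zero)).2 (Nat.prime_iff_prime_int.1 hprime)
    obtain ⟨⟨P, hP⟩⟩ := Ideal.nonempty_primesOver (S := 𝓞 K) (Ideal.span {(p : ℤ)})
    have := hP.1
    have := hP.2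
    exact ⟨P, hP, Or.inl (h.lt_pow_inertiaDeg hprime (Finset.mem_Icc.1 hp).2 hmem P)⟩

theorem minpolyFun_add_inv {L : Type*} [Field L] {ζ : L} (hζ : IsPrimitiveRoot ζ 27) :
    minpolyFun (ζ + ζ⁻¹) = 0 := by
  have h9 : IsPrimitiveRoot (ζ ^ 9) 3 := hζ.pow (by norm_num) (by norm_num)
  have hsum := h9.geom_sum_eq_zero (by norm_num)
  simp only [Finset.sum_range_succ, Finset.sum_range_zero] at hsum
  have hne := hζ.ne_zero (by norm_num)
  rw [minpolyFun]
  field_simp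
  linear_combination hsum

theorem adjoin_gen_eq_top {F L : Type*} [Field F] [Field L] [Algebra F L] {x : L}
    (hx : IsIntegral F x) : Algebra.adjoin F {AdjoinSimple.gen F x} = ⊤ := by
  rw [← adjoin.powerBasis_gen hx]
  exact (adjoin.powerBasis hx).adjoin_gen_eq_top

theorem isGenerator_symm {M : Type*} [Field M] [Algebra ℚ M] {x : M} (hx : minpolyFun x = 0)
    (htop : Algebra.adjoin ℚ {x} = ⊤) (e : K ≃ₐ[ℚ] M) : IsGenerator (e.symm x) where
  root := by
    have hmap := map_minpolyFun (e.symm : M →+* K) x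
    rw [hx, map_zero] at hmap
    exact hmap.symm
  adjoin := by
    have himage := AlgHom.map_adjoin (e.symm : M →ₐ[ℚ] K) {x}
    rw [htop, Algebra.map_top, Set.image_singleton,
      (AlgHom.range_eq_top _).2 e.symm.surjective] at himage
    exact himage.symm

theorem exists_isGenerator {L : Type*} [Field L] [Algebra ℚ L] {x : L} (hx : minpolyFun x = 0)
    (e : K ≃ₐ[ℚ] ℚ⟮x⟯) : ∃ θ : K, IsGenerator θ := by
  have hint : IsIntegral ℚ x := by
    have := (isIntegral_of_root ((aeval_minpolyShift x).trans hx)).tower_top (A := ℚ)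
    convert! this.sub isIntegral_one using 1
    ring
  refine ⟨_, isGenerator_symm (x := AdjoinSimple.gen ℚ x) ?_ ?_ e⟩
  · apply (algebraMap ℚ⟮x⟯ L).injective
    rw [map_minpolyFun, AdjoinSimple.algebraMap_gen, hx, map_zero]
  · convert! adjoin_gen_eq_top hint <;> exact Subsingleton.elim _ _

end RealCyclotomic27

/-- Let `ζ` be a primitive 27th root of unity and let `K ≅ ℚ(ζ + ζ⁻¹)` be the maximal real
subfield of `ℚ(ζ₂₇)`.  Then `K/ℚ` is Galois of degree `9` with cyclic Galois group of order
`9`, `disc K = 3^22`, `K` is totally real, `K` has class number `1`, and `K` has strict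
(narrow) class number `1`: every choice of signs at the `9` real embeddings of `K` is realized
by a unit of the ring of integers of `K`. -/
theorem maximal_real_subfield_of_27th_cyclotomic_field
    (L : Type) [Field L] [Algebra ℚ L] [IsCyclotomicExtension {27} ℚ L]
    (ζ : L) (hζ : IsPrimitiveRoot ζ 27)
    (K : Type) [Field K] [NumberField K]
    (e : K ≃ₐ[ℚ] ℚ⟮ζ + ζ⁻¹⟯) :
    IsGalois ℚ K ∧ Module.finrank ℚ K = 9 ∧
    IsCyclic (K ≃ₐ[ℚ] K) ∧ Nat.card (K ≃ₐ[ℚ] K) = 9 ∧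
    NumberField.discr K = 3 ^ 22 ∧
    (∀ v : NumberField.InfinitePlace K, v.IsReal) ∧
    Nat.card (K →+* ℝ) = 9 ∧
    NumberField.classNumber K = 1 ∧
    (∀ ε : (K →+* ℝ) → ℝ, (∀ v, ε v = 1 ∨ ε v = -1) →
      ∃ u : (𝓞 K)ˣ, ∀ v : K →+* ℝ, Real.sign (v ((u : 𝓞 K) : K)) = ε v) := by
  obtain ⟨_, h⟩ := RealCyclotomic27.exists_isGenerator (RealCyclotomic27.minpolyFun_add_inv hζ) e
  exact ⟨h.isGalois, h.finrank, h.isCyclic, h.card_aut, h.discr, h.isReal, h.card_realEmb,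
    h.classNumber, h.exists_unit_signs⟩
end

section
/- Let f(x) = x⁴ + x³ − 5x² − x + 3 ∈ ℚ[x]. Then f is irreducible over ℚ, all four complex roots of f are real (so the number field E = ℚ[x]/(f) is totally real), the discriminant of the number field E equals 9301 = 71 · 131, and the Galois group of the splitting field of f over ℚ is isomorphic to the symmetric group S₄. -/
open Polynomial

namespace TotallyRealQuartic

theorem irreducible_zmod_two : Irreducible (X ^ 4 + X ^ 3 + X ^ 2 + X + 1 : (ZMod 2)[X]) := by
  have hdeg : (X ^ 4 + X ^ 3 + X ^ 2 + X + 1 : (ZMod 2)[X]).natDegree = 4 := by compute_degree!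
  have hm : (X ^ 4 + X ^ 3 + X ^ 2 + X + 1 : (ZMod 2)[X]).Monic := by monicity!
  have hroot : ∀ a : ZMod 2, a ^ 4 + a ^ 3 + a ^ 2 + a + 1 ≠ 0 := by decide
  rw [hm.irreducible_iff_natDegree']
  refine ⟨fun h ↦ by simp [h] at hdeg, fun p q hp hq hpq hmem ↦ ?_⟩
  have hsum := hp.natDegree_mul hq
  rw [hpq, hdeg] at hsum
  rw [hdeg, Finset.mem_Ioc] at hmem
  obtain hq1 | hq2 : q.natDegree = 1 ∨ q.natDegree = 2 := by omega
  · rw [hq.as_sum, hq1] at hpq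
    have h := congrArg (eval (-q.coeff 0)) hpq
    refine hroot (-q.coeff 0) ?_
    simpa [CharTwo.add_self_eq_zero] using h.symm
  · have hp2 : p.natDegree = 2 := by omega
    rw [hp.as_sum, hq.as_sum, hq2, hp2] at hpq
    simp only [Finset.sum_range_succ, Finset.sum_range_zero, pow_zero, pow_one, mul_one,
      zero_add] at hpq
    generalize p.coeff 0 = a, p.coeff 1 = b, q.coeff 0 = c, q.coeff 1 = d at hpq
    have key : X ^ 4 + C (b + d) * X ^ 3 + C (a + c + b * d) * X ^ 2 + C (a * d + b * c) * X
        + C (a * c) = (X ^ 4 + X ^ 3 + X ^ 2 + X + 1 : (ZMod 2)[X]) := by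
      rw [← hpq]; simp only [C_add, C_mul]; ring
    have h0 := congrArg (coeff · 0) key
    have h1 := congrArg (coeff · 1) key
    have h2 := congrArg (coeff · 2) key
    have h3 := congrArg (coeff · 3) key
    simp [-map_add, -map_mul, coeff_X, coeff_one, coeff_X_pow] at h0 h1 h2 h3
    clear key hpq hdeg hm
    revert a b c d
    decide

theorem irreducible_quartic : Irreducible (X ^ 4 + X ^ 3 - 5 * X ^ 2 - X + 3 : ℚ[X]) := by
  have hm : (X ^ 4 + X ^ 3 - 5 * X ^ 2 - X + 3 : ℤ[X]).Monic := by monicity!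
  have h := hm.irreducible_of_irreducible_map (Int.castRingHom (ZMod 2)) _ (by
    convert irreducible_zmod_two using 1
    have h2 : (2 : (ZMod 2)[X]) = 0 := CharTwo.two_eq_zero
    simp
    linear_combination (-3 * X ^ 2 - X + 1) * h2)
  rw [hm.irreducible_iff_irreducible_map_fraction_map (K := ℚ)] at h
  simpa using h

theorem irreducible_resolventCubic : Irreducible (X ^ 3 + 5 * X ^ 2 - 13 * X - 64 : ℚ[X]) := by
  have hm : (X ^ 3 + 5 * X ^ 2 - 13 * X - 64 : ℤ[X]).Monic := by monicity!
  have h := hm.irreducible_of_irreducible_map (Int.castRingHom (ZMod 3)) _ (by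
    have hdeg := hm.natDegree_map (Int.castRingHom (ZMod 3))
    have h3 : (X ^ 3 + 5 * X ^ 2 - 13 * X - 64 : ℤ[X]).natDegree = 3 := by compute_degree!
    refine irreducible_of_degree_le_three_of_not_isRoot (by rw [hdeg, h3]; decide) fun x hx ↦ ?_
    simp [IsRoot] at hx
    revert x
    decide)
  rw [hm.irreducible_iff_irreducible_map_fraction_map (K := ℚ)] at h
  simpa using h

theorem exists_real_roots : ∃ s : Finset ℝ, s.card = 4 ∧
    ∀ a ∈ s, a ^ 4 + a ^ 3 - 5 * a ^ 2 - a + 3 = 0 := by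
  have hc : Continuous fun a : ℝ ↦ a ^ 4 + a ^ 3 - 5 * a ^ 2 - a + 3 := by fun_prop
  obtain ⟨a, ha, ha0⟩ := intermediate_value_Ioo' (show (-3 : ℝ) ≤ -1 by norm_num)
    hc.continuousOn (show (0 : ℝ) ∈ _ by norm_num)
  obtain ⟨b, hb, hb0⟩ := intermediate_value_Ioo (show (-1 : ℝ) ≤ 0 by norm_num)
    hc.continuousOn (show (0 : ℝ) ∈ _ by norm_num)
  obtain ⟨c, hc1, hc0⟩ := intermediate_value_Ioo' (show (0 : ℝ) ≤ 1 by norm_num)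
    hc.continuousOn (show (0 : ℝ) ∈ _ by norm_num)
  obtain ⟨d, hd, hd0⟩ := intermediate_value_Ioo (show (1 : ℝ) ≤ 2 by norm_num)
    hc.continuousOn (show (0 : ℝ) ∈ _ by norm_num)
  have hab := ha.2.trans hb.1
  have hbc := hb.2.trans hc1.1
  have hcd := hc1.2.trans hd.1
  refine ⟨{a, b, c, d}, ?_, by simp [ha0, hb0, hc0, hd0]⟩
  repeat rw [Finset.card_insert_of_notMem]
  · simp
  · simp [hcd.ne]
  · simp [hbc.ne, (hbc.trans hcd).ne]
  · simp [hab.ne, (hab.trans hbc).ne, (hab.trans (hbc.trans hcd)).ne]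

theorem im_eq_zero_of_root (z : ℂ)
    (hz : aeval z (X ^ 4 + X ^ 3 - 5 * X ^ 2 - X + 3 : ℚ[X]) = 0) : z.im = 0 := by
  classical
  obtain ⟨s, hs, hroot⟩ := exists_real_roots
  by_contra him
  have hdeg : (X ^ 4 + X ^ 3 - 5 * X ^ 2 - X + 3 : ℂ[X]).natDegree = 4 := by compute_degree!
  have hne : (X ^ 4 + X ^ 3 - 5 * X ^ 2 - X + 3 : ℂ[X]) ≠ 0 := by
    intro h; simp [h] at hdeg
  have hnot : z ∉ s.map ⟨((↑) : ℝ → ℂ), Complex.ofReal_injective⟩ := by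
    simp only [Finset.mem_map, Function.Embedding.coeFn_mk, not_exists, not_and]
    rintro a - rfl
    simp at him
  have hle := card_le_degree_of_subset_roots (p := (X ^ 4 + X ^ 3 - 5 * X ^ 2 - X + 3 : ℂ[X]))
    (Z := insert z (s.map ⟨((↑) : ℝ → ℂ), Complex.ofReal_injective⟩)) (by
      intro w hw
      rw [Finset.mem_val, Finset.mem_insert, Finset.mem_map] at hw
      rw [mem_roots hne]
      obtain rfl | ⟨a, ha, rfl⟩ := hw
      · simpa [map_ofNat] using hz
      · have := congrArg ((↑) : ℝ → ℂ) (hroot a ha)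
        simpa using this)
  rw [Finset.card_insert_of_notMem hnot, Finset.card_map, hs, hdeg] at hle
  omega

theorem monic_quartic : (X ^ 4 + X ^ 3 - 5 * X ^ 2 - X + 3 : ℚ[X]).Monic := by monicity!

theorem natDegree_quartic : (X ^ 4 + X ^ 3 - 5 * X ^ 2 - X + 3 : ℚ[X]).natDegree = 4 := by
  compute_degree!

theorem minpoly_eq {E : Type*} [Field E] [Algebra ℚ E] {x : E}
    (hx : aeval x (X ^ 4 + X ^ 3 - 5 * X ^ 2 - X + 3 : ℚ[X]) = 0) :
    minpoly ℚ x = X ^ 4 + X ^ 3 - 5 * X ^ 2 - X + 3 :=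
  (minpoly.eq_of_irreducible_of_monic irreducible_quartic hx monic_quartic).symm

theorem algebraAdjoin_eq_top {K L : Type*} [Field K] [Field L] [Algebra K L]
    [Algebra.IsAlgebraic K L] {s : Set L} (h : IntermediateField.adjoin K s = ⊤) :
    Algebra.adjoin K s = ⊤ :=
  IntermediateField.adjoin_eq_top_iff.1 h

theorem isReal_of_adjoin_eq_top {E : Type*} [Field E] [NumberField E] {x : E}
    (hx : aeval x (X ^ 4 + X ^ 3 - 5 * X ^ 2 - X + 3 : ℚ[X]) = 0)
    (htop : IntermediateField.adjoin ℚ {x} = ⊤) (v : NumberField.InfinitePlace E) : v.IsReal := by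
  rw [NumberField.InfinitePlace.isReal_iff, NumberField.ComplexEmbedding.isReal_iff]
  set φ := v.embedding
  have him : (φ x).im = 0 := im_eq_zero_of_root _ (by
    have := congrArg φ.toRatAlgHom hx
    rwa [map_zero, ← aeval_algHom_apply] at this)
  have h : (NumberField.ComplexEmbedding.conjugate φ).toRatAlgHom = φ.toRatAlgHom := by
    refine AlgHom.ext_of_adjoin_eq_top (algebraAdjoin_eq_top htop) ?_
    rintro _ rfl
    exact Complex.conj_eq_iff_im.2 him
  ext y
  exact DFunLike.congr_fun h y

theorem discr_powerBasis {E : Type*} [Field E] [NumberField E] (pb : PowerBasis ℚ E)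
    (hx : aeval pb.gen (X ^ 4 + X ^ 3 - 5 * X ^ 2 - X + 3 : ℚ[X]) = 0) :
    Algebra.discr ℚ pb.basis = 9301 := by
  have hmin := minpoly_eq hx
  have hdim : pb.dim = 4 := by rw [← pb.natDegree_minpoly, hmin, natDegree_quartic]
  have hrank : Module.finrank ℚ E = 4 := by rw [pb.finrank, hdim]
  let b := pb.basis.reindex (finCongr hdim)
  have hb (i : Fin 4) : b i = pb.gen ^ (i : ℕ) := by simp [b]
  have hpow : pb.gen ^ 4 = -3 * b 0 + b 1 + 5 * b 2 - b 3 := by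
    simp [map_ofNat] at hx
    simp [hb]
    linear_combination hx
  have hM : Algebra.leftMulMatrix b pb.gen =
      !![0, 0, 0, -3; 1, 0, 0, 1; 0, 1, 0, 5; 0, 0, 1, -1] := by
    have h3 : pb.gen * b 3 = (-3 : ℚ) • b 0 + (1 : ℚ) • b 1 + (5 : ℚ) • b 2 + (-1 : ℚ) • b 3 := by
      have hb3 : b 3 = pb.gen ^ 3 := hb 3
      simp [Algebra.smul_def]
      linear_combination hpow + pb.gen * hb3
    have h2 : pb.gen * b 2 = b 3 := by rw [hb, hb]; exact (pow_succ' _ _).symm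
    have h1 : pb.gen * b 1 = b 2 := by rw [hb, hb]; exact (pow_succ' _ _).symm
    have h0 : pb.gen * b 0 = b 1 := by rw [hb, hb]; exact (pow_succ' _ _).symm
    ext i j
    rw [Algebra.leftMulMatrix_eq_repr_mul]
    fin_cases j
    · simp [h0]; fin_cases i <;> simp
    · simp [h1]; fin_cases i <;> simp
    · simp [h2]; fin_cases i <;> simp
    · simp [h3]; fin_cases i <;> simp
  have hder : aeval pb.gen (derivative (X ^ 4 + X ^ 3 - 5 * X ^ 2 - X + 3 : ℚ[X])) =
      (4 : ℚ) • pb.gen ^ 3 + (3 : ℚ) • pb.gen ^ 2 - (10 : ℚ) • pb.gen - 1 := by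
    simp [Algebra.smul_def, map_ofNat]
    ring
  rw [Algebra.discr_powerBasis_eq_norm, hmin, hrank, Algebra.norm_eq_matrix_det b, hder]
  simp only [map_add, map_sub, map_smul, map_mul, map_one, hM, pow_succ, pow_zero, one_mul]
  have h1 : (1 : Matrix (Fin 4) (Fin 4) ℚ) = !![1,0,0,0;0,1,0,0;0,0,1,0;0,0,0,1] := by
    ext i j; fin_cases i <;> fin_cases j <;> rfl
  rw [h1]
  simp [Matrix.det_succ_row_zero, Fin.sum_univ_succ, Fin.succAbove]
  norm_num

theorem discr_eq {E : Type*} [Field E] [NumberField E] {x : E}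
    (hx : aeval x (X ^ 4 + X ^ 3 - 5 * X ^ 2 - X + 3 : ℚ[X]) = 0)
    (htop : IntermediateField.adjoin ℚ {x} = ⊤) : NumberField.discr E = 9301 := by
  have hint : IsIntegral ℤ x := ⟨X ^ 4 + X ^ 3 - 5 * X ^ 2 - X + 3, by monicity!, by
    simpa [eval₂_eq_eval_map, map_ofNat] using hx⟩
  have hintQ : IsIntegral ℚ x := hint.tower_top
  let pb : PowerBasis ℚ E := PowerBasis.ofAdjoinEqTop' hintQ (algebraAdjoin_eq_top htop)
  have hgen : pb.gen = x := PowerBasis.ofAdjoinEqTop'_gen ..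
  have hpb := discr_powerBasis pb (by rwa [hgen])
  have e : Module.Free.ChooseBasisIndex ℤ (NumberField.RingOfIntegers E) ≃ Fin pb.dim :=
    (NumberField.integralBasis E).indexEquiv pb.basis
  let b := (NumberField.integralBasis E).reindex e
  have hcoef : IsIntegral ℤ (b.toMatrix pb.basis).det := by
    refine IsIntegral.det fun i j ↦ ?_
    have hj : IsIntegral ℤ (pb.basis j) := by
      rw [pb.basis_eq_pow, hgen]; exact hint.pow _
    have hj' := NumberField.integralBasis_repr_apply E ⟨pb.basis j, hj⟩ (e.symm i)
    rw [Module.Basis.toMatrix_apply, Module.Basis.repr_reindex_apply]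
    erw [hj']
    exact isIntegral_algebraMap
  have hb : Algebra.discr ℚ b = NumberField.discr E := by
    rw [NumberField.coe_discr, Module.Basis.coe_reindex, Algebra.discr_reindex]
  obtain ⟨k, hk⟩ := IsIntegrallyClosed.isIntegral_iff.1 hcoef
  rw [← b.toMatrix_map_vecMul pb.basis, Algebra.discr_of_matrix_vecMul, hb, ← hk] at hpb
  have hZ : k ^ 2 * NumberField.discr E = 9301 := by
    rw [eq_intCast] at hpb
    exact_mod_cast hpb
  have hdvd : k * k ∣ 9301 := ⟨NumberField.discr E, by rw [← hZ]; ring⟩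
  have hsq : Squarefree (9301 : ℤ) := by
    rw [← Int.squarefree_natAbs]
    exact (Nat.squarefree_mul (m := 71) (n := 131) (by norm_num)).2
      ⟨(Nat.prime_iff.1 (by norm_num)).squarefree, (Nat.prime_iff.1 (by norm_num)).squarefree⟩
  have hu := Int.isUnit_iff.1 (hsq k hdvd)
  obtain rfl | rfl := hu <;> simpa using hZ

theorem natDegree_dvd_finrank {K L : Type*} [Field K] [Field L] [Algebra K L]
    [FiniteDimensional K L] {p : K[X]} (hp : Irreducible p) {x : L} (hx : aeval x p = 0) :
    p.natDegree ∣ Module.finrank K L := by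
  have h := minpoly.eq_of_irreducible hp hx
  have hd : (minpoly K x).natDegree = p.natDegree := by
    rw [← h, natDegree_mul_C (by simpa using hp.ne_zero)]
  rw [← hd]
  exact minpoly.degree_dvd (.of_finite K x)

variable {N : Type*} [Field N] [NumberField N]

theorem exists_hom_perm [IsSplittingField ℚ N (X ^ 4 + X ^ 3 - 5 * X ^ 2 - X + 3 : ℚ[X])] :
    ∃ (r : Fin 4 → N) (Φ : (N ≃ₐ[ℚ] N) →* Equiv.Perm (Fin 4)), Function.Injective Φ ∧
      (∀ σ i, r (Φ σ i) = σ (r i)) ∧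
      ∀ t : N, t ^ 4 + t ^ 3 - 5 * t ^ 2 - t + 3 = (t - r 0) * (t - r 1) * (t - r 2) * (t - r 3) := by
  set p : ℚ[X] := X ^ 4 + X ^ 3 - 5 * X ^ 2 - X + 3 with hp
  have hsplit : (p.map (algebraMap ℚ N)).Splits := IsSplittingField.splits N p
  have : Fact (p.map (algebraMap ℚ N)).Splits := ⟨hsplit⟩
  have hsep : p.Separable := irreducible_quartic.separable
  have hcard : Fintype.card (p.rootSet N) = 4 :=
    (card_rootSet_eq_natDegree hsep hsplit).trans natDegree_quartic
  let e : p.rootSet N ≃ Fin 4 := Fintype.equivFinOfCardEq hcard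
  let Ψ := (Gal.galActionHom p N).comp (Gal.restrict p N)
  have hΨ (σ : N ≃ₐ[ℚ] N) (x : p.rootSet N) : (Ψ σ x : N) = σ x := Gal.galActionHom_restrict p N σ x
  refine ⟨fun i ↦ e.symm i, e.permCongrHom.toMonoidHom.comp Ψ, ?_, fun σ i ↦ ?_, fun t ↦ ?_⟩
  · refine e.permCongrHom.injective.comp fun σ τ h ↦ ?_
    have htop := IsSplittingField.adjoin_rootSet N p
    have : (σ : N →ₐ[ℚ] N) = τ := by
      refine AlgHom.ext_of_adjoin_eq_top htop fun x hx ↦ ?_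
      have := congrArg (fun f ↦ ((f ⟨x, hx⟩ : p.rootSet N) : N)) h
      rw [hΨ, hΨ] at this
      exact this
    ext y
    exact DFunLike.congr_fun this y
  · simp [Equiv.permCongrHom, hΨ]
  · have h := hsplit.eq_prod_roots
    rw [(monic_quartic.map _).leadingCoeff, C_1, one_mul] at h
    have hnodup : (p.map (algebraMap ℚ N)).roots.Nodup := nodup_roots hsep.map
    have h' := congrArg (eval t) h
    rw [eval_multiset_prod, Multiset.map_map] at h'
    have h2 : (Multiset.map (eval t ∘ fun x ↦ X - C x) (p.map (algebraMap ℚ N)).roots).prod =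
        ∏ x : p.rootSet N, (t - x) := by
      classical
      rw [← Finset.prod_subtype (p.aroots N).toFinset (by simp [rootSet_def]) fun x ↦ t - x,
        Finset.prod, Multiset.toFinset_val, hnodup.dedup]
      simp
    rw [h2, ← Equiv.prod_comp e.symm, Fin.prod_univ_four] at h'
    rw [← h', hp]
    simp

theorem nonempty_gal_mulEquiv_perm
    [IsSplittingField ℚ N (X ^ 4 + X ^ 3 - 5 * X ^ 2 - X + 3 : ℚ[X])] :
    Nonempty ((N ≃ₐ[ℚ] N) ≃* Equiv.Perm (Fin 4)) := by
  obtain ⟨r, Φ, hinj, hΦ, hr⟩ := exists_hom_perm (N := N)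
  have : IsGalois ℚ N := .of_separable_splitting_field irreducible_quartic.separable
  have v0 := hr 0
  have v1 := hr 1
  have v2 := hr (-1)
  have v3 := hr 2
  have e1 : r 0 + r 1 + r 2 + r 3 = -1 := by grind
  have e2 : r 0 * r 1 + r 0 * r 2 + r 0 * r 3 + r 1 * r 2 + r 1 * r 3 + r 2 * r 3 = -5 := by grind
  have e3 : r 0 * r 1 * r 2 + r 0 * r 1 * r 3 + r 0 * r 2 * r 3 + r 1 * r 2 * r 3 = 1 := by grind
  have e4 : r 0 * r 1 * r 2 * r 3 = 3 := by linear_combination -v0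
  have hcard4 : 4 ∣ Nat.card (N ≃ₐ[ℚ] N) := by
    rw [IsGalois.card_aut_eq_finrank, ← natDegree_quartic]
    refine natDegree_dvd_finrank irreducible_quartic (x := r 0) ?_
    simpa [map_ofNat] using hr (r 0)
  have hcard3 : 3 ∣ Nat.card (N ≃ₐ[ℚ] N) := by
    have hd : (X ^ 3 + 5 * X ^ 2 - 13 * X - 64 : ℚ[X]).natDegree = 3 := by compute_degree!
    rw [IsGalois.card_aut_eq_finrank]
    nth_rw 1 [← hd]
    refine natDegree_dvd_finrank irreducible_resolventCubic (x := r 0 * r 1 + r 2 * r 3) ?_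
    have key (a b c d : N) : (a * b + c * d) ^ 3
        - (a * b + a * c + a * d + b * c + b * d + c * d) * (a * b + c * d) ^ 2
        + ((a + b + c + d) * (a * b * c + a * b * d + a * c * d + b * c * d) - 4 * (a * b * c * d))
          * (a * b + c * d)
        - ((a + b + c + d) ^ 2 * (a * b * c * d)
          - 4 * (a * b + a * c + a * d + b * c + b * d + c * d) * (a * b * c * d)
          + (a * b * c + a * b * d + a * c * d + b * c * d) ^ 2) = 0 := by ring
    have := key (r 0) (r 1) (r 2) (r 3)
    rw [e1, e2, e3, e4] at this
    simp [map_ofNat]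
    linear_combination this
  have hle : Nat.card (N ≃ₐ[ℚ] N) ∣ 24 := by
    have := Subgroup.card_dvd_of_injective Φ hinj
    rwa [Nat.card_eq_fintype_card (α := Equiv.Perm _), Fintype.card_perm, Fintype.card_fin] at this
  have h12 : 12 ∣ Nat.card (N ≃ₐ[ℚ] N) :=
    Nat.Coprime.mul_dvd_of_dvd_of_dvd (by norm_num) hcard4 hcard3
  have hrange : Nat.card Φ.range = Nat.card (N ≃ₐ[ℚ] N) :=
    (Nat.card_congr (MonoidHom.ofInjective hinj).toEquiv).symm
  by_cases h24 : Nat.card (N ≃ₐ[ℚ] N) = 24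
  · refine ⟨MulEquiv.ofBijective Φ ((Nat.bijective_iff_injective_and_card _).2 ⟨hinj, ?_⟩)⟩
    rw [h24, Nat.card_eq_fintype_card, Fintype.card_perm, Fintype.card_fin]
    rfl
  exfalso
  have hc : Nat.card (N ≃ₐ[ℚ] N) = 12 := by
    obtain ⟨k, hk⟩ := h12
    have := Nat.le_of_dvd (by norm_num) hle
    have : 0 < Nat.card (N ≃ₐ[ℚ] N) := Nat.card_pos
    omega
  have hindex : Φ.range.index = 2 := by
    have := Φ.range.card_mul_index
    rw [hrange, hc, Nat.card_eq_fintype_card, Fintype.card_perm, Fintype.card_fin] at this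
    simp [Nat.factorial] at this
    omega
  have halt := Equiv.Perm.eq_alternatingGroup_of_index_eq_two hindex
  set δ : N := (Matrix.vandermonde r).det with hδ
  have hfix (σ : N ≃ₐ[ℚ] N) : σ δ = δ := by
    have hsign : Equiv.Perm.sign (Φ σ) = 1 :=
      Equiv.Perm.mem_alternatingGroup.1 (halt ▸ ⟨σ, rfl⟩)
    have h1 : σ.toAlgHom.mapMatrix (Matrix.vandermonde r) =
        (Matrix.vandermonde r).submatrix (Φ σ) id := by
      ext i j
      simp [Matrix.vandermonde_apply, hΦ]
    have h2 := Matrix.det_permute (Φ σ) (Matrix.vandermonde r)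
    rw [hsign, ← h1, ← AlgHom.map_det] at h2
    simpa using h2
  have hδsq : δ ^ 2 = 9301 := by
    have key (a b c d A B C D : N) (hA : a + b + c + d = A)
        (hB : a * b + a * c + a * d + b * c + b * d + c * d = B)
        (hC : a * b * c + a * b * d + a * c * d + b * c * d = C) (hD : a * b * c * d = D) :
        ((b - a) * (c - a) * (d - a) * ((c - b) * (d - b)) * (d - c)) ^ 2 =
          256 * D ^ 3 - 192 * A * C * D ^ 2 - 128 * B ^ 2 * D ^ 2 + 144 * B * C ^ 2 * D
          - 27 * C ^ 4 + 144 * A ^ 2 * B * D ^ 2 - 6 * A ^ 2 * C ^ 2 * D - 80 * A * B ^ 2 * C * D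
          + 18 * A * B * C ^ 3 + 16 * B ^ 4 * D - 4 * B ^ 3 * C ^ 2 - 27 * A ^ 4 * D ^ 2
          + 18 * A ^ 3 * B * C * D - 4 * A ^ 3 * C ^ 3 - 4 * A ^ 2 * B ^ 3 * D
          + A ^ 2 * B ^ 2 * C ^ 2 := by
      subst hA hB hC hD
      ring
    have h := key (r 0) (r 1) (r 2) (r 3) _ _ _ _ e1 e2 e3 e4
    have hv : δ = (r 1 - r 0) * (r 2 - r 0) * (r 3 - r 0) * ((r 2 - r 1) * (r 3 - r 1))
        * (r 3 - r 2) := by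
      rw [hδ, Matrix.det_vandermonde]
      simp [Fin.prod_univ_succ, Fin.prod_Ioi_succ]
      ring
    rw [hv, h]
    norm_num
  obtain ⟨q, hq⟩ := (IsGalois.mem_range_algebraMap_iff_fixed δ).2 hfix
  have hqsq : (9301 : ℚ) = q * q := by
    apply (algebraMap ℚ N).injective
    rw [map_mul, hq, ← sq, hδsq]
    simp
  exact (by norm_num : ¬ IsSquare (9301 : ℚ)) ⟨q, hqsq⟩

end TotallyRealQuartic

/-- The quartic `f = x⁴ + x³ - 5x² - x + 3 ∈ ℚ[x]` is irreducible over `ℚ`, all of its complex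
roots are real (so the quartic number field it generates is totally real), the number field
`E = ℚ[x]/(f)` has discriminant `9301 = 71 ⬝ 131`, and the Galois group of the splitting field
of `f` over `ℚ` is isomorphic to `S₄`. -/
theorem quartic_field_x4_x3_sub_5x2_sub_x_add_3 :
    Irreducible (X ^ 4 + X ^ 3 - 5 * X ^ 2 - X + 3 : ℚ[X]) ∧
    (∀ z : ℂ, aeval z (X ^ 4 + X ^ 3 - 5 * X ^ 2 - X + 3 : ℚ[X]) = 0 → z.im = 0) ∧
    (∀ (E : Type) [Field E] [NumberField E], ∀ x : E,
      aeval x (X ^ 4 + X ^ 3 - 5 * X ^ 2 - X + 3 : ℚ[X]) = 0 →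
      IntermediateField.adjoin ℚ {x} = ⊤ →
      NumberField.discr E = 9301 ∧ (9301 : ℤ) = 71 * 131 ∧
      (∀ v : NumberField.InfinitePlace E, v.IsReal)) ∧
    (∀ (N : Type) [Field N] [NumberField N],
      IsSplittingField ℚ N (X ^ 4 + X ^ 3 - 5 * X ^ 2 - X + 3 : ℚ[X]) →
      Nonempty ((N ≃ₐ[ℚ] N) ≃* Equiv.Perm (Fin 4))) := by
  refine ⟨TotallyRealQuartic.irreducible_quartic, TotallyRealQuartic.im_eq_zero_of_root, ?_, ?_⟩
  · intro E _ _ x hx htop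
    exact ⟨TotallyRealQuartic.discr_eq hx htop, by norm_num,
      TotallyRealQuartic.isReal_of_adjoin_eq_top hx htop⟩
  · intro N _ _ _
    exact TotallyRealQuartic.nonempty_gal_mulEquiv_perm
end

section
/- Let f(x) = x⁴ + 2x³ − 75x² − 112x + 816 ∈ ℚ[x]. Then f is irreducible over ℚ, all four complex roots of f are real (so the number field E = ℚ[x]/(f) is totally real), the discriminant of the number field E equals 2² · 5 · 13936963, the Galois group of the splitting field of f over ℚ is isomorphic to the symmetric group S₄, and the prime 71 splits completely in E. -/
open Polynomial NumberField

/-- The quartic `x⁴ + 2x³ - 75x² - 112x + 816` over a commutative ring. -/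
noncomputable def quartic (R : Type*) [CommRing R] : R[X] :=
  X ^ 4 + 2 * X ^ 3 - 75 * X ^ 2 - 112 * X + 816

/-- The resolvent cubic `x³ + 75x² - 3488x - 260608` of `quartic`. -/
noncomputable def resolventCubic (R : Type*) [CommRing R] : R[X] :=
  X ^ 3 + 75 * X ^ 2 - 3488 * X - 260608

section Polynomials

variable {R S : Type*} [CommRing R] [CommRing S]

lemma map_quartic (φ : R →+* S) : (quartic R).map φ = quartic S := by
  simp [quartic]

lemma aeval_quartic [Algebra R S] (x : S) :
    aeval x (quartic R) = x ^ 4 + 2 * x ^ 3 - 75 * x ^ 2 - 112 * x + 816 := by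
  simp [quartic, map_ofNat]

lemma natDegree_quartic [Nontrivial R] : (quartic R).natDegree = 4 := by
  unfold quartic
  compute_degree!

lemma monic_quartic : (quartic R).Monic := by
  nontriviality R
  unfold quartic
  monicity!

lemma map_resolventCubic (φ : R →+* S) : (resolventCubic R).map φ = resolventCubic S := by
  simp [resolventCubic]

lemma natDegree_resolventCubic [Nontrivial R] : (resolventCubic R).natDegree = 3 := by
  unfold resolventCubic
  compute_degree!

lemma monic_resolventCubic : (resolventCubic R).Monic := by
  nontriviality R
  unfold resolventCubic
  monicity!

end Polynomials

instance fact_prime_eleven : Fact (Nat.Prime 11) := ⟨by norm_num⟩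

instance fact_prime_seven : Fact (Nat.Prime 7) := ⟨by norm_num⟩

instance fact_prime_seventy_one : Fact (Nat.Prime 71) := ⟨by norm_num⟩

lemma irreducible_quartic_zmod_eleven : Irreducible (quartic (ZMod 11)) := by
  have hne : quartic (ZMod 11) ≠ 1 := fun h => by
    simpa [h] using natDegree_quartic (R := ZMod 11)
  rw [monic_quartic.irreducible_iff_lt_natDegree_lt hne, natDegree_quartic]
  rintro q hq hdeg ⟨k, hk⟩
  have hkm : k.Monic := hq.of_mul_monic_left (hk ▸ monic_quartic)
  have hadd : q.natDegree + k.natDegree = 4 := by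
    rw [← hq.natDegree_mul hkm, ← hk, natDegree_quartic]
  have hcases : q.natDegree = 1 ∨ q.natDegree = 2 := by
    simp only [Finset.mem_Ioc] at hdeg
    omega
  rcases hcases with h | h
  · have hq' := hq.as_sum
    simp only [h, Finset.sum_range_one, pow_one, pow_zero, mul_one] at hq'
    generalize q.coeff 0 = a at hq'
    have hroot : (quartic (ZMod 11)).eval (-a) = 0 := by
      rw [hk, hq']
      simp
    clear hq' hk
    simp only [quartic, eval_add, eval_sub, eval_mul, eval_pow, eval_X, eval_ofNat] at hroot
    revert a
    decide
  · have h' : k.natDegree = 2 := by omega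
    have hq' := hq.as_sum
    have hk' := hkm.as_sum
    simp only [h, h', Finset.sum_range_succ, Finset.sum_range_zero, pow_one, pow_zero, mul_one,
      zero_add] at hq' hk'
    generalize q.coeff 0 = b at hq'
    generalize q.coeff 1 = a at hq'
    generalize k.coeff 0 = d at hk'
    generalize k.coeff 1 = c at hk'
    have hprod : quartic (ZMod 11) = C 1 * X ^ 4 + C (a + c) * X ^ 3 + C (b + d + a * c) * X ^ 2
        + C (a * d + b * c) * X + C (b * d) := by
      rw [hk, hq', hk']
      simp only [C_add, C_mul, C_1]
      ring
    have hexp : quartic (ZMod 11) = C 1 * X ^ 4 + C 2 * X ^ 3 + C (-75) * X ^ 2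
        + C (-112) * X + C 816 := by
      simp only [quartic, C_neg, C_1, C_ofNat]
      ring
    rw [hexp] at hprod
    have h0 := congrArg (coeff · 0) hprod
    have h1 := congrArg (coeff · 1) hprod
    have h2 := congrArg (coeff · 2) hprod
    have h3 := congrArg (coeff · 3) hprod
    simp only [coeff_add, coeff_C_mul, coeff_X_pow, coeff_X, coeff_C] at h0 h1 h2 h3
    norm_num at h0 h1 h2 h3
    obtain rfl : c = 2 - a := by linear_combination -h3
    obtain rfl : d = -75 - b - a * (2 - a) := by linear_combination -h2
    clear hprod hexp h2 h3 hq' hk'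
    revert a b
    decide

lemma irreducible_resolventCubic_zmod_seven : Irreducible (resolventCubic (ZMod 7)) := by
  rw [monic_resolventCubic.irreducible_iff_roots_eq_zero_of_degree_le_three
    (by rw [natDegree_resolventCubic]; norm_num) (by rw [natDegree_resolventCubic]),
    Multiset.eq_zero_iff_forall_notMem]
  intro a ha
  have h := isRoot_of_mem_roots ha
  simp only [resolventCubic, IsRoot.def, eval_add, eval_sub, eval_mul, eval_pow, eval_X,
    eval_ofNat] at h
  clear ha
  revert a
  decide

lemma irreducible_quartic_rat : Irreducible (quartic ℚ) := by
  rw [← map_quartic (algebraMap ℤ ℚ), ← monic_quartic.irreducible_iff_irreducible_map_fraction_map]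
  refine monic_quartic.irreducible_of_irreducible_map (Int.castRingHom (ZMod 11)) _ ?_
  rw [map_quartic]
  exact irreducible_quartic_zmod_eleven

lemma irreducible_resolventCubic_rat : Irreducible (resolventCubic ℚ) := by
  rw [← map_resolventCubic (algebraMap ℤ ℚ),
    ← monic_resolventCubic.irreducible_iff_irreducible_map_fraction_map]
  refine monic_resolventCubic.irreducible_of_irreducible_map (Int.castRingHom (ZMod 7)) _ ?_
  rw [map_resolventCubic]
  exact irreducible_resolventCubic_zmod_seven

section Vieta

variable {K : Type*} [Field K] {r : Fin 4 → K}

/-- Vieta's formulas for four distinct roots of `quartic`. -/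
lemma vieta_quartic (hr : Function.Injective r)
    (h : ∀ i, r i ^ 4 + 2 * r i ^ 3 - 75 * r i ^ 2 - 112 * r i + 816 = 0) :
    r 0 + r 1 + r 2 + r 3 = -2 ∧
    r 0 * r 1 + r 0 * r 2 + r 0 * r 3 + r 1 * r 2 + r 1 * r 3 + r 2 * r 3 = -75 ∧
    r 0 * r 1 * r 2 + r 0 * r 1 * r 3 + r 0 * r 2 * r 3 + r 1 * r 2 * r 3 = 112 ∧
    r 0 * r 1 * r 2 * r 3 = 816 := by
  have hsub (i j : Fin 4) (hij : i ≠ j) : r i - r j ≠ 0 := sub_ne_zero.2 (hr.ne hij)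
  have d1 (i j : Fin 4) (hij : i ≠ j) : r i ^ 3 + r i ^ 2 * r j + r i * r j ^ 2 + r j ^ 3
      + 2 * (r i ^ 2 + r i * r j + r j ^ 2) - 75 * (r i + r j) - 112 = 0 := by
    refine mul_left_cancel₀ (hsub i j hij) ?_
    linear_combination h i - h j
  have d2 (i j k : Fin 4) (hij : i ≠ j) (hik : i ≠ k) (hjk : j ≠ k) :
      r i ^ 2 + r j ^ 2 + r k ^ 2 + r i * r j + r i * r k + r j * r k
        + 2 * (r i + r j + r k) - 75 = 0 := by
    refine mul_left_cancel₀ (hsub j k hjk) ?_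
    linear_combination d1 i j hij - d1 i k hik
  have d3 : r 0 + r 1 + r 2 + r 3 + 2 = 0 := by
    refine mul_left_cancel₀ (hsub 2 3 (by decide)) ?_
    linear_combination d2 0 1 2 (by decide) (by decide) (by decide)
      - d2 0 1 3 (by decide) (by decide) (by decide)
  have e2 := d2 0 1 2 (by decide) (by decide) (by decide)
  have e3 := d1 0 1 (by decide)
  have e4 := h 0
  obtain h3 : r 3 = -2 - r 0 - r 1 - r 2 := by linear_combination d3
  rw [h3]
  refine ⟨by ring, by linear_combination -e2, by linear_combination e3 - (r 0 + r 1) * e2, ?_⟩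
  linear_combination -e4 + r 0 * e3 - r 0 * r 1 * e2

lemma det_vandermonde_sq_of_roots_quartic (hr : Function.Injective r)
    (h : ∀ i, r i ^ 4 + 2 * r i ^ 3 - 75 * r i ^ 2 - 112 * r i + 816 = 0) :
    (Matrix.vandermonde r).det ^ 2 = 71357250560 := by
  obtain ⟨h1, h2, h3, h4⟩ := vieta_quartic hr h
  set a := r 0
  set b := r 1
  set c := r 2
  set d := r 3
  have key (e₁ e₂ e₃ e₄ : K) (he₁ : a + b + c + d = e₁)
      (he₂ : a * b + a * c + a * d + b * c + b * d + c * d = e₂)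
      (he₃ : a * b * c + a * b * d + a * c * d + b * c * d = e₃) (he₄ : a * b * c * d = e₄) :
      (Matrix.vandermonde r).det ^ 2 =
        256 * e₄ ^ 3 - 192 * e₁ * e₃ * e₄ ^ 2 - 128 * e₂ ^ 2 * e₄ ^ 2 + 144 * e₂ * e₃ ^ 2 * e₄
        - 27 * e₃ ^ 4 + 144 * e₁ ^ 2 * e₂ * e₄ ^ 2 - 6 * e₁ ^ 2 * e₃ ^ 2 * e₄
        - 80 * e₁ * e₂ ^ 2 * e₃ * e₄ + 18 * e₁ * e₂ * e₃ ^ 3 + 16 * e₂ ^ 4 * e₄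
        - 4 * e₂ ^ 3 * e₃ ^ 2 - 27 * e₁ ^ 4 * e₄ ^ 2 + 18 * e₁ ^ 3 * e₂ * e₃ * e₄
        - 4 * e₁ ^ 3 * e₃ ^ 3 - 4 * e₁ ^ 2 * e₂ ^ 3 * e₄ + e₁ ^ 2 * e₂ ^ 2 * e₃ ^ 2 := by
    have hdet : (Matrix.vandermonde r).det =
        (b - a) * (c - a) * (d - a) * ((c - b) * (d - b)) * (d - c) := by
      rw [Matrix.det_vandermonde]
      have i0 : Finset.Ioi (0 : Fin 4) = {1, 2, 3} := by decide
      have i1 : Finset.Ioi (1 : Fin 4) = {2, 3} := by decide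
      have i2 : Finset.Ioi (2 : Fin 4) = {3} := by decide
      have i3 : Finset.Ioi (3 : Fin 4) = ∅ := by decide
      simp only [Fin.prod_univ_four, i0, i1, i2, i3, Finset.prod_insert, Finset.prod_singleton,
        Finset.prod_empty, Finset.mem_insert, Finset.mem_singleton, Fin.reduceEq, or_self,
        not_false_eq_true]
      ring
    rw [hdet]
    subst he₁ he₂ he₃ he₄
    ring
  rw [key _ _ _ _ h1 h2 h3 h4]
  norm_num

/-- The number `r₀r₁ + r₂r₃` attached to four distinct roots of `quartic` is a root of
`resolventCubic`. -/
lemma resolventCubic_of_roots_quartic (hr : Function.Injective r)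
    (h : ∀ i, r i ^ 4 + 2 * r i ^ 3 - 75 * r i ^ 2 - 112 * r i + 816 = 0) :
    (resolventCubic K).eval (r 0 * r 1 + r 2 * r 3) = 0 := by
  obtain ⟨h1, h2, h3, h4⟩ := vieta_quartic hr h
  set a := r 0
  set b := r 1
  set c := r 2
  set d := r 3
  have key (e₁ e₂ e₃ e₄ : K) (he₁ : a + b + c + d = e₁)
      (he₂ : a * b + a * c + a * d + b * c + b * d + c * d = e₂)
      (he₃ : a * b * c + a * b * d + a * c * d + b * c * d = e₃) (he₄ : a * b * c * d = e₄) :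
      (a * b + c * d) ^ 3 - e₂ * (a * b + c * d) ^ 2 + (e₁ * e₃ - 4 * e₄) * (a * b + c * d)
        - (e₁ ^ 2 * e₄ - 4 * e₂ * e₄ + e₃ ^ 2) = 0 := by
    subst he₁ he₂ he₃ he₄
    ring
  simp only [resolventCubic, eval_add, eval_sub, eval_mul, eval_pow, eval_X, eval_ofNat]
  linear_combination key _ _ _ _ h1 h2 h3 h4

end Vieta

lemma exists_real_roots_quartic : ∃ r : Fin 4 → ℝ, Function.Injective r ∧
    ∀ i, r i ^ 4 + 2 * r i ^ 3 - 75 * r i ^ 2 - 112 * r i + 816 = 0 := by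
  have hc (s : Set ℝ) :
      ContinuousOn (fun x : ℝ => x ^ 4 + 2 * x ^ 3 - 75 * x ^ 2 - 112 * x + 816) s := by
    fun_prop
  obtain ⟨a, ⟨ha, ha'⟩, hfa⟩ := intermediate_value_Ioo' (by norm_num) (hc (Set.Icc (-9) (-8)))
    (show (0 : ℝ) ∈ _ by norm_num)
  obtain ⟨b, ⟨hb, hb'⟩, hfb⟩ := intermediate_value_Ioo (by norm_num) (hc (Set.Icc (-5) (-4)))
    (show (0 : ℝ) ∈ _ by norm_num)
  obtain ⟨c, ⟨hc₁, hc₂⟩, hfc⟩ := intermediate_value_Ioo' (by norm_num) (hc (Set.Icc 0 3))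
    (show (0 : ℝ) ∈ _ by norm_num)
  obtain ⟨d, ⟨hd, hd'⟩, hfd⟩ := intermediate_value_Ioo (by norm_num) (hc (Set.Icc 7 8))
    (show (0 : ℝ) ∈ _ by norm_num)
  refine ⟨![a, b, c, d], (Fin.strictMono_iff_lt_succ.2 fun i => ?_).injective, fun i => ?_⟩
  · fin_cases i
    · show a < b
      linarith
    · show b < c
      linarith
    · show c < d
      linarith
  · fin_cases i <;> assumption

lemma im_eq_zero_of_aeval_quartic {z : ℂ} (hz : aeval z (quartic ℚ) = 0) : z.im = 0 := by
  classical
  obtain ⟨r, hr, hroot⟩ := exists_real_roots_quartic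
  let s : Finset ℂ := Finset.univ.image fun i => (r i : ℂ)
  have hs : s.card = 4 :=
    Finset.card_image_of_injective _ (Complex.ofReal_injective.comp hr)
  by_contra hz'
  have hzs : z ∉ s := by
    simp only [s, Finset.mem_image, Finset.mem_univ, true_and, not_exists]
    rintro i rfl
    exact hz' (Complex.ofReal_im _)
  have hmem (w : ℂ) (hw : w ^ 4 + 2 * w ^ 3 - 75 * w ^ 2 - 112 * w + 816 = 0) :
      w ∈ (quartic ℂ).roots := by
    rw [mem_roots monic_quartic.ne_zero, IsRoot.def, ← coe_aeval_eq_eval, aeval_quartic, hw]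
  have hle : (insert z s).card ≤ (quartic ℂ).natDegree := by
    refine card_le_degree_of_subset_roots fun w hw => ?_
    rw [Finset.mem_val, Finset.mem_insert] at hw
    rcases hw with rfl | hw
    · exact hmem _ (by rwa [aeval_quartic] at hz)
    · obtain ⟨i, -, rfl⟩ := Finset.mem_image.1 hw
      exact hmem _ (by exact_mod_cast hroot i)
  rw [Finset.card_insert_of_notMem hzs, hs, natDegree_quartic] at hle
  omega

section Stickelberger

open Matrix in
/-- The determinant and the permanent agree up to twice a sum of products of entries. -/
lemma exists_det_eq_permanent_sub_two_mul {n R : Type*} [Fintype n] [DecidableEq n] [CommRing R]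
    (A : Subring R) (M : Matrix n n R) (hM : ∀ i j, M i j ∈ A) :
    ∃ b ∈ A, M.det = M.permanent - 2 * b := by
  refine ⟨∑ σ : Equiv.Perm n, if Equiv.Perm.sign σ = 1 then 0 else ∏ i, M (σ i) i,
    A.sum_mem fun σ _ => ?_, ?_⟩
  · split_ifs
    · exact A.zero_mem
    · exact A.prod_mem fun i _ => hM _ _
  · rw [det_apply', permanent, Finset.mul_sum, ← Finset.sum_sub_distrib]
    refine Finset.sum_congr rfl fun σ _ => ?_
    rcases Int.units_eq_one_or (Equiv.Perm.sign σ) with h | h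
    · simp [h]
    · have : (-1 : ℤˣ) ≠ 1 := by decide
      simp only [h, this, if_false, Units.val_neg, Units.val_one, Int.cast_neg, Int.cast_one]
      ring

/-- Stickelberger's theorem: the discriminant of a number field is a square modulo `4`. -/
theorem exists_discr_eq_sq_add_four_mul (K : Type*) [Field K] [NumberField K] :
    ∃ a c : ℤ, discr K = a ^ 2 + 4 * c := by
  classical
  let L := AlgebraicClosure ℚ
  have : IsGalois ℚ L := by
    convert @IsAlgClosure.isGalois ℚ L _ _ (AlgebraicClosure.instAlgebra ℚ) inferInstance _
    exact Subsingleton.elim _ _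
  let b := integralBasis K
  have hcard : Fintype.card (Module.Free.ChooseBasisIndex ℤ (𝓞 K)) =
      Fintype.card (K →ₐ[ℚ] L) := by
    rw [AlgHom.card, Module.finrank_eq_card_basis b]
  let e := Fintype.equivOfCardEq hcard
  let M := Algebra.embeddingsMatrixReindex ℚ L b e
  have hM (i j) : M i j = e j (b i) := rfl
  have hint (i j) : M i j ∈ (integralClosure ℤ L).toSubring := by
    refine IsIntegral.map ((e j).restrictScalars ℤ) ?_
    rw [integralBasis_apply]
    exact RingOfIntegers.isIntegral_coe _
  have hsq : algebraMap ℚ L (discr K) = M.det ^ 2 := by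
    rw [coe_discr]
    exact Algebra.discr_eq_det_embeddingsMatrixReindex_pow_two ℚ L b e
  obtain ⟨x, hx, hdet⟩ := exists_det_eq_permanent_sub_two_mul _ M hint
  have hperm_int : IsIntegral ℤ M.permanent :=
    (integralClosure ℤ L).toSubring.sum_mem fun σ _ =>
      (integralClosure ℤ L).toSubring.prod_mem fun i _ => hint _ _
  have hperm_fixed (g : L ≃ₐ[ℚ] L) : g M.permanent = M.permanent := by
    let σ : Equiv.Perm (Module.Free.ChooseBasisIndex ℤ (𝓞 K)) :=
      (e.trans (AlgEquiv.refl.arrowCongr g)).trans e.symm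
    have hσ : g M.permanent = (M.submatrix id σ).permanent := by
      simp only [Matrix.permanent, map_sum, map_prod]
      refine Finset.sum_congr rfl fun τ _ => Finset.prod_congr rfl fun i _ => ?_
      simp [hM, σ]
    rw [hσ, Matrix.permanent_permute_rows]
  obtain ⟨q, hq⟩ := IntermediateField.mem_bot.1 ((InfiniteGalois.mem_bot_iff_fixed _).2 hperm_fixed)
  have hinj : Function.Injective (algebraMap ℚ L) := (algebraMap ℚ L).injective
  obtain ⟨a, rfl⟩ : ∃ a : ℤ, algebraMap ℤ ℚ a = q := by
    rw [← IsIntegrallyClosed.isIntegral_iff, ← isIntegral_algebraMap_iff hinj, hq]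
    exact hperm_int
  have hq' : (a : L) = M.permanent := by rw [← hq]; simp
  obtain ⟨c, hc⟩ : ∃ c : ℤ, algebraMap ℤ ℚ c = ((discr K : ℚ) - a ^ 2) / 4 := by
    rw [← IsIntegrallyClosed.isIntegral_iff, ← isIntegral_algebraMap_iff hinj]
    have : algebraMap ℚ L (((discr K : ℚ) - a ^ 2) / 4) = x * (x - M.permanent) := by
      rw [map_div₀, map_sub, hsq, hdet, map_pow, map_intCast, hq', map_ofNat]
      ring
    rw [this]
    exact IsIntegral.mul hx (IsIntegral.sub hx hperm_int)
  refine ⟨a, c, ?_⟩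
  rw [← Int.cast_inj (α := ℚ)]
  push_cast
  rw [eq_intCast] at hc
  linarith

end Stickelberger

section GaloisGroup

variable (N : Type*) [Field N] [NumberField N] [IsSplittingField ℚ N (quartic ℚ)]

/-- Four distinct roots exhausting the roots of `quartic` in its splitting field. -/
lemma exists_equiv_rootSet_quartic : Nonempty (Fin 4 ≃ (quartic ℚ).rootSet N) := by
  have hcard : Fintype.card ((quartic ℚ).rootSet N) = 4 := by
    rw [card_rootSet_eq_natDegree irreducible_quartic_rat.separable
      (IsSplittingField.splits N (quartic ℚ)), natDegree_quartic]
  exact ⟨(Fintype.equivFinOfCardEq hcard).symm⟩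

variable {N}

/-- The action of the Galois group on the roots of `quartic`, numbered by `Fin 4`. -/
lemma exists_injective_galois_hom (e : Fin 4 ≃ (quartic ℚ).rootSet N) :
    ∃ φ : (N ≃ₐ[ℚ] N) →* Equiv.Perm (Fin 4), Function.Injective φ ∧
      ∀ g i, (e (φ g i) : N) = g (e i) := by
  have hmaps (g : N ≃ₐ[ℚ] N) (i : Fin 4) : ∃ j, (e j : N) = g (e i) := by
    have hi := (e i).2
    rw [mem_rootSet] at hi
    have : g (e i) ∈ (quartic ℚ).rootSet N := by
      rw [mem_rootSet]
      exact ⟨hi.1, by rw [aeval_algHom_apply, hi.2, map_zero]⟩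
    exact ⟨e.symm ⟨_, this⟩, by simp⟩
  choose s hs using hmaps
  have he : Function.Injective fun i => (e i : N) := Subtype.val_injective.comp e.injective
  have hs_inj (g : N ≃ₐ[ℚ] N) : Function.Injective (s g) := fun i j hij => by
    have := hs g i
    rw [hij, hs g j] at this
    exact (he (g.injective this)).symm
  let p (g : N ≃ₐ[ℚ] N) : Equiv.Perm (Fin 4) :=
    Equiv.ofBijective (s g) (Finite.injective_iff_bijective.1 (hs_inj g))
  have hp (g i) : (e (p g i) : N) = g (e i) := hs g i
  let φ : (N ≃ₐ[ℚ] N) →* Equiv.Perm (Fin 4) := MonoidHom.mk' p fun g h => by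
    ext1 i
    refine he ?_
    simp only [Equiv.Perm.mul_apply, hp, AlgEquiv.mul_apply]
  refine ⟨φ, (injective_iff_map_eq_one φ).2 fun g hg => ?_, hp⟩
  have hfix : Set.EqOn (g : N →ₐ[ℚ] N) (AlgHom.id ℚ N) ((quartic ℚ).rootSet N) := by
    intro x hx
    obtain ⟨i, hi⟩ := e.surjective ⟨x, hx⟩
    have h := hp g i
    have hpi : p g i = i := congrArg (fun σ : Equiv.Perm (Fin 4) => σ i) hg
    rw [hpi, hi] at h
    exact h.symm
  have := AlgHom.ext_of_adjoin_eq_top (IsSplittingField.adjoin_rootSet N (quartic ℚ)) hfix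
  ext x
  exact DFunLike.congr_fun this x

lemma not_isSquare_discr_quartic : ¬ IsSquare (71357250560 : ℚ) := by
  rw [show (71357250560 : ℚ) = (71357250560 : ℕ) by norm_num, Rat.isSquare_natCast_iff]
  rintro ⟨n, hn⟩
  have h1 : 267127 < n := by nlinarith
  have h2 : n < 267128 := by nlinarith
  omega

theorem nonempty_mulEquiv_perm_of_isSplittingField_quartic :
    Nonempty ((N ≃ₐ[ℚ] N) ≃* Equiv.Perm (Fin 4)) := by
  obtain ⟨e⟩ := exists_equiv_rootSet_quartic N
  obtain ⟨φ, hφ, hact⟩ := exists_injective_galois_hom e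
  have : IsGalois ℚ N :=
    IsGalois.of_separable_splitting_field irreducible_quartic_rat.separable
  let r : Fin 4 → N := fun i => e i
  have hr : Function.Injective r := Subtype.val_injective.comp e.injective
  have hroot' (i) : aeval (r i) (quartic ℚ) = 0 := (mem_rootSet.1 (e i).2).2
  have hroot (i) : r i ^ 4 + 2 * r i ^ 3 - 75 * r i ^ 2 - 112 * r i + 816 = 0 := by
    rw [← aeval_quartic (R := ℚ), hroot']
  have hcard : Nat.card (N ≃ₐ[ℚ] N) = Module.finrank ℚ N := IsGalois.card_aut_eq_finrank ℚ N
  have h4 : 4 ∣ Nat.card φ.range := by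
    rw [← Nat.card_congr (φ.ofInjective hφ).toEquiv, hcard, ← natDegree_quartic (R := ℚ),
      minpoly.eq_of_irreducible_of_monic irreducible_quartic_rat (hroot' 0) monic_quartic]
    exact minpoly.degree_dvd (Algebra.IsIntegral.isIntegral _)
  have h3 : 3 ∣ Nat.card φ.range := by
    have hres : aeval (r 0 * r 1 + r 2 * r 3) (resolventCubic ℚ) = 0 := by
      rw [← eval_map_algebraMap, map_resolventCubic]
      exact resolventCubic_of_roots_quartic hr hroot
    rw [← Nat.card_congr (φ.ofInjective hφ).toEquiv, hcard,
      ← natDegree_resolventCubic (R := ℚ),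
      minpoly.eq_of_irreducible_of_monic irreducible_resolventCubic_rat hres monic_resolventCubic]
    exact minpoly.degree_dvd (Algebra.IsIntegral.isIntegral _)
  have hmul : Nat.card φ.range * φ.range.index = 24 := by
    rw [Subgroup.card_mul_index, Nat.card_perm, Nat.card_fin]
    rfl
  have h12 : 12 ∣ Nat.card φ.range := Nat.Coprime.mul_dvd_of_dvd_of_dvd (by norm_num) h3 h4
  have hindex : φ.range.index = 1 ∨ φ.range.index = 2 := by
    obtain ⟨k, hk⟩ := h12
    rw [hk] at hmul
    have hk0 : k ≠ 0 := by rintro rfl; omega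
    have hle : φ.range.index ≤ 2 := by nlinarith [Nat.pos_of_ne_zero hk0]
    have : φ.range.index ≠ 0 := by intro h; rw [h] at hmul; omega
    omega
  have hsurj : φ.range = ⊤ := by
    refine hindex.elim Subgroup.index_eq_one.1 fun h2 => ?_
    have halt := Equiv.Perm.eq_alternatingGroup_of_index_eq_two h2
    have hfix (g : N ≃ₐ[ℚ] N) : g (Matrix.vandermonde r).det = (Matrix.vandermonde r).det := by
      have hsign : Equiv.Perm.sign (φ g) = 1 := by
        rw [← Equiv.Perm.mem_alternatingGroup, ← halt]
        exact ⟨g, rfl⟩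
      have hsub : (Matrix.vandermonde r).map g = (Matrix.vandermonde r).submatrix (φ g) id := by
        ext i j
        simp [Matrix.vandermonde_apply, r, hact]
      have h := Matrix.det_permute (φ g) (Matrix.vandermonde r)
      rw [hsign, ← hsub] at h
      rw [AlgEquiv.map_det]
      simpa using h
    obtain ⟨q, hq⟩ := IntermediateField.mem_bot.1 ((IsGalois.mem_bot_iff_fixed _).2 hfix)
    refine absurd ⟨q, (algebraMap ℚ N).injective ?_⟩ not_isSquare_discr_quartic
    rw [map_mul, hq, ← sq, det_vandermonde_sq_of_roots_quartic hr hroot, map_ofNat]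
  exact ⟨MulEquiv.ofBijective φ ⟨hφ, MonoidHom.range_eq_top.1 hsurj⟩⟩

end GaloisGroup

section QuarticField

variable {E : Type*} [Field E] [NumberField E] {x : E}

lemma exists_powerBasis_quartic (hx : aeval x (quartic ℚ) = 0)
    (hgen : IntermediateField.adjoin ℚ {x} = ⊤) :
    ∃ B : PowerBasis ℚ E, B.gen = x ∧ B.dim = 4 := by
  let B := PowerBasis.ofAdjoinEqTop (Algebra.IsIntegral.isIntegral (R := ℚ) x)
    (IntermediateField.adjoin_eq_top_iff.1 hgen)
  have hB : B.gen = x := PowerBasis.ofAdjoinEqTop_gen _ _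
  refine ⟨B, hB, ?_⟩
  rw [← B.natDegree_minpoly, hB,
    ← minpoly.eq_of_irreducible_of_monic irreducible_quartic_rat hx monic_quartic,
    natDegree_quartic]

lemma isReal_infinitePlace_quartic (hx : aeval x (quartic ℚ) = 0)
    (hgen : IntermediateField.adjoin ℚ {x} = ⊤) (v : InfinitePlace E) : v.IsReal := by
  obtain ⟨B, rfl, -⟩ := exists_powerBasis_quartic hx hgen
  rw [InfinitePlace.isReal_iff, ComplexEmbedding.isReal_iff]
  have him : (v.embedding B.gen).im = 0 := by
    refine im_eq_zero_of_aeval_quartic ?_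
    have := aeval_algHom_apply v.embedding.toRatAlgHom B.gen (quartic ℚ)
    rw [hx, map_zero] at this
    exact this
  have : (ComplexEmbedding.conjugate v.embedding).toRatAlgHom = v.embedding.toRatAlgHom :=
    B.algHom_ext (Complex.conj_eq_iff_im.2 him)
  ext y
  exact DFunLike.congr_fun this y

lemma discr_powers_quartic (hx : aeval x (quartic ℚ) = 0)
    (hgen : IntermediateField.adjoin ℚ {x} = ⊤) :
    Algebra.discr ℚ (fun i : Fin 4 => x ^ (i : ℕ)) = 71357250560 := by
  obtain ⟨B, rfl, hdim⟩ := exists_powerBasis_quartic hx hgen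
  have hcard : Fintype.card (E →ₐ[ℚ] ℂ) = 4 := by rw [AlgHom.card, B.finrank, hdim]
  let e := (Fintype.equivFinOfCardEq hcard).symm
  have hr : Function.Injective fun i => e i B.gen := fun i j hij =>
    e.injective (B.algHom_ext hij)
  have hroot (i) : e i B.gen ^ 4 + 2 * e i B.gen ^ 3 - 75 * e i B.gen ^ 2 - 112 * e i B.gen + 816
      = 0 := by
    rw [← aeval_quartic (R := ℚ), aeval_algHom_apply, hx, map_zero]
  have hmat : Algebra.embeddingsMatrixReindex ℚ ℂ (fun i : Fin 4 => B.gen ^ (i : ℕ)) e =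
      (Matrix.vandermonde fun i => e i B.gen).transpose := by
    ext i j
    simp [Algebra.embeddingsMatrixReindex, Algebra.embeddingsMatrix, Matrix.vandermonde_apply]
  refine (algebraMap ℚ ℂ).injective ?_
  rw [Algebra.discr_eq_det_embeddingsMatrixReindex_pow_two ℚ ℂ _ e, hmat, Matrix.det_transpose,
    det_vandermonde_sq_of_roots_quartic hr hroot, map_ofNat]

/-- The discriminant of a number field divides that of any family of integers, with square
quotient. -/
lemma exists_discr_eq_sq_mul_discr {n : ℕ} (hn : Module.finrank ℚ E = n) {b : Fin n → E}
    (hb : ∀ i, IsIntegral ℤ (b i)) :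
    ∃ m : ℤ, Algebra.discr ℚ b = ((m ^ 2 * discr E : ℤ) : ℚ) := by
  have hcard : Fintype.card (Module.Free.ChooseBasisIndex ℤ (𝓞 E)) = n := by
    rw [← hn, ← RingOfIntegers.rank, Module.finrank_eq_card_chooseBasisIndex]
  let e := Fintype.equivFinOfCardEq hcard
  let w := (integralBasis E).reindex e
  let M : Matrix (Fin n) (Fin n) ℤ :=
    Matrix.of fun i j => (RingOfIntegers.basis E).repr ⟨b j, hb j⟩ (e.symm i)
  have hM : w.toMatrix b = M.map (algebraMap ℤ ℚ) := by
    ext i j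
    simp only [Module.Basis.toMatrix_apply, w, Module.Basis.repr_reindex,
      Finsupp.mapDomain_equiv_apply, M, Matrix.map_apply, Matrix.of_apply]
    exact integralBasis_repr_apply E ⟨b j, hb j⟩ (e.symm i)
  refine ⟨M.det, ?_⟩
  have h := Algebra.discr_of_matrix_vecMul w (w.toMatrix b)
  rw [Module.Basis.toMatrix_map_vecMul, hM] at h
  have hw : Algebra.discr ℚ w = (discr E : ℚ) := by
    rw [coe_discr, ← Algebra.discr_reindex ℚ (integralBasis E) e, Module.Basis.coe_reindex]
  rw [h, hw, Int.cast_mul, Int.cast_pow]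
  congr 2
  exact (RingHom.map_det (algebraMap ℤ ℚ) M).symm

theorem discr_quarticField (hx : aeval x (quartic ℚ) = 0)
    (hgen : IntermediateField.adjoin ℚ {x} = ⊤) : discr E = 2 ^ 2 * 5 * 13936963 := by
  have hx' := hx
  rw [aeval_quartic] at hx'
  have hint {y : E} (a b c d : ℤ) (h : y ^ 4 + a * y ^ 3 + b * y ^ 2 + c * y + d = 0) :
      IsIntegral ℤ y := by
    refine ⟨X ^ 4 + C a * X ^ 3 + C b * X ^ 2 + C c * X + C d, by monicity!, ?_⟩
    simpa only [eval₂_add, eval₂_mul, eval₂_pow, eval₂_X, eval₂_C, algebraMap_int_eq,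
      Int.coe_castRingHom] using h
  let b : Fin 4 → E := ![1, x, (x ^ 2 + x) / 2, (x ^ 3 + 2 * x ^ 2 + x + 4) / 8]
  have hb (i) : IsIntegral ℤ (b i) := by
    fin_cases i
    · exact isIntegral_one
    · refine hint 2 (-75) (-112) 816 ?_
      simp only [b]
      push_cast
      linear_combination hx'
    · refine hint (-76) 1861 (-16008) 43452 ?_
      simp only [b]
      push_cast
      linear_combination (1 / 16 * x ^ 4 + 1 / 8 * x ^ 3 - 75 / 16 * x ^ 2 - 5 / 2 * x + 213 / 4)
        * hx'
    · refine hint (-25) (-3757) (-3100) 147106 ?_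
      simp only [b]
      push_cast
      linear_combination (1 / 4096 * x ^ 8 + 3 / 2048 * x ^ 7 + 91 / 4096 * x ^ 6
        + 63 / 1024 * x ^ 5 + 5143 / 4096 * x ^ 4 + 5603 / 2048 * x ^ 3 + 70877 / 4096 * x ^ 2
        + 11915 / 512 * x + 45369 / 256) * hx'
  let P : Matrix (Fin 4) (Fin 4) ℚ :=
    !![1, 0, 0, 0; 0, 1, 0, 0; 0, 1 / 2, 1 / 2, 0; 1 / 2, 1 / 8, 1 / 4, 1 / 8]
  have hP : (P.map (algebraMap ℚ E)).mulVec (fun i : Fin 4 => x ^ (i : ℕ)) = b := by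
    ext i
    fin_cases i
    · simp [P, b, Matrix.mulVec, dotProduct, Fin.sum_univ_four]
    · simp [P, b, Matrix.mulVec, dotProduct, Fin.sum_univ_four]
    · simp [P, b, Matrix.mulVec, dotProduct, Fin.sum_univ_four]
      ring
    · simp [P, b, Matrix.mulVec, dotProduct, Fin.sum_univ_four]
      ring
  have hdet : P.det = 1 / 16 := by
    simp [P, Matrix.det_succ_row_zero, Fin.sum_univ_succ]
    norm_num
  obtain ⟨B, hB, hdim⟩ := exists_powerBasis_quartic hx hgen
  obtain ⟨m, hm⟩ := exists_discr_eq_sq_mul_discr (B.finrank.trans hdim) hb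
  rw [← hP, Algebra.discr_of_matrix_mulVec, discr_powers_quartic hx hgen, hdet] at hm
  have hm' : m ^ 2 * discr E = 278739260 := by
    rw [← Int.cast_inj (α := ℚ), ← hm]
    norm_num
  obtain ⟨a, c, hac⟩ := exists_discr_eq_sq_add_four_mul E
  have hsf : Squarefree (69684815 : ℤ) := by
    rw [← Int.squarefree_natAbs]
    change Squarefree (5 * 13936963)
    rw [Nat.squarefree_mul (by norm_num)]
    exact ⟨(show Nat.Prime 5 by norm_num).squarefree,
      (show Nat.Prime 13936963 by norm_num).squarefree⟩
  have hunit {k : ℤ} (hk : k * k ∣ 69684815) : k ^ 2 = 1 := by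
    rw [sq_eq_one_iff, ← Int.isUnit_iff]
    exact hsf k hk
  rcases Int.even_or_odd' m with ⟨k, rfl | rfl⟩
  · have hk : k ^ 2 * discr E = 69684815 := by linarith
    rw [hunit ⟨discr E, by rw [← hk]; ring⟩, one_mul, hac] at hk
    rcases Int.even_or_odd' a with ⟨l, rfl | rfl⟩
    · ring_nf at hk
      omega
    · ring_nf at hk
      omega
  · have hcop : IsCoprime ((2 * k + 1) * (2 * k + 1)) (4 : ℤ) :=
      ⟨1, -(k ^ 2 + k), by ring⟩
    have hk : (2 * k + 1) ^ 2 = 1 :=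
      hunit (hcop.dvd_of_dvd_mul_left ⟨discr E, by linarith⟩)
    rw [hk, one_mul] at hm'
    rw [hm']
    norm_num

end QuarticField

section Splitting

variable {E : Type*} [Field E] [NumberField E] {θ : 𝓞 E}

lemma exists_aeval_eq_discr_mul (hθ : aeval (θ : E) (quartic ℚ) = 0)
    (hgen : IntermediateField.adjoin ℚ {(θ : E)} = ⊤) (w : 𝓞 E) :
    ∃ g : ℤ[X], aeval θ g = 71357250560 * w := by
  obtain ⟨B, hB, hdim⟩ := exists_powerBasis_quartic hθ hgen
  have hdiscr : Algebra.discr ℚ B.basis = 71357250560 := by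
    rw [← discr_powers_quartic hθ hgen, ← Algebra.discr_reindex ℚ B.basis (finCongr hdim)]
    congr 1
    ext i
    simp [hB]
  have h := Algebra.discr_mul_isIntegral_mem_adjoin (R := ℤ) ℚ (B := B) (z := (w : E))
    (hB ▸ RingOfIntegers.isIntegral_coe θ) (RingOfIntegers.isIntegral_coe w)
  rw [hdiscr, hB, Algebra.adjoin_singleton_eq_range_aeval] at h
  obtain ⟨g, hg⟩ := h
  refine ⟨g, RingOfIntegers.ext ?_⟩
  have hg' : aeval (θ : E) g = (71357250560 : ℚ) • (w : E) := hg
  change algebraMap (𝓞 E) E _ = algebraMap (𝓞 E) E _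
  rw [← aeval_algebraMap_apply, hg', Algebra.smul_def, map_mul, map_ofNat, map_ofNat]

lemma quartic_dvd_of_aeval_eq_zero (hθ : aeval (θ : E) (quartic ℚ) = 0) {p : ℤ[X]}
    (hp : aeval θ p = 0) : quartic ℤ ∣ p := by
  rw [← map_dvd_map (algebraMap ℤ ℚ) (algebraMap ℤ ℚ).injective_int monic_quartic, map_quartic,
    minpoly.eq_of_irreducible_of_monic irreducible_quartic_rat hθ monic_quartic]
  refine minpoly.dvd ℚ _ ?_
  rw [aeval_map_algebraMap, aeval_algebraMap_apply, hp, map_zero]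

/-- The ideal above `71` attached to a root of `quartic` modulo `71`. -/
noncomputable def idealOfRoot (θ : 𝓞 E) (a : ℤ) : Ideal (𝓞 E) :=
  Ideal.span {71, θ - (a : 𝓞 E)}

lemma idealOfRoot_ne_top (hθ : aeval (θ : E) (quartic ℚ) = 0)
    (hgen : IntermediateField.adjoin ℚ {(θ : E)} = ⊤) {a : ℤ}
    (ha : aeval (a : ZMod 71) (quartic ℤ) = 0) : idealOfRoot θ a ≠ ⊤ := by
  rw [Ne, Ideal.eq_top_iff_one, idealOfRoot, Ideal.mem_span_pair]
  rintro ⟨u, v, huv⟩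
  obtain ⟨g, hg⟩ := exists_aeval_eq_discr_mul hθ hgen u
  obtain ⟨h, hh⟩ := exists_aeval_eq_discr_mul hθ hgen v
  obtain ⟨k, hk⟩ := quartic_dvd_of_aeval_eq_zero hθ 
    (p := 71357250560 - 71 * g - (X - (a : ℤ[X])) * h) (by
    simp only [map_sub, map_mul, map_ofNat, aeval_X, map_intCast, hg, hh]
    linear_combination -71357250560 * huv)
  have h71 := congrArg (aeval (a : ZMod 71)) hk
  rw [map_mul, ha, zero_mul] at h71
  simp only [map_sub, map_mul, map_ofNat, aeval_X, map_intCast, sub_self, zero_mul,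
    sub_zero, show (71 : ZMod 71) = 0 from rfl] at h71
  exact absurd h71 (by decide)

lemma charP_quotient_idealOfRoot (hθ : aeval (θ : E) (quartic ℚ) = 0)
    (hgen : IntermediateField.adjoin ℚ {(θ : E)} = ⊤) {a : ℤ}
    (ha : aeval (a : ZMod 71) (quartic ℤ) = 0) : CharP (𝓞 E ⧸ idealOfRoot θ a) 71 := by
  have : Nontrivial (𝓞 E ⧸ idealOfRoot θ a) :=
    Ideal.Quotient.nontrivial_iff.2 (idealOfRoot_ne_top hθ hgen ha)
  refine ringChar.of_eq (CharP.ringChar_of_prime_eq_zero (by norm_num) ?_)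
  exact Ideal.Quotient.eq_zero_iff_mem.2 (Ideal.subset_span (by simp))

lemma bijective_zmod_quotient_idealOfRoot (hθ : aeval (θ : E) (quartic ℚ) = 0)
    (hgen : IntermediateField.adjoin ℚ {(θ : E)} = ⊤) {a : ℤ}
    (ha : aeval (a : ZMod 71) (quartic ℤ) = 0) :
    ∃ φ : ZMod 71 →+* 𝓞 E ⧸ idealOfRoot θ a, Function.Bijective φ := by
  have := charP_quotient_idealOfRoot hθ hgen ha
  refine ⟨ZMod.castHom dvd_rfl _, ZMod.castHom_injective _, fun y => ?_⟩
  obtain ⟨w, rfl⟩ := Ideal.Quotient.mk_surjective y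
  obtain ⟨g, hg⟩ := exists_aeval_eq_discr_mul hθ hgen w
  let π := Ideal.Quotient.mk (idealOfRoot θ a)
  have hθa : π θ = (a : 𝓞 E ⧸ idealOfRoot θ a) := by
    rw [← map_intCast π, Ideal.Quotient.eq]
    exact Ideal.subset_span (by simp)
  have hπg : π (aeval θ g) = ((g.eval a : ℤ) : 𝓞 E ⧸ idealOfRoot θ a) := by
    have := (aeval_algHom_apply π.toIntAlgHom θ g).symm
    refine this.trans ?_
    change aeval (π θ) g = _
    rw [hθa]
    simpa using aeval_algebraMap_apply (𝓞 E ⧸ idealOfRoot θ a) a g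
  have hinv : (71357250560 : ZMod 71) * (71357250560 : ZMod 71)⁻¹ = 1 :=
    mul_inv_cancel₀ (by decide)
  refine ⟨(71357250560 : ZMod 71)⁻¹ * ((g.eval a : ℤ) : ZMod 71), ?_⟩
  have hinv' := congrArg (ZMod.castHom dvd_rfl (𝓞 E ⧸ idealOfRoot θ a)) hinv
  rw [map_mul, map_one, map_ofNat] at hinv'
  rw [map_mul, map_intCast, ← hπg, hg, map_mul, map_ofNat]
  linear_combination (π w) * hinv'

theorem exists_ideals_over_seventy_one (hθ : aeval (θ : E) (quartic ℚ) = 0)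
    (hgen : IntermediateField.adjoin ℚ {(θ : E)} = ⊤) :
    ∃ P : Fin 4 → Ideal (𝓞 E), Function.Injective P ∧
      ∀ i, (P i).IsMaximal ∧ (71 : 𝓞 E) ∈ P i ∧ Nat.card ((𝓞 E) ⧸ P i) = 71 := by
  let a : Fin 4 → ℤ := ![38, 41, 62, 70]
  have ha (i) : aeval (a i : ZMod 71) (quartic ℤ) = 0 := by
    rw [aeval_quartic]
    revert i
    decide
  refine ⟨fun i => idealOfRoot θ (a i), fun i j hij => ?_, fun i => ?_⟩
  · have := charP_quotient_idealOfRoot hθ hgen (ha i)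
    have hj : θ - (a j : 𝓞 E) ∈ idealOfRoot θ (a i) := by
      change idealOfRoot θ (a i) = idealOfRoot θ (a j) at hij
      rw [hij]
      exact Ideal.subset_span (by simp)
    have hi : θ - (a i : 𝓞 E) ∈ idealOfRoot θ (a i) := Ideal.subset_span (by simp)
    have hsub : ((a i - a j : ℤ) : 𝓞 E ⧸ idealOfRoot θ (a i)) = 0 := by
      rw [← map_intCast (Ideal.Quotient.mk (idealOfRoot θ (a i))), Ideal.Quotient.eq_zero_iff_mem]
      convert (idealOfRoot θ (a i)).sub_mem hj hi using 1
      push_cast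
      ring
    rw [CharP.intCast_eq_zero_iff _ 71] at hsub
    clear hij hj hi this
    revert i j
    decide
  · obtain ⟨φ, hφ⟩ := bijective_zmod_quotient_idealOfRoot hθ hgen (ha i)
    refine ⟨Ideal.Quotient.maximal_of_isField _ ?_, Ideal.subset_span (by simp), ?_⟩
    · exact (RingEquiv.ofBijective φ hφ).symm.toMulEquiv.isField (Field.toIsField (ZMod 71))
    · rw [← Nat.card_congr (Equiv.ofBijective φ hφ), Nat.card_zmod]

end Splitting

/-- The quartic `f = x⁴ + 2x³ - 75x² - 112x + 816 ∈ ℚ[x]` is irreducible over `ℚ`, all of its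
complex roots are real, the number field `E = ℚ[x]/(f)` has discriminant `2² ⬝ 5 ⬝ 13936963`,
the Galois group of the splitting field of `f` over `ℚ` is isomorphic to `S₄`, and the prime
`71` splits completely in `E`: `71 𝒪_E` is a product of `4` distinct prime ideals with
residue field `F₇₁`. -/
theorem quartic_field_x4_2x3_sub_75x2_sub_112x_add_816 :
    Irreducible (X ^ 4 + 2 * X ^ 3 - 75 * X ^ 2 - 112 * X + 816 : ℚ[X]) ∧
    (∀ z : ℂ, aeval z (X ^ 4 + 2 * X ^ 3 - 75 * X ^ 2 - 112 * X + 816 : ℚ[X]) = 0 →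
      z.im = 0) ∧
    (∀ (E : Type) [Field E] [NumberField E], ∀ x : E,
      aeval x (X ^ 4 + 2 * X ^ 3 - 75 * X ^ 2 - 112 * X + 816 : ℚ[X]) = 0 →
      IntermediateField.adjoin ℚ {x} = ⊤ →
      NumberField.discr E = 2 ^ 2 * 5 * 13936963 ∧
      (∀ v : NumberField.InfinitePlace E, v.IsReal) ∧
      (∃ P : Fin 4 → Ideal (𝓞 E), Function.Injective P ∧
        ∀ i, (P i).IsMaximal ∧ (71 : 𝓞 E) ∈ P i ∧ Nat.card ((𝓞 E) ⧸ P i) = 71)) ∧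
    (∀ (N : Type) [Field N] [NumberField N],
      IsSplittingField ℚ N (X ^ 4 + 2 * X ^ 3 - 75 * X ^ 2 - 112 * X + 816 : ℚ[X]) →
      Nonempty ((N ≃ₐ[ℚ] N) ≃* Equiv.Perm (Fin 4))) := by
  refine ⟨irreducible_quartic_rat, fun z hz => im_eq_zero_of_aeval_quartic hz,
    fun E _ _ x hx hgen => ⟨discr_quarticField hx hgen, isReal_infinitePlace_quartic hx hgen, ?_⟩,
    fun N _ _ hN => ?_⟩
  · have hint : IsIntegral ℤ x := by
      refine ⟨quartic ℤ, monic_quartic, ?_⟩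
      rw [← aeval_def, ← aeval_map_algebraMap ℚ, map_quartic]
      exact hx
    exact exists_ideals_over_seventy_one (θ := ⟨x, hint⟩) hx hgen
  · have : IsSplittingField ℚ N (quartic ℚ) := hN
    exact nonempty_mulEquiv_perm_of_isSplittingField_quartic
end

section
/- Let f(x) = x⁵ − 10x³ − 5x² + 10x − 1 ∈ ℚ[x]. Then f is irreducible over ℚ, the number field F = ℚ[x]/(f) is a Galois extension of ℚ with cyclic Galois group of order 5, F is totally real with discriminant 5⁸, F embeds into the 25th cyclotomic field ℚ(ζ₂₅) (it is the unique subfield of ℚ(ζ₂₅) of degree 5 over ℚ), and F has strict (narrow) class number 1: its class number is 1 and for every choice of signs ε(v) ∈ {±1}, one for each of the 5 real embeddings v of F, there exists a unit u of the ring of integers of F with sign(v(u)) = ε(v) for all v. -/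
open Polynomial NumberField IntermediateField

/-- The quintic `x⁵ - 10x³ - 5x² + 10x - 1`. -/
noncomputable def quintic : ℚ[X] := X ^ 5 - 10 * X ^ 3 - 5 * X ^ 2 + 10 * X - 1

/-- The translate `f(x + 1)` of the quintic, which is Eisenstein at `5`. -/
noncomputable def shiftedQuintic : ℤ[X] := X ^ 5 + 5 * X ^ 4 - 25 * X ^ 2 - 25 * X - 5

lemma shiftedQuintic_natDegree : shiftedQuintic.natDegree = 5 := by
  unfold shiftedQuintic; compute_degree!

lemma shiftedQuintic_monic : shiftedQuintic.Monic := by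
  unfold shiftedQuintic; monicity!

lemma shiftedQuintic_isEisensteinAt : shiftedQuintic.IsEisensteinAt (ℤ ∙ (5 : ℤ)) where
  leading := by
    rw [shiftedQuintic_monic.leadingCoeff, Ideal.mem_span_singleton]
    norm_num
  mem {n} hn := by
    rw [shiftedQuintic_natDegree] at hn
    rw [Ideal.mem_span_singleton]
    interval_cases n <;> simp [shiftedQuintic, coeff_X, coeff_X_pow, coeff_ofNat_mul]
  notMem := by
    rw [Ideal.span_singleton_pow, Ideal.mem_span_singleton]
    simp [shiftedQuintic]

lemma quintic_comp_X_add_one :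
    quintic.comp (X + C 1) = shiftedQuintic.map (algebraMap ℤ ℚ) := by
  simp [quintic, shiftedQuintic]
  ring

lemma shiftedQuintic_irreducible : Irreducible shiftedQuintic :=
  shiftedQuintic_isEisensteinAt.irreducible
    ((Ideal.span_singleton_prime (by norm_num)).2 (by norm_num))
    shiftedQuintic_monic.isPrimitive (by rw [shiftedQuintic_natDegree]; norm_num)

lemma quintic_irreducible : Irreducible quintic := by
  have h := (shiftedQuintic_monic.irreducible_iff_irreducible_map_fraction_map (K := ℚ)).1
    shiftedQuintic_irreducible
  rw [← quintic_comp_X_add_one] at h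
  exact (MulEquiv.irreducible_iff (algEquivAevalXAddC (1 : ℚ))).1 (by
    simpa [algEquivAevalXAddC, comp, aeval_def] using! h)

lemma quintic_natDegree : quintic.natDegree = 5 := by
  unfold quintic; compute_degree!

lemma quintic_monic : quintic.Monic := by
  unfold quintic; monicity!

lemma aeval_quintic {K : Type*} [CommRing K] [Algebra ℚ K] (t : K) :
    aeval t quintic = t ^ 5 - 10 * t ^ 3 - 5 * t ^ 2 + 10 * t - 1 := by
  have h₅ := map_ofNat (aeval (R := ℚ) t) 5
  have h₁₀ := map_ofNat (aeval (R := ℚ) t) 10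
  simp [quintic, h₅, h₁₀]

/-- The conjugates of a root `x` of the quintic are polynomials in `x`. -/
lemma quintic_exists_conjugates {K : Type*} [Field K] [CharZero K] {x : K}
    (hx : x ^ 5 - 10 * x ^ 3 - 5 * x ^ 2 + 10 * x - 1 = 0) :
    ∃ r s t u : K, (∀ y, y ^ 5 - 10 * y ^ 3 - 5 * y ^ 2 + 10 * y - 1 =
        (y - x) * (y - r) * (y - s) * (y - t) * (y - u)) ∧
      x + r + s + t + u = 0 ∧ x ^ 2 = 4 - r - 2 * t ∧ x ^ 3 = 3 + 6 * x - 3 * r - 2 * s - 3 * t ∧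
      x ^ 4 = 32 + 6 * x - 10 * r + s - 18 * t ∧
      x ^ 4 = 3 * x ^ 3 + 8 * x ^ 2 - 19 * x - 9 - 7 * u := by
  have h7 : (7 : K) ≠ 0 := by norm_num
  obtain ⟨r, hr⟩ : ∃ r, r = (-22 + 36 * x + 39 * x ^ 2 - 2 * x ^ 3 - 4 * x ^ 4) / 7 := ⟨_, rfl⟩
  obtain ⟨s, hs⟩ : ∃ s, s = (6 - 6 * x - 24 * x ^ 2 - 2 * x ^ 3 + 3 * x ^ 4) / 7 := ⟨_, rfl⟩
  obtain ⟨t, ht⟩ : ∃ t, t = (25 - 18 * x - 23 * x ^ 2 + x ^ 3 + 2 * x ^ 4) / 7 := ⟨_, rfl⟩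
  obtain ⟨u, hu⟩ : ∃ u, u = (-9 - 19 * x + 8 * x ^ 2 + 3 * x ^ 3 - x ^ 4) / 7 := ⟨_, rfl⟩
  have e₁ : x + r + s + t + u = 0 := by subst hr hs ht hu; field_simp; ring
  have e₂ : x * (r + s + t + u) + r * (s + t + u) + s * (t + u) + t * u = -10 := by
    subst hr hs ht hu
    linear_combination (123 + 123 * x - x ^ 2 - 15 * x ^ 3) / 49 * hx
  have e₃ : x * (r * (s + t + u) + s * (t + u) + t * u) + r * (s * (t + u) + t * u) +
      s * t * u = 5 := by
    subst hr hs ht hu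
    linear_combination (227 - 2149 * x - 3465 * x ^ 2 - 755 * x ^ 3 + 727 * x ^ 4 + 213 * x ^ 5 - 43
      * x ^ 6 - 10 * x ^ 7) / 343 * hx
  have e₄ : x * (r * (s * (t + u) + t * u) + s * t * u) + r * s * t * u = 10 := by
    subst hr hs ht hu
    linear_combination (-5690 - 30332 * x - 5198 * x ^ 2 + 62727 * x ^ 3 + 15611 * x ^ 4 - 36001 * x
      ^ 5 - 8614 * x ^ 6 + 7493 * x ^ 7 + 1347 * x ^ 8 - 688 * x ^ 9 - 64 * x ^ 10 + 24 * x ^ 11) /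
      2401 * hx
  have e₅ : x * r * s * t * u = 1 := by
    subst hr hs ht hu
    linear_combination (2401 - 5690 * x - 31921 * x ^ 2 + 15872 * x ^ 3 + 93009 * x ^ 4 + 20847 * x
      ^ 5 - 41825 * x ^ 6 - 10105 * x ^ 7 + 7794 * x ^ 8 + 1417 * x ^ 9 - 688 * x ^ 10 - 64 * x ^ 11
      + 24 * x ^ 12) / 2401 * hx
  refine ⟨r, s, t, u, fun y ↦ ?_, e₁, ?_, ?_, ?_, ?_⟩
  · linear_combination y ^ 4 * e₁ - y ^ 3 * e₂ + y ^ 2 * e₃ - y * e₄ + e₅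
  all_goals subst hr hs ht hu; field_simp; ring

/-- A negative of a Gaussian period is a root of the quintic. -/
lemma quintic_gaussPeriod {K : Type*} [CommRing K] {z : K}
    (hz : z ^ 20 + z ^ 15 + z ^ 10 + z ^ 5 + 1 = 0) :
    ∃ y : K, y ^ 5 - 10 * y ^ 3 - 5 * y ^ 2 + 10 * y - 1 = 0 := by
  obtain ⟨y, hy⟩ : ∃ y, y = -z + z ^ 4 - z ^ 7 + z ^ 9 + z ^ 14 - z ^ 18 + z ^ 19 := ⟨_, rfl⟩
  have h₂ : y ^ 2 = 4 + z ^ 2 - z ^ 3 + 2 * z ^ 6 + z ^ 8 + z ^ 11 - z ^ 13 + z ^ 14 + 2 * z ^ 17 -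
    z ^ 18 + 2 * z ^ 19 := by
    subst hy
    linear_combination (-4 + z ^ 3 + 2 * z ^ 5 - 2 * z ^ 6 + z ^ 8 - z ^ 11 + z ^ 13 + z ^ 16 - 2 *
      z ^ 17 + z ^ 18) * hz
  have h₃ : y ^ 3 = 3 - 8 * z + z ^ 2 - z ^ 3 + 8 * z ^ 4 + z ^ 6 - 8 * z ^ 7 + 6 * z ^ 9 + z ^ 11 -
    2 * z ^ 12 - 3 * z ^ 13 + 9 * z ^ 14 - 2 * z ^ 16 + z ^ 17 - 9 * z ^ 18 + 9 * z ^ 19 := by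
    rw [pow_succ, h₂]
    subst hy
    linear_combination (-3 + 4 * z - z ^ 2 - 3 * z ^ 4 + 3 * z ^ 5 - 4 * z ^ 6 + 2 * z ^ 7 - z ^ 9 +
      3 * z ^ 10 + z ^ 13 - 2 * z ^ 15 + 3 * z ^ 16 - 3 * z ^ 17 + 2 * z ^ 18) * hz
  have h₅ : y ^ 5 = 51 - 70 * z + 15 * z ^ 2 - 15 * z ^ 3 + 70 * z ^ 4 + 20 * z ^ 6 - 70 * z ^ 7 + 5
    * z ^ 8 + 50 * z ^ 9 + 15 * z ^ 11 - 20 * z ^ 12 - 35 * z ^ 13 + 85 * z ^ 14 - 20 * z ^ 16 + 20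
    * z ^ 17 - 85 * z ^ 18 + 90 * z ^ 19 := by
    rw [show y ^ 5 = y ^ 2 * y ^ 3 by ring, h₂, h₃]
    linear_combination (-39 + 38 * z - 8 * z ^ 2 - 29 * z ^ 4 + 37 * z ^ 5 - 39 * z ^ 6 + 22 * z ^ 7
      + z ^ 8 - 16 * z ^ 9 + 27 * z ^ 10 - 2 * z ^ 11 - 6 * z ^ 12 + 5 * z ^ 13 + 4 * z ^ 14 - 23 *
      z ^ 15 + 29 * z ^ 16 - 27 * z ^ 17 + 18 * z ^ 18) * hz
  refine ⟨y, ?_⟩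
  rw [h₅, h₃, h₂]
  subst hy
  ring

section NumberField

variable {F : Type*} [Field F] [NumberField F] {x : F}

lemma minpoly_of_aeval_quintic (hx : aeval x quintic = 0) : minpoly ℚ x = quintic :=
  (minpoly.eq_of_irreducible_of_monic quintic_irreducible hx quintic_monic).symm

lemma isIntegral_of_aeval_quintic (hx : aeval x quintic = 0) : IsIntegral ℤ x := by
  refine ⟨X ^ 5 - 10 * X ^ 3 - 5 * X ^ 2 + 10 * X - 1, by monicity!, ?_⟩
  rw [aeval_quintic] at hx
  simpa using hx

lemma finrank_eq_five (hx : aeval x quintic = 0) (htop : ℚ⟮x⟯ = ⊤) :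
    Module.finrank ℚ F = 5 := by
  rw [← quintic_natDegree, ← minpoly_of_aeval_quintic hx,
    Field.primitive_element_iff_minpoly_natDegree_eq ℚ x |>.1 htop]

lemma algHom_ext_of_adjoin_eq_top {A : Type*} [Semiring A] [Algebra ℚ A] (htop : ℚ⟮x⟯ = ⊤)
    {φ ψ : F →ₐ[ℚ] A} (h : φ x = ψ x) : φ = ψ := by
  refine AlgHom.ext_of_adjoin_eq_top (s := {x}) ?_ (by simpa using h)
  rw [← IntermediateField.adjoin_simple_toSubalgebra_of_isAlgebraic
    (Algebra.IsAlgebraic.isAlgebraic x), htop, IntermediateField.top_toSubalgebra]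

lemma quintic_map_eq_prod {K : Type*} [Field K] [Algebra ℚ K] {x r s t u : K}
    (h : ∀ y, y ^ 5 - 10 * y ^ 3 - 5 * y ^ 2 + 10 * y - 1 =
        (y - x) * (y - r) * (y - s) * (y - t) * (y - u)) :
    quintic.map (algebraMap ℚ K) = (X - C x) * (X - C r) * (X - C s) * (X - C t) * (X - C u) :=
  have : CharZero K := algebraRat.charZero K
  Polynomial.funext fun y ↦ by
    rw [eval_map_algebraMap, aeval_quintic, h]
    simp

lemma quintic_splits {K : Type*} [Field K] [Algebra ℚ K] {x : K} (hx : aeval x quintic = 0) :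
    (quintic.map (algebraMap ℚ K)).Splits := by
  have : CharZero K := algebraRat.charZero K
  rw [aeval_quintic] at hx
  obtain ⟨r, s, t, u, hprod, -⟩ := quintic_exists_conjugates hx
  rw [quintic_map_eq_prod hprod]
  exact ((((Splits.X_sub_C _).mul (Splits.X_sub_C _)).mul (Splits.X_sub_C _)).mul
    (Splits.X_sub_C _)).mul (Splits.X_sub_C _)

lemma exists_algHom_of_adjoin_eq_top {A : Type*} [Field A] [Algebra ℚ A]
    (hx : aeval x quintic = 0) (htop : ℚ⟮x⟯ = ⊤) {y : A} (hy : aeval y quintic = 0) :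
    ∃ φ : F →ₐ[ℚ] A, φ x = y := by
  have hmin := minpoly_of_aeval_quintic hx
  refine exists_algHom_of_adjoin_splits_of_aeval (S := {x}) (fun s hs ↦ ?_) htop (by rwa [hmin])
  rw [Set.mem_singleton_iff.1 hs, hmin]
  exact ⟨Algebra.IsIntegral.isIntegral x, quintic_splits hy⟩

lemma isGalois_of_adjoin_eq_top (hx : aeval x quintic = 0) (htop : ℚ⟮x⟯ = ⊤) : IsGalois ℚ F := by
  have : quintic.IsSplittingField ℚ F := by
    refine isSplittingField_iff_intermediateField.2 ⟨quintic_splits hx, ?_⟩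
    rw [eq_top_iff, ← htop]
    exact adjoin.mono ℚ _ _ (Set.singleton_subset_iff.2
      (mem_rootSet.2 ⟨quintic_monic.ne_zero, hx⟩))
  exact IsGalois.of_separable_splitting_field quintic_irreducible.separable

lemma trace_eq_zero_of_aeval_quintic (hx : aeval x quintic = 0) :
    Algebra.trace ℚ F x = 0 := by
  have : quintic.nextCoeff = 0 := by
    rw [nextCoeff_of_natDegree_pos (by simp [quintic_natDegree]), quintic_natDegree]
    simp [quintic, coeff_X, coeff_one, coeff_ofNat_mul, coeff_X_pow]
  rw [trace_eq_finrank_mul_minpoly_nextCoeff, minpoly_of_aeval_quintic hx, this, neg_zero,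
    mul_zero]

end NumberField

section Trace

variable {F : Type*} [Field F] [NumberField F] {x : F}

lemma trace_sq_of_aeval_quintic (hF : Module.finrank ℚ F = 5) (hx : aeval x quintic = 0) :
    Algebra.trace ℚ F (x ^ 2) = 20 := by
  have hx' := hx
  rw [aeval_quintic] at hx'
  obtain ⟨r, s, t, u, hprod, -, h₂, -⟩ := quintic_exists_conjugates hx'
  have hr : Algebra.trace ℚ F r = 0 :=
    trace_eq_zero_of_aeval_quintic (by rw [aeval_quintic, hprod]; ring)
  have ht : Algebra.trace ℚ F t = 0 :=
    trace_eq_zero_of_aeval_quintic (by rw [aeval_quintic, hprod]; ring)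
  have h4 : Algebra.trace ℚ F (algebraMap ℚ F 4) = 20 := by
    rw [Algebra.trace_algebraMap, hF]; norm_num
  rw [h₂, show 4 - r - 2 * t = algebraMap ℚ F 4 - r - (2 : ℚ) • t by simp [Algebra.smul_def]]
  simp only [map_sub, map_smul, hr, ht, h4]
  simp

/-- The trace of a product of two roots of the quintic. -/
lemma trace_mul_of_aeval_quintic (hF : Module.finrank ℚ F = 5) {y : F} (hx : aeval x quintic = 0)
    (hy : aeval y quintic = 0) :
    y = x ∨ Algebra.trace ℚ F (x * y) = -5 := by
  have hx' := hx
  rw [aeval_quintic] at hx'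
  obtain ⟨r, s, t, u, hprod, e₁, e₂, e₃, e₄, -⟩ := quintic_exists_conjugates hx'
  set T := Algebra.trace ℚ F with hT
  have hc (q : ℚ) : T (algebraMap ℚ F q) = 5 * q := by
    rw [hT, Algebra.trace_algebraMap, hF]; norm_num
  have hroot {z : F} (hz : (z - x) * (z - r) * (z - s) * (z - t) * (z - u) = 0) : T z = 0 :=
    trace_eq_zero_of_aeval_quintic (by rw [aeval_quintic, hprod, hz])
  have hx0 : T x = 0 := hroot (by ring)
  have hr0 : T r = 0 := hroot (by ring)
  have hs0 : T s = 0 := hroot (by ring)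
  have ht0 : T t = 0 := hroot (by ring)
  have hxx : T (x ^ 2) = 20 := trace_sq_of_aeval_quintic hF hx
  have l₃ : T (x ^ 3) = 15 := by
    rw [e₃, show 3 + 6 * x - 3 * r - 2 * s - 3 * t = algebraMap ℚ F 3 + (6 : ℚ) • x - (3 : ℚ) • r -
      (2 : ℚ) • s - (3 : ℚ) • t by simp [Algebra.smul_def]]
    simp only [map_sub, map_add, map_smul, hc, hx0, hr0, hs0, ht0]
    norm_num
  have l₄ : T (x ^ 4) = 160 := by
    rw [e₄, show 32 + 6 * x - 10 * r + s - 18 * t = algebraMap ℚ F 32 + (6 : ℚ) • x - (10 : ℚ) • r +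
      s - (18 : ℚ) • t by simp [Algebra.smul_def]]
    simp only [map_sub, map_add, map_smul, hc, hx0, hr0, hs0, ht0]
    norm_num
  have l₅ : T (x ^ 5) = 255 := by
    rw [show x ^ 5 = (10 : ℚ) • x ^ 3 + (5 : ℚ) • x ^ 2 - (10 : ℚ) • x + algebraMap ℚ F 1 by
      simp [Algebra.smul_def]; linear_combination hx']
    simp only [map_sub, map_add, map_smul, hc, hx0, hxx, l₃]
    norm_num
  have m₁ : T (x ^ 2) + T (x * r) + T (x * s) + T (x * t) + T (x * u) = 0 := by
    rw [← map_add, ← map_add, ← map_add, ← map_add, ← map_zero T]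
    congr 1
    linear_combination x * e₁
  have m₂ : T (x ^ 3) = - T (x * r) - 2 * T (x * t) := by
    rw [show x ^ 3 = (4 : ℚ) • x - x * r - (2 : ℚ) • (x * t) by
      simp [Algebra.smul_def]; linear_combination x * e₂]
    simp only [map_sub, map_smul, hx0, smul_eq_mul]
    ring
  have m₃ : T (x ^ 4) = 6 * T (x ^ 2) - 3 * T (x * r) - 2 * T (x * s) - 3 * T (x * t) := by
    rw [show x ^ 4 = (3 : ℚ) • x + (6 : ℚ) • x ^ 2 - (3 : ℚ) • (x * r) - (2 : ℚ) • (x * s) -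
      (3 : ℚ) • (x * t) by simp [Algebra.smul_def]; linear_combination x * e₃]
    simp only [map_sub, map_add, map_smul, hx0, smul_eq_mul]
    ring
  have m₄ : T (x ^ 5) = 6 * T (x ^ 2) - 10 * T (x * r) + T (x * s) - 18 * T (x * t) := by
    rw [show x ^ 5 = (32 : ℚ) • x + (6 : ℚ) • x ^ 2 - (10 : ℚ) • (x * r) + x * s -
      (18 : ℚ) • (x * t) by simp [Algebra.smul_def]; linear_combination x * e₄]
    simp only [map_sub, map_add, map_smul, hx0, smul_eq_mul]
    ring
  have hy' := hy
  rw [aeval_quintic, hprod] at hy'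
  simp only [mul_eq_zero, sub_eq_zero] at hy'
  obtain (((rfl | rfl) | rfl) | rfl) | rfl := hy'
  · exact Or.inl rfl
  all_goals right; linarith

/-- An integral family of discriminant `5⁸`: the unit `1` and four of the conjugates of `x`, together
with the base change to the powers of `x - 1`. -/
lemma exists_discr_eq_five_pow (hF : Module.finrank ℚ F = 5) (hx : aeval x quintic = 0) :
    ∃ (b : Fin 5 → F) (P : Matrix (Fin 5) (Fin 5) ℚ), (∀ i, IsIntegral ℤ (b i)) ∧
      Algebra.discr ℚ b = 5 ^ 8 ∧ P.det = 7 ∧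
      (fun i : Fin 5 ↦ (x - 1) ^ (i : ℕ)) = (P.map (algebraMap ℚ F)).mulVec b := by
  have hx' := hx
  rw [aeval_quintic] at hx'
  obtain ⟨r, s, t, u, hprod, e₁, e₂, e₃, e₄, -⟩ := quintic_exists_conjugates hx'
  have hroot {z : F} (hz : (z - x) * (z - r) * (z - s) * (z - t) * (z - u) = 0) :
      aeval z quintic = 0 := by rw [aeval_quintic, hprod, hz]
  have hr : aeval r quintic = 0 := hroot (by ring)
  have hs : aeval s quintic = 0 := hroot (by ring)
  have ht : aeval t quintic = 0 := hroot (by ring)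
  have hu : aeval u quintic = 0 := hroot (by ring)
  set T := Algebra.trace ℚ F with hT
  have hsq {z : F} (hz : aeval z quintic = 0) : T (z * z) = 20 := by
    rw [← sq, hT, trace_sq_of_aeval_quintic hF hz]
  have hge {y z : F} (hy : aeval y quintic = 0) (hz : aeval z quintic = 0) : -5 ≤ T (y * z) := by
    obtain rfl | h := trace_mul_of_aeval_quintic hF hy hz
    · rw [hsq hz]; norm_num
    · exact h.ge
  have hsum (y : F) : T (y * x) + T (y * r) + T (y * s) + T (y * t) + T (y * u) = 0 := by
    rw [← map_add, ← map_add, ← map_add, ← map_add, ← map_zero T]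
    congr 1
    linear_combination y * e₁
  have one : T 1 = 5 := by
    rw [← map_one (algebraMap ℚ F), hT, Algebra.trace_algebraMap, hF]; norm_num
  have zx : T x = 0 := trace_eq_zero_of_aeval_quintic hx
  have zr : T r = 0 := trace_eq_zero_of_aeval_quintic hr
  have zs : T s = 0 := trace_eq_zero_of_aeval_quintic hs
  have zt : T t = 0 := trace_eq_zero_of_aeval_quintic ht
  have xr : T (x * r) = -5 := by
    linarith [hsum x, hsq hx, hge hx hr, hge hx hs, hge hx ht, hge hx hu]
  have xs : T (x * s) = -5 := by
    linarith [hsum x, hsq hx, hge hx hr, hge hx hs, hge hx ht, hge hx hu]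
  have xt : T (x * t) = -5 := by
    linarith [hsum x, hsq hx, hge hx hr, hge hx hs, hge hx ht, hge hx hu]
  have rs : T (r * s) = -5 := by
    linarith [hsum r, hsq hr, hge hr hx, hge hr hs, hge hr ht, hge hr hu]
  have rt : T (r * t) = -5 := by
    linarith [hsum r, hsq hr, hge hr hx, hge hr hs, hge hr ht, hge hr hu]
  have st : T (s * t) = -5 := by
    linarith [hsum s, hsq hs, hge hs hx, hge hs hr, hge hs ht, hge hs hu]
  refine ⟨![1, x, r, s, t], !![1, 0, 0, 0, 0; -1, 1, 0, 0, 0; 5, -2, -1, 0, -2;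
    -10, 9, 0, -2, 3; 45, -22, -4, 9, -18], ?_, ?_, ?_, ?_⟩
  · intro i
    fin_cases i
    exacts [isIntegral_one, isIntegral_of_aeval_quintic hx, isIntegral_of_aeval_quintic hr,
      isIntegral_of_aeval_quintic hs, isIntegral_of_aeval_quintic ht]
  · have : Algebra.traceMatrix ℚ ![1, x, r, s, t] = !![5, 0, 0, 0, 0; 0, 20, -5, -5, -5;
        0, -5, 20, -5, -5; 0, -5, -5, 20, -5; 0, -5, -5, -5, 20] := by
      ext i j
      rw [Algebra.traceMatrix_apply, Algebra.traceForm_apply]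
      fin_cases i <;> fin_cases j <;>
        simp [← hT, one, zx, zr, zs, zt, xr, xs, xt, rs, rt, st, hsq, hx, hr, hs, ht,
          mul_comm r x, mul_comm s x, mul_comm t x, mul_comm s r, mul_comm t r, mul_comm t s]
    rw [Algebra.discr_def, this]
    simp [Matrix.det_succ_row_zero, Fin.sum_univ_succ, Fin.succAbove]
    norm_num
  · simp [Matrix.det_succ_row_zero, Fin.sum_univ_succ, Fin.succAbove]
    norm_num
  · ext i
    fin_cases i <;> simp [Matrix.mulVec, dotProduct, Fin.sum_univ_succ]
    · ring
    · linear_combination e₂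
    · linear_combination e₃ - 3 * e₂
    · linear_combination e₄ - 4 * e₃ + 6 * e₂

end Trace

section Discriminant

variable {F : Type*} [Field F] [NumberField F] {x : F}

lemma discr_coe_eq_discr {ι : Type*} [Fintype ι] [DecidableEq ι] (w : Module.Basis ι ℤ (𝓞 F)) :
    Algebra.discr ℚ (fun i ↦ (w i : F)) = NumberField.discr F := by
  rw [← discr_eq_discr F w]
  change _ = algebraMap ℤ ℚ _
  rw [← Algebra.discr_localizationLocalization ℤ (nonZeroDivisors ℤ) F]
  congr 1
  ext
  simp only [Module.Basis.localizationLocalization_apply]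

/-- An integral family has discriminant a square multiple of the discriminant of the field. -/
lemma exists_discr_eq_sq_mul_discr_s16 {ι : Type*} [Fintype ι] [DecidableEq ι]
    (w : Module.Basis ι ℤ (𝓞 F)) {b : ι → F} (hb : ∀ i, IsIntegral ℤ (b i)) :
    ∃ m : ℤ, Algebra.discr ℚ b = m ^ 2 * NumberField.discr F := by
  obtain ⟨b, rfl⟩ : ∃ b' : ι → 𝓞 F, b = fun i ↦ (b' i : F) := ⟨fun i ↦ ⟨b i, hb i⟩, rfl⟩
  refine ⟨(w.toMatrix b).det, ?_⟩
  have hmul : (fun i ↦ (b i : F)) = Matrix.vecMul (fun i ↦ (w i : F))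
      (((w.toMatrix b).map (Int.castRingHom ℚ)).map (algebraMap ℚ F)) := by
    ext j
    rw [← w.sum_toMatrix_smul_self b j]
    simp [Matrix.vecMul, dotProduct, mul_comm]
  rw [hmul, Algebra.discr_of_matrix_vecMul, discr_coe_eq_discr, ← RingHom.mapMatrix_apply,
    ← RingHom.map_det]
  rfl

lemma minpoly_sub_one (hx : aeval x quintic = 0) : minpoly ℤ (x - 1) = shiftedQuintic := by
  refine map_injective (algebraMap ℤ ℚ) (algebraMap ℤ ℚ).injective_int ?_
  rw [← minpoly.isIntegrallyClosed_eq_field_fractions' ℚ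
    ((isIntegral_of_aeval_quintic hx).sub isIntegral_one), ← map_one (algebraMap ℚ F),
    minpoly.sub_algebraMap, minpoly_of_aeval_quintic hx, quintic_comp_X_add_one]

lemma exists_powerBasis_gen_eq_sub (htop : ℚ⟮x⟯ = ⊤) (c : ℚ) :
    ∃ B : PowerBasis ℚ F, B.gen = x - algebraMap ℚ F c := by
  have : ℚ⟮x - algebraMap ℚ F c⟯ = ⊤ := by
    rw [eq_top_iff, ← htop, adjoin_simple_le_iff]
    simpa using add_mem (mem_adjoin_simple_self ℚ (x - algebraMap ℚ F c))
      (IntermediateField.algebraMap_mem ℚ⟮x - algebraMap ℚ F c⟯ c)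
  refine ⟨PowerBasis.ofAdjoinEqTop (Algebra.IsIntegral.isIntegral _) ?_,
    PowerBasis.ofAdjoinEqTop_gen _ _⟩
  rw [← IntermediateField.adjoin_simple_toSubalgebra_of_isAlgebraic
    (Algebra.IsAlgebraic.isAlgebraic _), this, IntermediateField.top_toSubalgebra]

/-- The index of `ℤ[x - 1]` in the ring of integers divides a power of `7`. -/
lemma smul_mem_span_pow (hx : aeval x quintic = 0) (htop : ℚ⟮x⟯ = ⊤)
    (hdisc : Algebra.discr ℚ (fun i : Fin 5 ↦ (x - 1) ^ (i : ℕ)) = 49 * 5 ^ 8) {z : F}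
    (hz : IsIntegral ℤ z) : ∃ c : Fin 5 → ℤ, 49 * z = ∑ i, c i * (x - 1) ^ (i : ℕ) := by
  obtain ⟨B, hB⟩ := exists_powerBasis_gen_eq_sub htop 1
  rw [map_one] at hB
  have hdim : B.dim = 5 := by rw [← B.finrank, finrank_eq_five hx htop]
  have hint : IsIntegral ℤ (x - 1) := (isIntegral_of_aeval_quintic hx).sub isIntegral_one
  have hBd : Algebra.discr ℚ B.basis = 49 * 5 ^ 8 := by
    rw [← hdisc, ← Algebra.discr_reindex ℚ _ (finCongr hdim)]
    congr 1
    ext i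
    simp [hB]
  have hmem := Algebra.discr_mul_isIntegral_mem_adjoin ℚ (B := B) (hB ▸ hint) hz
  have hmem' : algebraMap ℤ F 49 * z ∈ Algebra.adjoin ℤ {B.gen} := by
    refine mem_adjoin_of_smul_prime_pow_smul_of_minpoly_isEisensteinAt (p := (5 : ℤ)) (n := 8)
      (K := ℚ) (by norm_num) (hB ▸ hint) ((isIntegral_algebraMap (x := (49 : ℤ))).mul hz) ?_ ?_
    · convert hmem using 1
      rw [hBd]
      simp [Algebra.smul_def]
      ring
    · rw [hB, minpoly_sub_one hx]
      exact shiftedQuintic_isEisensteinAt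
  rw [hB, Algebra.adjoin_singleton_eq_range_aeval] at hmem'
  obtain ⟨p, hp⟩ := hmem'
  have hroot : aeval (x - 1) shiftedQuintic = 0 := by
    rw [← minpoly_sub_one hx]; exact minpoly.aeval ℤ (x - 1)
  refine ⟨fun i ↦ (p %ₘ shiftedQuintic).coeff i, ?_⟩
  have hdeg : (p %ₘ shiftedQuintic).natDegree < 5 := by
    rw [← shiftedQuintic_natDegree]
    exact natDegree_modByMonic_lt _ shiftedQuintic_monic fun h ↦ by
      simpa [h] using shiftedQuintic_natDegree
  calc 49 * z = aeval (x - 1) p := by simpa using hp.symm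
    _ = aeval (x - 1) (p %ₘ shiftedQuintic) := (aeval_modByMonic_eq_self_of_root hroot).symm
    _ = _ := by rw [aeval_eq_sum_range' hdeg, Finset.sum_range]; simp

lemma discr_eq_five_pow (hx : aeval x quintic = 0) (htop : ℚ⟮x⟯ = ⊤) :
    NumberField.discr F = 5 ^ 8 := by
  have hF := finrank_eq_five hx htop
  obtain ⟨b, P, hb, hdisc, hP, hpow⟩ := exists_discr_eq_five_pow hF hx
  have hpd : Algebra.discr ℚ (fun i : Fin 5 ↦ (x - 1) ^ (i : ℕ)) = 49 * 5 ^ 8 := by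
    rw [hpow, Algebra.discr_of_matrix_mulVec, hP, hdisc]
    norm_num
  have w : Module.Basis (Fin 5) ℤ (𝓞 F) :=
    (Module.finBasis ℤ (𝓞 F)).reindex (finCongr (by rw [RingOfIntegers.rank, hF]))
  obtain ⟨m, hm⟩ := exists_discr_eq_sq_mul_discr_s16 w hb
  choose c hc using fun i ↦ smul_mem_span_pow hx htop hpd (w i).isIntegral_coe
  have hw : (((49 : ℚ) • (1 : Matrix (Fin 5) (Fin 5) ℚ)).map (algebraMap ℚ F)).mulVec (fun i ↦ (w i : F)) =
      (((Matrix.of c).map (Int.castRingHom ℚ)).map (algebraMap ℚ F)).mulVec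
        (fun i : Fin 5 ↦ (x - 1) ^ (i : ℕ)) := by
    ext i
    simpa [Matrix.mulVec, dotProduct, Matrix.one_apply, apply_ite] using hc i
  have h49 : (49 ^ 10 * NumberField.discr F : ℚ) = (Matrix.of c).det ^ 2 * (49 * 5 ^ 8) := by
    have := congrArg (Algebra.discr ℚ) hw
    rw [Algebra.discr_of_matrix_mulVec, Algebra.discr_of_matrix_mulVec, discr_coe_eq_discr, hpd,
      ← RingHom.mapMatrix_apply, ← RingHom.map_det, Matrix.det_smul] at this
    simpa [← pow_mul] using this
  have h₁ : m ^ 2 * NumberField.discr F = 5 ^ 8 := by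
    exact_mod_cast hm.symm.trans hdisc
  have h₂ : (49 ^ 10 * NumberField.discr F : ℤ) = (Matrix.of c).det ^ 2 * (49 * 5 ^ 8) := by
    exact_mod_cast h49
  refine Int.dvd_antisymm ?_ (by positivity) ⟨m ^ 2, by rw [← h₁]; ring⟩ ?_
  · have : 0 < m ^ 2 * NumberField.discr F := by rw [h₁]; positivity
    exact (pos_of_mul_pos_right this (sq_nonneg m)).le
  · refine IsCoprime.dvd_of_dvd_mul_left (y := 49 ^ 10) ?_ ⟨(Matrix.of c).det ^ 2 * 49, by
      linear_combination h₂⟩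
    rw [Int.isCoprime_iff_gcd_eq_one]; rfl

end Discriminant

section ClassNumber

variable {F : Type*} [Field F] [NumberField F] {x : F}

lemma map_quintic_eval {R S : Type*} [CommRing R] [CommRing S] (φ : R →+* S) (y : R) :
    φ (y ^ 5 - 10 * y ^ 3 - 5 * y ^ 2 + 10 * y - 1) =
      φ y ^ 5 - 10 * φ y ^ 3 - 5 * φ y ^ 2 + 10 * φ y - 1 := by
  have h₅ := map_ofNat φ 5
  have h₁₀ := map_ofNat φ 10
  simp [h₅, h₁₀]

lemma norm_sub_algebraMap (hx : aeval x quintic = 0) (htop : ℚ⟮x⟯ = ⊤) (c : ℚ) :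
    Algebra.norm ℚ (x - algebraMap ℚ F c) = -quintic.eval c := by
  obtain ⟨B, hB⟩ := exists_powerBasis_gen_eq_sub htop c
  rw [← hB, Algebra.PowerBasis.norm_gen_eq_coeff_zero_minpoly, ← B.finrank,
    finrank_eq_five hx htop, hB, minpoly.sub_algebraMap, minpoly_of_aeval_quintic hx,
    coeff_zero_eq_eval_zero, eval_comp]
  norm_num

lemma isReal_of_adjoin_eq_top (hx : aeval x quintic = 0) (htop : ℚ⟮x⟯ = ⊤) (v : InfinitePlace F) :
    v.IsReal := by
  have := isGalois_of_adjoin_eq_top hx htop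
  have hodd : Odd (Module.finrank ℚ F) := by rw [finrank_eq_five hx htop]; decide
  have := IsUnramifiedAtInfinitePlaces_of_odd_finrank hodd
  refine (InfinitePlace.isUnramified_iff.1 
    (InfinitePlace.isUnramified ℚ v)).resolve_right ?_
  rw [InfinitePlace.not_isComplex_iff_isReal]
  exact IsTotallyReal.isReal _

/-- A prime modulo which the quintic has no root is inert. -/
lemma inertiaDeg_eq_five [IsGalois ℚ F] (hx : aeval x quintic = 0) (hF : Module.finrank ℚ F = 5)
    {p : ℕ} (hp : p.Prime)
    (hroot : ∀ t : ZMod p, t ^ 5 - 10 * t ^ 3 - 5 * t ^ 2 + 10 * t - 1 ≠ 0)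
    (P : Ideal (𝓞 F)) [P.IsPrime] [P.LiesOver (Ideal.span {(p : ℤ)})] :
    P.inertiaDeg ℤ = 5 := by
  have : Fact p.Prime := ⟨hp⟩
  have : (Ideal.span {(p : ℤ)}).IsMaximal := Int.ideal_span_isMaximal_of_prime p
  have hdvd : P.inertiaDeg ℤ ∣ 5 := by
    rw [← hF, ← IsGalois.card_aut_eq_finrank,
      ← Ideal.ncard_primesOver_mul_ramificationIdxIn_mul_inertiaDegIn (Ideal.span {(p : ℤ)}) (𝓞 F)
        (F ≃ₐ[ℚ] F), Ideal.inertiaDegIn_eq_inertiaDeg (Ideal.span {(p : ℤ)}) P (F ≃ₐ[ℚ] F)]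
    exact Dvd.intro_left _ (mul_assoc _ _ _)
  refine ((Nat.dvd_prime (by norm_num)).1 hdvd).resolve_left fun h ↦ ?_
  have hcard := Ideal.natAbs_pow_inertiaDeg (p : ℤ) P
  rw [h, pow_one, Int.natAbs_natCast, Ideal.absNorm_apply, Submodule.cardQuot_apply] at hcard
  have : Finite (𝓞 F ⧸ P) := Nat.finite_of_card_ne_zero (hcard ▸ hp.ne_zero)
  have : Fintype (𝓞 F ⧸ P) := Fintype.ofFinite _
  rw [Nat.card_eq_fintype_card] at hcard
  let e := ZMod.ringEquivOfPrime (𝓞 F ⧸ P) hp hcard.symm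
  obtain ⟨y, rfl⟩ : ∃ y : 𝓞 F, (y : F) = x := ⟨⟨x, isIntegral_of_aeval_quintic hx⟩, rfl⟩
  rw [aeval_quintic, ← map_quintic_eval, FaithfulSMul.algebraMap_eq_zero_iff] at hx
  refine hroot ((e.symm : _ →+* ZMod p).comp (Ideal.Quotient.mk P) y) ?_
  rw [← map_quintic_eval, hx, map_zero]

/-- An element of prime norm generates a prime ideal. -/
lemma span_singleton_mem_primesOver {a : 𝓞 F} {p : ℕ} (hp : p.Prime)
    (h : |Algebra.norm ℚ (a : F)| = p) :
    Ideal.span {a} ∈ (Ideal.span {(p : ℤ)}).primesOver (𝓞 F) := by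
  have hn : Ideal.absNorm (Ideal.span {a}) = p := by
    rw [Ideal.absNorm_span_singleton]
    rw [← Algebra.coe_norm_int, ← Int.cast_abs, Int.abs_eq_natAbs] at h
    exact_mod_cast h
  refine ⟨Ideal.isPrime_of_irreducible_absNorm (by rwa [hn]), ⟨?_⟩⟩
  rw [Ideal.under_def, ← Ideal.span_singleton_absNorm (by rwa [hn]), hn]

lemma classNumber_eq_one (hx : aeval x quintic = 0) (htop : ℚ⟮x⟯ = ⊤) : classNumber F = 1 := by
  have := isGalois_of_adjoin_eq_top hx htop
  have : IsTotallyReal F := ⟨isReal_of_adjoin_eq_top hx htop⟩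
  have hF := finrank_eq_five hx htop
  obtain ⟨y, rfl⟩ : ∃ y : 𝓞 F, (y : F) = x := ⟨⟨x, isIntegral_of_aeval_quintic hx⟩, rfl⟩
  have hbound : ⌊(4 / Real.pi) ^ InfinitePlace.nrComplexPlaces F *
      ((Module.finrank ℚ F).factorial / Module.finrank ℚ F ^ Module.finrank ℚ F *
        √|NumberField.discr F|)⌋₊ = 24 := by
    rw [IsTotallyReal.nrComplexPlaces_eq_zero, hF, discr_eq_five_pow hx htop]
    have : √|((5 ^ 8 : ℤ) : ℝ)| = 5 ^ 4 := by
      rw [Real.sqrt_eq_iff_mul_self_eq (by positivity) (by positivity)]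
      norm_num
    rw [this, Nat.floor_eq_iff (by positivity)]
    norm_num [Nat.factorial]
  rw [classNumber_eq_one_iff]
  refine RingOfIntegers.isPrincipalIdealRing_of_isPrincipal_of_lt_or_isPrincipal_of_mem_primesOver_of_mem_Icc ?_
  rw [hbound]
  intro p hp hprime
  have key : p = 5 ∨ p = 7 ∨
      ∀ t : ZMod p, t ^ 5 - 10 * t ^ 3 - 5 * t ^ 2 + 10 * t - 1 ≠ 0 := by
    rw [Finset.mem_Icc] at hp
    obtain ⟨h1, h2⟩ := hp
    interval_cases p <;> first | (exfalso; revert hprime; norm_num; done) | decide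
  obtain rfl | rfl | hroot := key
  · refine ⟨Ideal.span {y - 1}, span_singleton_mem_primesOver hprime ?_, .inr ⟨⟨_, rfl⟩⟩⟩
    have h := norm_sub_algebraMap hx htop 1
    rw [map_one] at h
    rw [show ((y - 1 : 𝓞 F) : F) = y - 1 from rfl, h]
    norm_num [quintic]
  · refine ⟨Ideal.span {y + 1}, span_singleton_mem_primesOver hprime ?_, .inr ⟨⟨_, rfl⟩⟩⟩
    have h := norm_sub_algebraMap hx htop (-1)
    rw [map_neg, map_one, sub_neg_eq_add] at h
    rw [show ((y + 1 : 𝓞 F) : F) = y + 1 from rfl, h]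
    norm_num [quintic]
  · have : Fact p.Prime := ⟨hprime⟩
    have : (Ideal.span {(p : ℤ)}).IsMaximal := Int.ideal_span_isMaximal_of_prime p
    obtain ⟨⟨P, hP, hP'⟩⟩ := Ideal.nonempty_primesOver (S := 𝓞 F) (Ideal.span {(p : ℤ)})
    refine ⟨P, ⟨hP, hP'⟩, .inl ?_⟩
    rw [inertiaDeg_eq_five hx hF hprime hroot P]
    exact lt_of_lt_of_le (by norm_num) (Nat.pow_le_pow_left hprime.two_le 5)

end ClassNumber

section Cyclotomic

lemma Subgroup.eq_setOf_pow_card_eq_one {G : Type*} [Group G] [Finite G] [IsCyclic G]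
    (H : Subgroup G) : (H : Set G) = {a | a ^ Nat.card H = 1} := by
  classical
  have := Fintype.ofFinite G
  refine Set.eq_of_subset_of_ncard_le (fun a ha ↦ ?_) ?_
  · exact congrArg Subtype.val (pow_card_eq_one' (x := (⟨a, ha⟩ : H)))
  · rw [← Nat.card_coe_set_eq (H : Set G), Set.ncard_eq_toFinset_card', Set.toFinset_ofPred]
    exact IsCyclic.card_pow_eq_one_le Nat.card_pos

/-- A field with cyclic Galois group over `K` has at most one subfield of each degree. -/
lemma IntermediateField.eq_of_finrank_eq_of_isCyclic {K L : Type*} [Field K] [Field L] [Algebra K L]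
    [FiniteDimensional K L] [IsGalois K L] [IsCyclic (L ≃ₐ[K] L)] {E E' : IntermediateField K L}
    (h : Module.finrank K E = Module.finrank K E') : E = E' := by
  have hcard : Nat.card E.fixingSubgroup = Nat.card E'.fixingSubgroup := by
    rw [IsGalois.card_fixingSubgroup_eq_finrank, IsGalois.card_fixingSubgroup_eq_finrank]
    have h₁ := Module.finrank_mul_finrank K E L
    rw [h, ← Module.finrank_mul_finrank K E' L] at h₁
    exact Nat.eq_of_mul_eq_mul_left Module.finrank_pos h₁
  have : E.fixingSubgroup = E'.fixingSubgroup := SetLike.coe_injective (by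
    rw [Subgroup.eq_setOf_pow_card_eq_one, hcard, ← Subgroup.eq_setOf_pow_card_eq_one])
  rw [← IsGalois.fixedField_fixingSubgroup E, this, IsGalois.fixedField_fixingSubgroup]

variable {F : Type*} [Field F] [NumberField F] {x : F}

lemma exists_algHom_cyclotomic (hx : aeval x quintic = 0) (htop : ℚ⟮x⟯ = ⊤) (L : Type*) [Field L]
    [Algebra ℚ L] [IsCyclotomicExtension {25} ℚ L] :
    ∃ φ : F →ₐ[ℚ] L, ∀ E : IntermediateField ℚ L, Module.finrank ℚ E = 5 → E = φ.fieldRange := by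
  obtain ⟨ζ, hζ⟩ : ∃ ζ : L, IsPrimitiveRoot ζ 25 := ⟨_, IsCyclotomicExtension.zeta_spec 25 ℚ L⟩
  have hroot := hζ.isRoot_cyclotomic (by norm_num)
  rw [show 25 = 5 ^ (1 + 1) by norm_num, cyclotomic_prime_pow_eq_geom_sum (by norm_num)] at hroot
  obtain ⟨y, hy⟩ := quintic_gaussPeriod (z := ζ) (by
    simp [Finset.sum_range_succ, ← pow_mul] at hroot
    linear_combination hroot)
  obtain ⟨φ, -⟩ := exists_algHom_of_adjoin_eq_top hx htop (y := y) (by rw [aeval_quintic, hy])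
  refine ⟨φ, fun E hE ↦ ?_⟩
  have := IsCyclotomicExtension.isGalois {25} ℚ L
  have := IsCyclotomicExtension.finiteDimensional {25} ℚ L
  have : IsCyclic (ZMod 25)ˣ :=
    ZMod.isCyclic_units_of_prime_pow 5 (by norm_num) (by norm_num) 2
  have : IsCyclic (L ≃ₐ[ℚ] L) :=
    isCyclic_of_surjective _ (IsCyclotomicExtension.autEquivPow L
      (cyclotomic.irreducible_rat (n := 25) (by norm_num))).symm.surjective
  refine IntermediateField.eq_of_finrank_eq_of_isCyclic ?_
  rw [hE, ← finrank_eq_five hx htop]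
  exact (AlgEquiv.ofInjectiveField φ).toLinearEquiv.finrank_eq

end Cyclotomic

section Signs

/-- The unit `2 - 2x - x²` is negative at only one root of the quintic. -/
lemma three_lt_of_quintic_eq_zero {t : ℝ} (ht : t ^ 5 - 10 * t ^ 3 - 5 * t ^ 2 + 10 * t - 1 = 0)
    (h : 2 - 2 * t - t ^ 2 ≤ 0) : 3 < t := by
  by_contra! h3
  have hdiv : (t ^ 2 + 2 * t - 2) * (t ^ 3 - 2 * t ^ 2 - 4 * t - 1) + (4 * t - 3) = 0 := by
    linear_combination ht
  obtain h0 | h0 := le_or_gt t 0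
  · have ht2 : t ≤ -5 / 2 := by nlinarith
    have hq : t ^ 3 - 2 * t ^ 2 - 4 * t - 1 ≤ 0 := by nlinarith [sq_nonneg t, sq_nonneg (t + 2)]
    nlinarith
  · have ht2 : 7 / 10 ≤ t := by nlinarith
    have hq : t ^ 3 - 2 * t ^ 2 - 4 * t - 1 ≤ -4 := by
      nlinarith [mul_nonneg (sub_nonneg.2 h3) (show 0 ≤ t ^ 2 + t - 1 by nlinarith)]
    nlinarith

lemma eq_of_quintic_eq_zero {s t : ℝ} (hs : s ^ 5 - 10 * s ^ 3 - 5 * s ^ 2 + 10 * s - 1 = 0)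
    (ht : t ^ 5 - 10 * t ^ 3 - 5 * t ^ 2 + 10 * t - 1 = 0) (hs3 : 3 < s) (ht3 : 3 < t) :
    s = t := by
  have hpos : 0 < s ^ 4 + s ^ 3 * t + s ^ 2 * t ^ 2 + s * t ^ 3 + t ^ 4 -
      10 * (s ^ 2 + s * t + t ^ 2) - 5 * (s + t) + 10 := by
    obtain ⟨a, ha, rfl⟩ : ∃ a, 0 < a ∧ s = a + 3 := ⟨s - 3, by linarith, by ring⟩
    obtain ⟨b, hb, rfl⟩ : ∃ b, 0 < b ∧ t = b + 3 := ⟨t - 3, by linarith, by ring⟩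
    ring_nf
    positivity
  have : (s - t) * (s ^ 4 + s ^ 3 * t + s ^ 2 * t ^ 2 + s * t ^ 3 + t ^ 4 -
      10 * (s ^ 2 + s * t + t ^ 2) - 5 * (s + t) + 10) = 0 := by
    linear_combination hs - ht
  exact sub_eq_zero.1 ((mul_eq_zero.1 this).resolve_right hpos.ne')

lemma exists_quintic_eq_zero :
    ∃ t : ℝ, 3 < t ∧ t ^ 5 - 10 * t ^ 3 - 5 * t ^ 2 + 10 * t - 1 = 0 := by
  have hcont : ContinuousOn (fun t : ℝ ↦ t ^ 5 - 10 * t ^ 3 - 5 * t ^ 2 + 10 * t - 1)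
      (Set.Icc 3 4) := by fun_prop
  obtain ⟨t, ht, h0⟩ := intermediate_value_Ioo (by norm_num) hcont
    (show (0 : ℝ) ∈ _ by constructor <;> norm_num)
  exact ⟨t, ht.1, h0⟩

variable {F : Type*} [Field F] [NumberField F] {x : F}

lemma exists_unit_coe_eq (hx : aeval x quintic = 0) :
    ∃ η : (𝓞 F)ˣ, ((η : 𝓞 F) : F) = 2 - 2 * x - x ^ 2 := by
  obtain ⟨y, rfl⟩ : ∃ y : 𝓞 F, (y : F) = x := ⟨⟨x, isIntegral_of_aeval_quintic hx⟩, rfl⟩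
  rw [aeval_quintic, ← map_quintic_eval, FaithfulSMul.algebraMap_eq_zero_iff] at hx
  refine ⟨Units.mkOfMulEqOne (2 - 2 * y - y ^ 2) (-5 + 48 * y + 38 * y ^ 2 - 3 * y ^ 3 - 4 * y ^ 4)
    (by linear_combination (11 + 4 * y) * hx), ?_⟩
  have h₂ := map_ofNat (algebraMap (𝓞 F) F) 2
  simp [h₂]

/-- For every real embedding there is a unit which is negative at that embedding only. -/
lemma exists_unit_sign_eq (hx : aeval x quintic = 0) (htop : ℚ⟮x⟯ = ⊤) (w : F →+* ℝ) :
    ∃ η : (𝓞 F)ˣ, ∀ v : F →+* ℝ, (v = w → v ((η : 𝓞 F) : F) < 0) ∧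
      (v ≠ w → 0 < v ((η : 𝓞 F) : F)) := by
  obtain ⟨ρ, hρ3, hρ⟩ := exists_quintic_eq_zero
  obtain ⟨z, hz, hwz⟩ : ∃ z : F, aeval z quintic = 0 ∧ w z = ρ := by
    have hroot : ρ ∈ ((quintic.map (algebraMap ℚ F)).map w).roots := by
      rw [Polynomial.map_map, Subsingleton.elim (w.comp (algebraMap ℚ F)) (algebraMap ℚ ℝ),
        mem_roots_map_of_injective (algebraMap ℚ ℝ).injective quintic_monic.ne_zero, ← aeval_def,
        aeval_quintic, hρ]
    rw [(quintic_splits hx).roots_map] at hroot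
    obtain ⟨z, hz, rfl⟩ := Multiset.mem_map.1 hroot
    exact ⟨z, (mem_aroots.1 hz).2, rfl⟩
  obtain ⟨η, hη⟩ := exists_unit_coe_eq hz
  have hvη (v : F →+* ℝ) : v ((η : 𝓞 F) : F) = 2 - 2 * v z - v z ^ 2 := by
    rw [hη]
    have h₂ := map_ofNat v 2
    simp [h₂]
  refine ⟨η, fun v ↦ ⟨?_, fun hvw ↦ ?_⟩⟩
  · rintro rfl
    rw [hvη, hwz]
    nlinarith
  · by_contra! hle
    rw [hvη] at hle
    have hvz : v z ^ 5 - 10 * v z ^ 3 - 5 * v z ^ 2 + 10 * v z - 1 = 0 := by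
      rw [← map_quintic_eval, ← aeval_quintic, hz, map_zero]
    have heq : v z = w z :=
      hwz ▸ eq_of_quintic_eq_zero hvz hρ (three_lt_of_quintic_eq_zero hvz hle) hρ3
    obtain ⟨φ, rfl⟩ := exists_algHom_of_adjoin_eq_top hx htop hz
    have hcomp : (v.toRatAlgHom).comp φ = (w.toRatAlgHom).comp φ :=
      algHom_ext_of_adjoin_eq_top htop heq
    have hφ : Function.Surjective φ := (Algebra.IsAlgebraic.algHom_bijective φ).2
    refine hvw (RingHom.ext fun a ↦ ?_)
    obtain ⟨b, rfl⟩ := hφ a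
    exact DFunLike.congr_fun hcomp b

lemma exists_unit_forall_sign_eq (hx : aeval x quintic = 0) (htop : ℚ⟮x⟯ = ⊤)
    {ε : (F →+* ℝ) → ℝ} (hε : ∀ v, ε v = 1 ∨ ε v = -1) :
    ∃ u : (𝓞 F)ˣ, ∀ v : F →+* ℝ, Real.sign (v ((u : 𝓞 F) : F)) = ε v := by
  classical
  choose η hη using exists_unit_sign_eq hx htop
  refine ⟨∏ w with ε w = -1, η w, fun v ↦ ?_⟩
  have hv : v ((↑(∏ w with ε w = -1, η w) : 𝓞 F) : F) =
    ∏ w with ε w = -1, v ((η w : 𝓞 F) : F) := by simp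
  rw [hv]
  obtain h | h := hε v
  · rw [h]
    refine Real.sign_of_pos (Finset.prod_pos fun w hw ↦ (hη w v).2 ?_)
    rintro rfl
    norm_num [h] at hw
  · rw [h, ← Finset.mul_prod_erase _ _ (show v ∈ ({w | ε w = -1} : Finset _) by simpa using h)]
    exact Real.sign_of_neg (mul_neg_of_neg_of_pos ((hη v v).1 rfl)
      (Finset.prod_pos fun w hw ↦ (hη w v).2 (Finset.ne_of_mem_erase hw).symm))

end Signs

/-- The quintic `f = x⁵ - 10x³ - 5x² + 10x - 1 ∈ ℚ[x]` is irreducible over `ℚ`, and the number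
field `F = ℚ[x]/(f)` is Galois over `ℚ` with cyclic Galois group of order `5`, totally real
with discriminant `5⁸`, embeds into `ℚ(ζ₂₅)` as its unique subfield of degree `5`, and has
strict (narrow) class number `1`: its class number is `1` and every choice of signs at the `5`
real embeddings of `F` is realized by a unit of the ring of integers of `F`. -/
theorem quintic_subfield_of_25th_cyclotomic_field :
    Irreducible (X ^ 5 - 10 * X ^ 3 - 5 * X ^ 2 + 10 * X - 1 : ℚ[X]) ∧
    (∀ (F : Type) [Field F] [NumberField F], ∀ x : F,
      aeval x (X ^ 5 - 10 * X ^ 3 - 5 * X ^ 2 + 10 * X - 1 : ℚ[X]) = 0 →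
      IntermediateField.adjoin ℚ {x} = ⊤ →
      IsGalois ℚ F ∧ IsCyclic (F ≃ₐ[ℚ] F) ∧ Nat.card (F ≃ₐ[ℚ] F) = 5 ∧
      (∀ v : NumberField.InfinitePlace F, v.IsReal) ∧
      NumberField.discr F = 5 ^ 8 ∧
      (∀ (L : Type) [Field L] [Algebra ℚ L] [IsCyclotomicExtension {25} ℚ L],
        ∃ φ : F →ₐ[ℚ] L, ∀ E : IntermediateField ℚ L,
          Module.finrank ℚ E = 5 → E = φ.fieldRange) ∧
      NumberField.classNumber F = 1 ∧
      (∀ ε : (F →+* ℝ) → ℝ, (∀ v, ε v = 1 ∨ ε v = -1) →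
        ∃ u : (𝓞 F)ˣ, ∀ v : F →+* ℝ, Real.sign (v ((u : 𝓞 F) : F)) = ε v)) := by
  refine ⟨quintic_irreducible, fun F _ _ x hx htop ↦ ?_⟩
  have hgal := isGalois_of_adjoin_eq_top hx htop
  have hcard : Nat.card (F ≃ₐ[ℚ] F) = 5 := by
    rw [IsGalois.card_aut_eq_finrank, finrank_eq_five hx htop]
  have : Fact (Nat.Prime 5) := ⟨by norm_num⟩
  exact ⟨hgal, isCyclic_of_prime_card hcard, hcard, isReal_of_adjoin_eq_top hx htop,
    discr_eq_five_pow hx htop, fun L _ _ _ ↦ exists_algHom_cyclotomic hx htop L,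
    classNumber_eq_one hx htop, fun _ hε ↦ exists_unit_forall_sign_eq hx htop hε⟩
end

section
/- Let S be a finite nonabelian simple group and let H be a subgroup of the direct product S⁵ = S × S × S × S × S such that (i) for each i ∈ {1,…,5}, the i-th coordinate projection maps H surjectively onto S, and (ii) H is invariant under the automorphism σ of S⁵ that cyclically permutes the coordinates, σ(x₁,x₂,x₃,x₄,x₅) = (x₅,x₁,x₂,x₃,x₄). Then either H = S⁵, or H is a diagonal subgroup: there exist automorphisms α₁,…,α₅ of S with α₁ = id such that H = {(α₁(x), α₂(x), α₃(x), α₄(x), α₅(x)) : x ∈ S}. -/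
section SubdirectPowers

variable {ι S : Type*} [Group S]

/-- The values at coordinate `j` of those elements of `H` that are trivial on `T`. -/
def Subgroup.coordinateImage (H : Subgroup (ι → S)) (T : Set ι) (j : ι) : Subgroup S :=
  (H ⊓ Subgroup.pi T fun _ => ⊥).map (Pi.evalMonoidHom (fun _ : ι => S) j)

theorem Subgroup.mem_coordinateImage {H : Subgroup (ι → S)} {T : Set ι} {j : ι} {s : S} :
    s ∈ H.coordinateImage T j ↔ ∃ h ∈ H, (∀ i ∈ T, h i = 1) ∧ h j = s := by
  simp [Subgroup.coordinateImage, Subgroup.mem_map, Subgroup.mem_pi, and_assoc]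

theorem Subgroup.coordinateImage_normal {H : Subgroup (ι → S)} {j : ι}
    (hsurj : ∀ s, ∃ h ∈ H, h j = s) (T : Set ι) : (H.coordinateImage T j).Normal := by
  refine ⟨fun n hn g => ?_⟩
  obtain ⟨h, hH, hT, rfl⟩ := mem_coordinateImage.1 hn
  obtain ⟨k, kH, rfl⟩ := hsurj g
  exact mem_coordinateImage.2 ⟨k * h * k⁻¹, H.mul_mem (H.mul_mem kH hH) (H.inv_mem kH),
    fun i hi => by simp [hT i hi], rfl⟩

/-- A subgroup of a power of a nonabelian simple group that surjects onto each factor, even when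
restricted to the kernel of any other projection, surjects onto each factor when restricted to
the elements trivial on any finite set of other coordinates. -/
theorem Subgroup.coordinateImage_eq_top [IsSimpleGroup S] (hnab : ∃ a b : S, a * b ≠ b * a)
    {H : Subgroup (ι → S)} {j : ι} (hsurj : ∀ s, ∃ h ∈ H, h j = s)
    (hpair : ∀ i ≠ j, H.coordinateImage {i} j = ⊤) (T : Finset ι) (hj : j ∉ T) :
    H.coordinateImage T j = ⊤ := by
  classical
  induction T using Finset.induction_on with
  | empty =>
    refine (Subgroup.eq_top_iff' _).2 fun s => ?_
    obtain ⟨h, hH, hs⟩ := hsurj s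
    exact mem_coordinateImage.2 ⟨h, hH, by simp, hs⟩
  | insert i T _ ih =>
    rw [Finset.mem_insert, not_or] at hj
    refine (coordinateImage_normal hsurj _).eq_bot_or_eq_top.resolve_left fun hbot => ?_
    obtain ⟨a, b, hab⟩ := hnab
    obtain ⟨h, hH, hT, rfl⟩ := mem_coordinateImage.1 (ih hj.2 ▸ mem_top a)
    obtain ⟨k, kH, hi, rfl⟩ :=
      mem_coordinateImage.1 (hpair i (Ne.symm hj.1) ▸ mem_top b)
    have hmem : h j * k j * (h j)⁻¹ * (k j)⁻¹ ∈ H.coordinateImage (insert i T : Finset ι) j := by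
      refine mem_coordinateImage.2 ⟨h * k * h⁻¹ * k⁻¹, H.mul_mem (H.mul_mem
        (H.mul_mem hH kH) (H.inv_mem hH)) (H.inv_mem kH), fun m hm => ?_, rfl⟩
      rcases Finset.mem_insert.1 hm with rfl | hm
      · simp [hi m rfl]
      · simp [hT m hm]
    rw [hbot, mem_bot, mul_inv_eq_one, mul_inv_eq_iff_eq_mul] at hmem
    exact hab hmem

theorem Subgroup.eq_top_of_coordinateImage_singleton [Fintype ι] [IsSimpleGroup S]
    (hnab : ∃ a b : S, a * b ≠ b * a) {H : Subgroup (ι → S)}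
    (hsurj : ∀ j s, ∃ h ∈ H, h j = s)
    (hpair : ∀ i j, i ≠ j → H.coordinateImage {i} j = ⊤) : H = ⊤ := by
  classical
  refine (Subgroup.eq_top_iff' H).2 fun x => pi_mem_of_mulSingle_mem x fun j => ?_
  have htop := coordinateImage_eq_top hnab (hsurj j) (fun i hi => hpair i j hi)
    (Finset.univ.erase j) (by simp)
  obtain ⟨h, hH, hT, hj⟩ := mem_coordinateImage.1 (htop ▸ mem_top (x j))
  convert hH using 1
  ext i
  rcases eq_or_ne i j with rfl | hij
  · simp [hj]
  · simp [hij, hT i (by simp [hij])]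

/-- If every coordinate of an element of `H` determines the others, then `H` is diagonal. -/
theorem Subgroup.exists_eq_range_of_coordinate_injective {H : Subgroup (ι → S)} (o : ι)
    (hsurj : ∀ j s, ∃ h ∈ H, h j = s)
    (hlink : ∀ i j, ∀ h ∈ H, h i = 1 → h j = 1) :
    ∃ α : ι → (S ≃* S), α o = MulEquiv.refl S ∧
      (H : Set (ι → S)) = Set.range (fun x : S => fun i => α i x) := by
  have hbij (i : ι) :
      Function.Bijective ((Pi.evalMonoidHom (fun _ : ι => S) i).comp H.subtype) := by
    refine ⟨(injective_iff_map_eq_one _).2 fun h hi => ?_, fun s => ?_⟩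
    · exact Subtype.ext (funext fun j => hlink i j h h.2 hi)
    · obtain ⟨h, hH, hs⟩ := hsurj i s
      exact ⟨⟨h, hH⟩, hs⟩
  let e (i : ι) : H ≃* S := MulEquiv.ofBijective _ (hbij i)
  have he (i : ι) (h : H) : e i h = (h : ι → S) i := rfl
  refine ⟨fun i => (e o).symm.trans (e i), by ext; simp, Set.ext fun x => ⟨fun hx => ?_, ?_⟩⟩
  · refine ⟨e o ⟨x, hx⟩, funext fun i => ?_⟩
    simp [he i]
  · rintro ⟨s, rfl⟩
    exact ((e o).symm s).2

end SubdirectPowers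

theorem Subgroup.translate_mem_of_shift_mem {S : Type*} [Group S] {H : Subgroup (Fin 5 → S)}
    (hshift : ∀ x ∈ H, (fun i : Fin 5 => x (i - 1)) ∈ H) {x : Fin 5 → S} (hx : x ∈ H)
    (d : Fin 5) : (fun i => x (i + d)) ∈ H := by
  have hiter (n : ℕ) : (fun i => x (i - n • (1 : Fin 5))) ∈ H := by
    induction n with
    | zero => simpa using hx
    | succ n ih =>
      convert hshift _ ih using 3
      rw [succ_nsmul', sub_sub]
  have hd : ∃ n : Fin 5, ∀ i : Fin 5, i - (n : ℕ) • (1 : Fin 5) = i + d := by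
    revert d
    decide
  obtain ⟨n, hn⟩ := hd
  simpa only [hn] using hiter n

theorem Subgroup.coordinate_eq_one_of_shift_mem {S : Type*} [Group S]
    {H : Subgroup (Fin 5 → S)} (hshift : ∀ x ∈ H, (fun i : Fin 5 => x (i - 1)) ∈ H)
    {i j : Fin 5} (hij : i ≠ j) (hlink : ∀ h ∈ H, h i = 1 → h j = 1) (a b : Fin 5) :
    ∀ h ∈ H, h a = 1 → h b = 1 := by
  intro h hH ha
  have hstep (c : Fin 5) (hc : h c = 1) : h (c + (j - i)) = 1 := by
    have := hlink _ (translate_mem_of_shift_mem hshift hH (c - i))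
      (by simpa using hc)
    rwa [show j + (c - i) = c + (j - i) by abel] at this
  have hiter (n : ℕ) : h (a + n • (j - i)) = 1 := by
    induction n with
    | zero => simpa using ha
    | succ n ih => simpa only [succ_nsmul, add_assoc] using hstep _ ih
  have hgen : ∀ d : Fin 5, d ≠ 0 → ∀ c : Fin 5, ∃ n : Fin 5, (n : ℕ) • d = c := by decide
  obtain ⟨n, hn⟩ := hgen (j - i) (sub_ne_zero.2 hij.symm) (b - a)
  simpa [hn] using hiter n


/-- Goursat-type lemma of Gorenstein–Lyons–Solomon: if `S` is a finite nonabelian simple group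
and `H ≤ S⁵` projects onto each factor and is invariant under the cyclic shift
`(x₁,…,x₅) ↦ (x₅,x₁,…,x₄)`, then either `H = S⁵` or `H` is a diagonal subgroup
`{(α₁ x, …, α₅ x) : x ∈ S}` for automorphisms `α᷈ᵢ` of `S` with `α₁ = id`. -/
theorem subgroup_of_fifth_power_of_simple_group
    (S : Type) [Group S] [Finite S] [IsSimpleGroup S]
    (hnab : ∃ a b : S, a * b ≠ b * a)
    (H : Subgroup (Fin 5 → S))
    (hsurj : ∀ i : Fin 5, Function.Surjective (fun h : H => (h : Fin 5 → S) i))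
    (hshift : ∀ x ∈ H, (fun i : Fin 5 => x (i - 1)) ∈ H) :
    H = ⊤ ∨
    ∃ α : Fin 5 → (S ≃* S), α 0 = MulEquiv.refl S ∧
      (H : Set (Fin 5 → S)) = Set.range (fun x : S => fun i : Fin 5 => α i x) := by
  have hsurj' (j : Fin 5) (s : S) : ∃ h ∈ H, h j = s := by
    obtain ⟨h, hs⟩ := hsurj j s
    exact ⟨h, h.2, hs⟩
  by_cases hpair : ∀ i j, i ≠ j → H.coordinateImage {i} j = ⊤
  · exact Or.inl (Subgroup.eq_top_of_coordinateImage_singleton hnab hsurj' hpair)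
  · push Not at hpair
    obtain ⟨i, j, hij, htop⟩ := hpair
    have hbot := (Subgroup.coordinateImage_normal (hsurj' j) {i}).eq_bot_or_eq_top.resolve_right
      htop
    refine Or.inr (Subgroup.exists_eq_range_of_coordinate_injective 0 hsurj'
      (Subgroup.coordinate_eq_one_of_shift_mem hshift hij fun h hH hi => ?_))
    rw [← Subgroup.mem_bot, ← hbot]
    exact Subgroup.mem_coordinateImage.2 ⟨h, hH, by simpa using hi, rfl⟩
end

section
/- Let q = 3^27 and let G be a subgroup of PGL₂(F_q). If G contains an element of order q − 1 and an element of order (q + 1)/4 (note 4 divides q + 1 since 3^27 ≡ 3 (mod 4)), then G = PGL₂(F_q). -/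
/-- `PGL₂(F)`: the quotient of `GL₂(F)` by its center. -/
abbrev PGL2 (F : Type) [Field F] : Type :=
  (Matrix.GeneralLinearGroup (Fin 2) F) ⧸ Subgroup.center (Matrix.GeneralLinearGroup (Fin 2) F)

section

open Matrix Polynomial

theorem fin_two_matrix_congr {R : Type*} {a b c d a' b' c' d' : R} (ha : a = a') (hb : b = b')
    (hc : c = c') (hd : d = d') : !![a, b; c, d] = !![a', b'; c', d'] := by
  subst ha hb hc hd
  rfl

section Generation

variable {F : Type*} [Field F]

/-- A set of `2 × 2` matrices that is closed under products and adjugates and contains all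
invertible diagonal matrices, such as the set of matrices in a subgroup of `GL₂(F)` that contains
the diagonal torus. -/
structure IsTorusStable (S : Set (Matrix (Fin 2) (Fin 2) F)) : Prop where
  mul_mem : ∀ {m n}, m ∈ S → n ∈ S → m * n ∈ S
  adjugate_mem : ∀ {m}, m ∈ S → m.adjugate ∈ S
  diag_mem : ∀ {a d : F}, a ≠ 0 → d ≠ 0 → !![a, 0; 0, d] ∈ S

theorem exists_eval_ne_zero_of_natDegree_lt [Finite F] {f : F[X]} (hf : f ≠ 0)
    (h : f.natDegree < Nat.card F) : ∃ x, f.eval x ≠ 0 :=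
  f.exists_eval_ne_zero_of_natDegree_lt_card hf (by
    rw [← Nat.cast_card]; exact_mod_cast h)

namespace IsTorusStable

variable {S : Set (Matrix (Fin 2) (Fin 2) F)}

theorem exists_upper_mem [Finite F] (hS : IsTorusStable S) (hF : 5 < Nat.card F)
    {a b c d : F} (hm : !![a, b; c, d] ∈ S) (hdet : a * d - b * c ≠ 0)
    (ha : a ≠ 0) (hb : b ≠ 0) (hd : d ≠ 0) :
    ∃ x y z : F, y ≠ 0 ∧ !![x, y; 0, z] ∈ S := by
  have had : a * d ≠ 0 := mul_ne_zero ha hd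
  have h1 : (X - C 1 : F[X]) ≠ 0 := X_sub_C_ne_zero 1
  have h2 : (C (a * d) * X + C (-(b * c)) : F[X]) ≠ 0 := fun h => by
    have := congrArg (fun f => coeff f 1) h
    simp [ha, hd, coeff_C] at this
  have h3 : (C (a * d) * X ^ 2 + C (-(a * d + b * c)) * X + C (a * d) : F[X]) ≠ 0 := fun h => by
    have := congrArg (fun f => coeff f 0) h
    simp [ha, hd] at this
  obtain ⟨x, hx⟩ := exists_eval_ne_zero_of_natDegree_lt
    (mul_ne_zero (mul_ne_zero (mul_ne_zero X_ne_zero h1) h2) h3)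
    (lt_of_le_of_lt (by compute_degree) hF)
  simp only [eval_mul, eval_add, eval_sub, eval_pow, eval_X, eval_C, mul_ne_zero_iff] at hx
  obtain ⟨⟨⟨hx0, hx1⟩, hx2⟩, hx3⟩ := hx
  have hconj := hS.mul_mem (hS.mul_mem hm (hS.diag_mem hx0 one_ne_zero)) (hS.adjugate_mem hm)
  have hy1 : d ^ 2 * (1 - x) ≠ 0 :=
    mul_ne_zero (pow_ne_zero 2 hd) (fun h => hx1 (by linear_combination -h))
  have hprod := hS.mul_mem (hS.mul_mem hm (hS.diag_mem hy1 hx2)) hconj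
  refine ⟨a * (d ^ 2 * (1 - x)) * (a * x * d - b * c) +
      b * (a * d * x + -(b * c)) * (c * d * (x - 1)),
    b * ((a * d - b * c) * (a * d * x ^ 2 + -(a * d + b * c) * x + a * d)),
    c * (d ^ 2 * (1 - x)) * (a * b * (1 - x)) + d * (a * d * x + -(b * c)) * (a * d - c * b * x),
    mul_ne_zero hb (mul_ne_zero hdet hx3), ?_⟩
  convert hprod using 1
  simp only [adjugate_fin_two_of, mul_fin_two]
  apply fin_two_matrix_congr <;> ring

theorem exists_upper_mem_of_not_monomial [Finite F] (hS : IsTorusStable S) (hF : 5 < Nat.card F)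
    {a b c d : F} (hm : !![a, b; c, d] ∈ S) (hdet : a * d - b * c ≠ 0)
    (hb : b ≠ 0) (hc : c ≠ 0) (had : ¬(a = 0 ∧ d = 0)) :
    ∃ x y z : F, y ≠ 0 ∧ !![x, y; 0, z] ∈ S := by
  have key (e : F) : ∃ x : F, x ≠ 0 ∧ b * c * x + e ≠ 0 := by
    have h2 : (C (b * c) * X + C e : F[X]) ≠ 0 := fun h => by
      have := congrArg (fun f => coeff f 1) h
      simp [hb, hc, coeff_C] at this
    obtain ⟨x, hx⟩ := exists_eval_ne_zero_of_natDegree_lt (mul_ne_zero X_ne_zero h2)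
      (lt_of_le_of_lt (show _ ≤ 2 by compute_degree) (by lia))
    simp only [eval_mul, eval_add, eval_X, eval_C, mul_ne_zero_iff] at hx
    exact ⟨x, hx⟩
  by_cases ha : a = 0
  · subst ha
    have hd : d ≠ 0 := by simpa using had
    obtain ⟨x, hx0, hx⟩ := key (d ^ 2)
    have h := hS.mul_mem (hS.mul_mem hm (hS.diag_mem hx0 one_ne_zero)) hm
    have heq : !![0, b; c, d] * !![x, 0; 0, 1] * !![0, b; c, d] =
        !![b * c, b * d; c * d, b * c * x + d ^ 2] := by
      simp only [mul_fin_two]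
      apply fin_two_matrix_congr <;> ring
    rw [heq] at h
    refine hS.exists_upper_mem hF h ?_ (mul_ne_zero hb hc) (mul_ne_zero hb hd) hx
    rw [show b * c * (b * c * x + d ^ 2) - b * d * (c * d) = (b * c) ^ 2 * x by ring]
    exact mul_ne_zero (pow_ne_zero 2 (mul_ne_zero hb hc)) hx0
  by_cases hd : d = 0
  · subst hd
    obtain ⟨x, hx0, hx⟩ := key (a ^ 2)
    have h := hS.mul_mem (hS.mul_mem hm (hS.diag_mem one_ne_zero hx0)) hm
    have heq : !![a, b; c, 0] * !![1, 0; 0, x] * !![a, b; c, 0] =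
        !![b * c * x + a ^ 2, a * b; a * c, b * c] := by
      simp only [mul_fin_two]
      apply fin_two_matrix_congr <;> ring_nf
    rw [heq] at h
    refine hS.exists_upper_mem hF h ?_ hx (mul_ne_zero ha hb)
      (mul_ne_zero hb hc)
    rw [show (b * c * x + a ^ 2) * (b * c) - a * b * (a * c) = (b * c) ^ 2 * x by ring]
    exact mul_ne_zero (pow_ne_zero 2 (mul_ne_zero hb hc)) hx0
  exact hS.exists_upper_mem hF hm hdet ha hb hd

theorem unipotent_mem (hS : IsTorusStable S) {x y z : F} (hm : !![x, y; 0, z] ∈ S)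
    (hx : x ≠ 0) (hy : y ≠ 0) (hz : z ≠ 0) (t : F) : !![1, t; 0, 1] ∈ S := by
  by_cases ht : t = 0
  · subst ht
    exact hS.diag_mem one_ne_zero one_ne_zero
  have h := hS.mul_mem (hS.mul_mem (hS.diag_mem (div_ne_zero ht hy) (inv_ne_zero hz)) hm)
    (hS.diag_mem (a := y / (t * x)) (div_ne_zero hy (mul_ne_zero ht hx)) one_ne_zero)
  convert h using 1
  simp only [mul_fin_two]
  apply fin_two_matrix_congr <;> field_simp <;> ring

theorem mem_of_unipotent_mem (hS : IsTorusStable S) (hu : ∀ t : F, !![1, t; 0, 1] ∈ S)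
    {a b c d : F} (hm : !![a, b; c, d] ∈ S) (hdet : a * d - b * c ≠ 0) (hc : c ≠ 0)
    {x y z w : F} (hdet' : x * w - y * z ≠ 0) : !![x, y; z, w] ∈ S := by
  by_cases hz : z = 0
  · subst hz
    have hxw : x ≠ 0 ∧ w ≠ 0 := by simpa using hdet'
    have h := hS.mul_mem (hS.diag_mem hxw.1 hxw.2) (hu (y / x))
    convert h using 1
    have := hxw.1
    simp only [mul_fin_two]
    apply fin_two_matrix_congr <;> field_simp <;> ring
  · have hw := hS.mul_mem (hS.mul_mem (hu (-(a / c))) hm) (hu (-(d / c)))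
    have heq : !![1, -(a / c); 0, 1] * !![a, b; c, d] * !![1, -(d / c); 0, 1] =
        !![0, -((a * d - b * c) / c); c, 0] := by
      simp only [mul_fin_two]
      apply fin_two_matrix_congr <;> field_simp <;> ring
    rw [heq] at hw
    generalize a * d - b * c = D at hw hdet
    have h := hS.mul_mem (hS.mul_mem (hS.mul_mem (hu (x / z))
      (hS.diag_mem (a := (x * w - y * z) / z * (c / D)) (d := z / c)
        (mul_ne_zero (div_ne_zero hdet' hz) (div_ne_zero hc hdet)) (div_ne_zero hz hc)))
      hw) (hu (w / z))
    convert h using 1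
    simp only [mul_fin_two]
    apply fin_two_matrix_congr <;> field_simp <;> ring

/-- A torus-stable set with a matrix that neither fixes nor swaps the two points of the torus
contains every invertible matrix. -/
theorem mem_of_det_ne_zero [Finite F] (hS : IsTorusStable S) (hF : 5 < Nat.card F)
    {m : Matrix (Fin 2) (Fin 2) F} (hm : m ∈ S) (hdet : m.det ≠ 0) (hb : m 0 1 ≠ 0)
    (hc : m 1 0 ≠ 0) (had : ¬(m 0 0 = 0 ∧ m 1 1 = 0))
    (hS' : ∀ n ∈ S, n.det ≠ 0) {n : Matrix (Fin 2) (Fin 2) F} (hn : n.det ≠ 0) : n ∈ S := by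
  rw [det_fin_two] at hdet hn
  rw [eta_fin_two m] at hm
  obtain ⟨x, y, z, hy, h⟩ := hS.exists_upper_mem_of_not_monomial hF hm hdet hb hc had
  have hxz : x ≠ 0 ∧ z ≠ 0 := by simpa using hS' _ h
  rw [eta_fin_two n]
  exact hS.mem_of_unipotent_mem (hS.unipotent_mem h hxz.1 hy hxz.2) hm hdet hc hn

end IsTorusStable

end Generation

section Frobenius

variable {F : Type*} [Field F]

theorem aeval_eq_zero_of_charpoly_dvd {m : Matrix (Fin 2) (Fin 2) F} {f : F[X]}
    (h : m.charpoly ∣ f) : aeval m f = 0 := by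
  obtain ⟨g, rfl⟩ := h
  rw [map_mul, aeval_self_charpoly, zero_mul]

/-- A `2 × 2` matrix over a field with `q` elements that has no eigenvalue in this field has a
scalar `(q + 1)`-st power. -/
theorem exists_pow_card_add_one_eq_scalar [Finite F] {m : Matrix (Fin 2) (Fin 2) F}
    (hm : ∀ x, ¬ m.charpoly.IsRoot x) : ∃ c, m ^ (Nat.card F + 1) = scalar (Fin 2) c := by
  have hdeg : m.charpoly.natDegree = 2 := by simp [charpoly_natDegree_eq_dim]
  have hirr : Irreducible m.charpoly :=
    irreducible_of_degree_le_three_of_not_isRoot (by simp [hdeg]) hm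
  have : Fact (Irreducible m.charpoly) := ⟨hirr⟩
  let K := AdjoinRoot m.charpoly
  let B := AdjoinRoot.powerBasis' m.charpoly_monic
  have hrank : Module.finrank F K = 2 := by
    rw [B.finrank]; exact hdeg
  have : Module.Finite F K := B.finite
  have : Finite K := Module.finite_of_finite F
  have hnorm := FiniteField.algebraMap_norm_eq_pow_sum F K (AdjoinRoot.root m.charpoly)
  rw [hrank, Finset.sum_range_succ, Finset.sum_range_one, pow_zero, pow_one, add_comm] at hnorm
  refine ⟨Algebra.norm F (AdjoinRoot.root m.charpoly), ?_⟩
  have hdvd : m.charpoly ∣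
      X ^ (Nat.card F + 1) - C (Algebra.norm F (AdjoinRoot.root m.charpoly)) := by
    rw [← AdjoinRoot.mk_eq_zero, map_sub, map_pow, AdjoinRoot.mk_X, ← hnorm]
    exact sub_self _
  have := aeval_eq_zero_of_charpoly_dvd hdvd
  rw [map_sub, map_pow, aeval_X, aeval_C, sub_eq_zero] at this
  exact this

theorem charpoly_eq_mul_of_isRoot {m : Matrix (Fin 2) (Fin 2) F} {x : F}
    (hx : m.charpoly.IsRoot x) : m.charpoly = (X - C x) * (X - C (m.trace - x)) := by
  rw [IsRoot.def, charpoly_fin_two] at hx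
  have hdet : m.det = x * (m.trace - x) := by
    simp at hx
    linear_combination hx
  rw [charpoly_fin_two, hdet]
  simp only [map_mul, map_sub]
  ring

/-- A `2 × 2` matrix with distinct eigenvalues in a field with `q` elements equals its `q`-th
power. -/
theorem pow_card_eq_self_of_charpoly_eq [Finite F] {m : Matrix (Fin 2) (Fin 2) F} {x y : F}
    (hxy : x ≠ y) (hm : m.charpoly = (X - C x) * (X - C y)) : m ^ Nat.card F = m := by
  have := Fintype.ofFinite F
  have hroot (z : F) : X - C z ∣ X ^ Nat.card F - X := by
    rw [dvd_iff_isRoot, IsRoot.def, Nat.card_eq_fintype_card]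
    simp [FiniteField.pow_card]
  have hdvd : m.charpoly ∣ X ^ Nat.card F - X := by
    rw [hm]
    exact (isCoprime_X_sub_C_of_isUnit_sub (sub_ne_zero.2 hxy).isUnit).mul_dvd (hroot x) (hroot y)
  have := aeval_eq_zero_of_charpoly_dvd hdvd
  rwa [map_sub, map_pow, aeval_X, sub_eq_zero] at this

/-- In characteristic `p`, a `2 × 2` matrix with a repeated eigenvalue has a scalar `p`-th
power. -/
theorem pow_char_eq_scalar_of_charpoly_eq {p : ℕ} [Fact p.Prime] [CharP F p]
    {m : Matrix (Fin 2) (Fin 2) F} {x : F} (hm : m.charpoly = (X - C x) * (X - C x)) :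
    m ^ p = scalar (Fin 2) (x ^ p) := by
  have hdvd : m.charpoly ∣ X ^ p - C (x ^ p) := by
    rw [hm, C_pow, ← sub_pow_char, ← sq]
    exact pow_dvd_pow _ (Fact.out : p.Prime).two_le
  have := aeval_eq_zero_of_charpoly_dvd hdvd
  rw [map_sub, map_pow, aeval_X, aeval_C, sub_eq_zero] at this
  exact this

/-- A `2 × 2` matrix with distinct eigenvalues is diagonalizable. -/
theorem exists_mul_eq_mul_diag_of_charpoly_eq {m : Matrix (Fin 2) (Fin 2) F} {x y : F}
    (hxy : x ≠ y) (hm : m.charpoly = (X - C x) * (X - C y)) :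
    ∃ P : Matrix (Fin 2) (Fin 2) F, P.det ≠ 0 ∧ m * P = P * !![x, 0; 0, y] := by
  have heig (z : F) (hz : m.charpoly.eval z = 0) : ∃ v ≠ 0, m *ᵥ v = z • v := by
    rw [eval_charpoly] at hz
    obtain ⟨v, hv, h⟩ := exists_mulVec_eq_zero_iff.2 hz
    refine ⟨v, hv, ?_⟩
    rw [sub_mulVec, sub_eq_zero] at h
    rw [← h, scalar_apply, ← smul_one_eq_diagonal, smul_mulVec, one_mulVec]
  obtain ⟨v, hv, hmv⟩ := heig x (by simp [hm])
  obtain ⟨w, hw, hmw⟩ := heig y (by simp [hm])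
  have hv0 := congrFun hmv 0
  have hv1 := congrFun hmv 1
  have hw0 := congrFun hmw 0
  have hw1 := congrFun hmw 1
  simp only [mulVec, dotProduct, Fin.sum_univ_two, Pi.smul_apply, smul_eq_mul] at hv0 hv1 hw0 hw1
  refine ⟨!![v 0, w 0; v 1, w 1], fun hdet => ?_, ?_⟩
  · rw [det_fin_two_of] at hdet
    have hxy' := sub_ne_zero.2 hxy
    have key (i j : Fin 2) : v i * w j = 0 := by
      have : (x - y) * (v i * w j) = 0 := by
        fin_cases i <;> fin_cases j <;> simp only [Fin.mk_zero, Fin.mk_one, Fin.isValue]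
        · linear_combination -w 0 * hv0 + v 0 * hw0 - m 0 1 * hdet
        · linear_combination -w 1 * hv0 + v 1 * hw0 + (m 0 0 - y) * hdet
        · linear_combination -w 0 * hv1 + v 0 * hw1 + (y - m 1 1) * hdet
        · linear_combination -w 1 * hv1 + v 1 * hw1 + m 1 0 * hdet
      exact (mul_eq_zero.1 this).resolve_left hxy'
    obtain ⟨i, hi⟩ := Function.ne_iff.1 hv
    obtain ⟨j, hj⟩ := Function.ne_iff.1 hw
    exact mul_ne_zero hi hj (key i j)
  · rw [eta_fin_two m]
    simp only [mul_fin_two]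
    apply fin_two_matrix_congr
    · linear_combination hv0
    · linear_combination hw0
    · linear_combination hv1
    · linear_combination hw1

end Frobenius

section PGL2

variable {F : Type} [Field F]

/-- The matrices in a subgroup of `GL₂(F)` that contains the diagonal torus. -/
theorem isTorusStable_coe_image {H : Subgroup (GL (Fin 2) F)}
    (hH : ∀ g : GL (Fin 2) F, ∀ a d : F, (g : Matrix (Fin 2) (Fin 2) F) = !![a, 0; 0, d] → g ∈ H) :
    IsTorusStable ((fun g : GL (Fin 2) F => (g : Matrix (Fin 2) (Fin 2) F)) '' H) := by
  have hdiag {a d : F} (ha : a ≠ 0) (hd : d ≠ 0) :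
      ∃ g ∈ H, (g : Matrix (Fin 2) (Fin 2) F) = !![a, 0; 0, d] :=
    ⟨.mkOfDetNeZero !![a, 0; 0, d] (by simp [ha, hd]), hH _ a d rfl, rfl⟩
  refine ⟨?_, ?_, fun ha hd => hdiag ha hd⟩
  · rintro _ _ ⟨g, hg, rfl⟩ ⟨h, hh, rfl⟩
    exact ⟨g * h, H.mul_mem hg hh, rfl⟩
  · rintro _ ⟨g, hg, rfl⟩
    have hdet : (g : Matrix (Fin 2) (Fin 2) F).det ≠ 0 := g.det_ne_zero
    obtain ⟨s, hs, hs'⟩ := hdiag hdet hdet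
    refine ⟨s * g⁻¹, H.mul_mem hs (H.inv_mem hg), ?_⟩
    have hscalar : (s : Matrix (Fin 2) (Fin 2) F) = (g : Matrix (Fin 2) (Fin 2) F).det • 1 := by
      rw [hs', one_fin_two, smul_of]
      simp
    simp only [Units.val_mul, coe_units_inv, hscalar, inv_def, smul_mul, one_mul, smul_smul,
      Ring.inverse_eq_inv', mul_inv_cancel₀ hdet, one_smul]

theorem PGL2.mk_pow_eq_one_iff {g : GL (Fin 2) F} {n : ℕ} :
    (QuotientGroup.mk g : PGL2 F) ^ n = 1 ↔
      ∃ c, (g : Matrix (Fin 2) (Fin 2) F) ^ n = scalar (Fin 2) c := by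
  rw [← QuotientGroup.mk_pow, QuotientGroup.eq_one_iff,
    GeneralLinearGroup.mem_center_iff_val_mem_range_scalar]
  simp [eq_comm]

/-- An eigenvalue of multiplicity two forces the order in `PGL₂(F)` to divide the
characteristic. -/
theorem PGL2.ne_trace_sub_of_isRoot {p : ℕ} [Fact p.Prime] [CharP F p] {g : GL (Fin 2) F}
    (hg : ¬ orderOf (QuotientGroup.mk g : PGL2 F) ∣ p) {x : F}
    (hx : (g : Matrix (Fin 2) (Fin 2) F).charpoly.IsRoot x) :
    x ≠ (g : Matrix (Fin 2) (Fin 2) F).trace - x := fun h => by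
  have hchar := charpoly_eq_mul_of_isRoot hx
  rw [← h] at hchar
  exact hg (orderOf_dvd_of_pow_eq_one
    (mk_pow_eq_one_iff.2 ⟨_, pow_char_eq_scalar_of_charpoly_eq (p := p) hchar⟩))

variable [Finite F]

/-- An element of `PGL₂(F)` whose order does not divide `q + 1` lifts to a matrix with an
eigenvalue in `F`. -/
theorem PGL2.exists_isRoot_charpoly {g : GL (Fin 2) F}
    (hg : ¬ orderOf (QuotientGroup.mk g : PGL2 F) ∣ Nat.card F + 1) :
    ∃ x, (g : Matrix (Fin 2) (Fin 2) F).charpoly.IsRoot x := by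
  by_contra! h
  exact hg (orderOf_dvd_of_pow_eq_one
    (mk_pow_eq_one_iff.2 (exists_pow_card_add_one_eq_scalar h)))

/-- An element of `PGL₂(F)` whose order divides neither `q - 1` nor the characteristic lifts to a
matrix without eigenvalues in `F`. -/
theorem PGL2.not_isRoot_charpoly {p : ℕ} [Fact p.Prime] [CharP F p] {g : GL (Fin 2) F}
    (hg : ¬ orderOf (QuotientGroup.mk g : PGL2 F) ∣ Nat.card F - 1)
    (hg' : ¬ orderOf (QuotientGroup.mk g : PGL2 F) ∣ p) (x : F) :
    ¬ (g : Matrix (Fin 2) (Fin 2) F).charpoly.IsRoot x := fun hx => by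
  have h := pow_card_eq_self_of_charpoly_eq (ne_trace_sub_of_isRoot hg' hx)
    (charpoly_eq_mul_of_isRoot hx)
  rw [← Units.val_pow_eq_pow_val, Units.val_inj] at h
  have h1 : g ^ (Nat.card F - 1) = 1 := by
    rw [← mul_eq_right (b := g), ← pow_succ, Nat.sub_add_cancel Nat.card_pos, h]
  apply hg
  rw [orderOf_dvd_iff_pow_eq_one, ← QuotientGroup.mk_pow, h1]
  rfl

/-- An element of order `q - 1` of a subgroup of `PGL₂(F)` generates a split torus. -/
theorem PGL2.exists_conj_torus_mem {p : ℕ} [Fact p.Prime] [CharP F p] {G : Subgroup (PGL2 F)}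
    {g : PGL2 F} (hgG : g ∈ G) (hg : orderOf g = Nat.card F - 1)
    (h1 : ¬ Nat.card F - 1 ∣ Nat.card F + 1) (hp : ¬ Nat.card F - 1 ∣ p) :
    ∃ P : GL (Fin 2) F, ∀ t : GL (Fin 2) F, ∀ a d : F,
      (t : Matrix (Fin 2) (Fin 2) F) = !![a, 0; 0, d] →
        (QuotientGroup.mk (P * t * P⁻¹) : PGL2 F) ∈ G := by
  obtain ⟨m, rfl⟩ := QuotientGroup.mk_surjective g
  obtain ⟨x, hx⟩ := exists_isRoot_charpoly (hg ▸ h1)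
  have hxy := ne_trace_sub_of_isRoot (hg ▸ hp) hx
  have hchar := charpoly_eq_mul_of_isRoot hx
  generalize (m : Matrix (Fin 2) (Fin 2) F).trace - x = y at hxy hchar
  obtain ⟨P₀, hP₀, hmP⟩ := exists_mul_eq_mul_diag_of_charpoly_eq hxy hchar
  have hdet := congrArg det hmP
  rw [det_mul, det_mul, mul_comm, mul_right_inj' hP₀, det_fin_two_of] at hdet
  have hxy0 : x ≠ 0 ∧ y ≠ 0 := by
    have := m.det_ne_zero
    rw [hdet] at this
    simpa using this
  let P : GL (Fin 2) F := .mkOfDetNeZero P₀ hP₀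
  let D : GL (Fin 2) F := .mkOfDetNeZero !![x, 0; 0, y] (by simp [hxy0])
  have hm : m = P * D * P⁻¹ := by
    rw [eq_mul_inv_iff_mul_eq]
    exact Units.ext hmP
  have hDpow (k : ℕ) : ((D ^ k : GL (Fin 2) F) : Matrix (Fin 2) (Fin 2) F) =
      !![x ^ k, 0; 0, y ^ k] := by
    induction k with
    | zero => simp [one_fin_two]
    | succ k ih =>
      rw [pow_succ, Units.val_mul, ih]
      change _ * !![x, 0; 0, y] = _
      simp [pow_succ]
  let ζ : Fˣ := Units.mk0 x hxy0.1 / Units.mk0 y hxy0.2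
  have hζ : orderOf ζ = Nat.card Fˣ := by
    refine Nat.dvd_antisymm (orderOf_dvd_natCard ζ) ?_
    rw [Nat.card_units, ← hg, orderOf_dvd_iff_pow_eq_one]
    have h := congrArg Units.val (pow_orderOf_eq_one ζ)
    simp only [ζ, div_pow, Units.val_div_eq_div_val, Units.val_pow_eq_pow_val, Units.val_mk0,
      Units.val_one] at h
    rw [div_eq_one_iff_eq (pow_ne_zero _ hxy0.2)] at h
    rw [← QuotientGroup.mk_pow, QuotientGroup.eq_one_iff, hm, conj_pow]
    refine (Subgroup.center (GL (Fin 2) F)).normal_of_characteristic.conj_mem _ ?_ _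
    rw [GeneralLinearGroup.mem_center_iff_val_mem_range_scalar, hDpow, ← h]
    exact ⟨x ^ orderOf ζ, by ext i j; fin_cases i <;> fin_cases j <;> simp [ζ]⟩
  refine ⟨P, fun t a d ht => ?_⟩
  have had : a ≠ 0 ∧ d ≠ 0 := by
    have := t.det_ne_zero
    rw [ht] at this
    simpa using this
  obtain ⟨k, hk⟩ : ∃ k : ℕ, ζ ^ k = Units.mk0 a had.1 / Units.mk0 d had.2 := by
    have hmem : Units.mk0 a had.1 / Units.mk0 d had.2 ∈ Subgroup.zpowers ζ := by
      rw [Subgroup.eq_top_of_card_eq (Subgroup.zpowers ζ) (by rw [Nat.card_zpowers, hζ])]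
      trivial
    exact mem_powers_iff_mem_zpowers.2 hmem
  have hk := congrArg Units.val hk
  simp only [ζ, div_pow, Units.val_div_eq_div_val, Units.val_pow_eq_pow_val, Units.val_mk0] at hk
  rw [div_eq_div_iff (pow_ne_zero _ hxy0.2) had.2] at hk
  have hquot : (QuotientGroup.mk (P * t * P⁻¹) : PGL2 F) = QuotientGroup.mk m ^ k := by
    rw [← QuotientGroup.mk_pow, hm, conj_pow, QuotientGroup.eq,
      show (P * t * P⁻¹)⁻¹ * (P * D ^ k * P⁻¹) = P * (t⁻¹ * D ^ k) * P⁻¹ by group]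
    refine (Subgroup.center (GL (Fin 2) F)).normal_of_characteristic.conj_mem _ ?_ _
    rw [GeneralLinearGroup.mem_center_iff_val_mem_range_scalar]
    refine ⟨y ^ k / d, ?_⟩
    rw [Units.val_mul, hDpow, ← Units.inv_mul_eq_iff_eq_mul, inv_inv, ht]
    have := had.2
    ext i j
    fin_cases i <;> fin_cases j <;> simp [mul_apply] <;> field_simp
    linear_combination -hk
  rw [hquot]
  exact G.pow_mem hgG k

/-- A subgroup of `PGL₂(F)` with an element of order `q - 1` and an element whose order divides
none of `q - 1`, `2` and the characteristic is all of `PGL₂(F)`. -/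
theorem PGL2.eq_top_of_orderOf {p : ℕ} [Fact p.Prime] [CharP F p] (hF : 5 < Nat.card F)
    {G : Subgroup (PGL2 F)} {g h : PGL2 F} (hgG : g ∈ G) (hg : orderOf g = Nat.card F - 1)
    (h1 : ¬ Nat.card F - 1 ∣ Nat.card F + 1) (hp : ¬ Nat.card F - 1 ∣ p) (hhG : h ∈ G)
    (hh1 : ¬ orderOf h ∣ Nat.card F - 1) (hh2 : ¬ orderOf h ∣ 2) (hhp : ¬ orderOf h ∣ p) :
    G = ⊤ := by
  obtain ⟨P, hP⟩ := exists_conj_torus_mem (p := p) hgG hg h1 hp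
  let f : GL (Fin 2) F →* PGL2 F := (QuotientGroup.mk' _).comp (MulAut.conj P).toMonoidHom
  have hf : Function.Surjective f :=
    (QuotientGroup.mk'_surjective _).comp (MulAut.conj P).surjective
  have hS := isTorusStable_coe_image (H := G.comap f) hP
  obtain ⟨m, rfl⟩ := hf h
  have horder : orderOf (f m) = orderOf (QuotientGroup.mk m : PGL2 F) := by
    change orderOf ((QuotientGroup.mk (P * m * P⁻¹)) : PGL2 F) = _
    rw [QuotientGroup.mk_mul, QuotientGroup.mk_mul, QuotientGroup.mk_inv]
    exact MulEquiv.orderOf_eq (MulAut.conj (QuotientGroup.mk P : PGL2 F)) (QuotientGroup.mk m)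
  rw [horder] at hh1 hh2 hhp
  have hroot := not_isRoot_charpoly (p := p) hh1 hhp
  have heval (x : F) : (m : Matrix (Fin 2) (Fin 2) F).charpoly.eval x =
      (x - m 0 0) * (x - m 1 1) - m 0 1 * m 1 0 := by
    rw [charpoly_fin_two, trace_fin_two, det_fin_two]
    simp
    ring
  rw [eq_top_iff]
  intro k _
  obtain ⟨n, rfl⟩ := hf k
  obtain ⟨n', hn', hnn'⟩ := hS.mem_of_det_ne_zero (m := m) (n := n) hF ⟨m, hhG, rfl⟩ m.det_ne_zero
    (fun hb => hroot (m 0 0) (by rw [IsRoot.def, heval, hb]; ring))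
    (fun hc => hroot (m 0 0) (by rw [IsRoot.def, heval, hc]; ring))
    (fun had => hh2 (orderOf_dvd_of_pow_eq_one (mk_pow_eq_one_iff.2 ⟨m 0 1 * m 1 0, by
      rw [sq, eta_fin_two (m : Matrix (Fin 2) (Fin 2) F), had.1, had.2, mul_fin_two]
      ext i j
      fin_cases i <;> fin_cases j <;> simp [mul_comm]⟩)))
    (by rintro _ ⟨n, -, rfl⟩; exact n.det_ne_zero) n.det_ne_zero
  rwa [Units.ext hnn'] at hn'

end PGL2

end

/-- Let `q = 3^27`.  A subgroup of `PGL₂(F_q)` containing an element of order `q - 1` and an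
element of order `(q + 1)/4` is all of `PGL₂(F_q)`. -/
theorem subgroup_of_PGL2_F3_27_with_elements_of_large_order
    (G : Subgroup (PGL2 (GaloisField 3 27)))
    (h1 : ∃ g ∈ G, orderOf g = 3 ^ 27 - 1)
    (h2 : ∃ g ∈ G, orderOf g = (3 ^ 27 + 1) / 4) :
    G = ⊤ := by
  have hcard : Nat.card (GaloisField 3 27) = 3 ^ 27 := GaloisField.card 3 27 (by norm_num)
  obtain ⟨g, hgG, hg⟩ := h1
  obtain ⟨h, hhG, hh⟩ := h2
  exact PGL2.eq_top_of_orderOf (p := 3) (by rw [hcard]; norm_num) hgG (by rw [hg, hcard])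
    (by rw [hcard]; norm_num) (by rw [hcard]; norm_num) hhG (by rw [hh, hcard]; norm_num)
    (by rw [hh]; norm_num) (by rw [hh]; norm_num)
end
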